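/- arXiv:1712.01251 — 2 statements merged into one kernel-verified Lean document; each statement's English description precedes it below -/
import Mathlib

section
/- Let n > 1 and let u ∈ BV_loc(ℝ^n, ℝ^N), i.e., u ∈ L¹_loc and its distributional gradient Du is an ℝ^{N×n}-valued Radon measure. Then u is L^{n/(n−1),1}-differentiable at ℒ^n-almost every x ∈ ℝ^n. -/
open MeasureTheory Metric Filter
open scoped ENNReal RealInnerProductSpace Topology

noncomputable section

/-- Euclidean space `ℝ^n`. -/
abbrev Euc (n : ℕ) : Type := EuclideanSpace ℝ (Fin n)

/-- The `i`-th standard basis vector of `ℝ^n`. -/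
def stdVec (n : ℕ) (i : Fin n) : Euc n := EuclideanSpace.single i (1 : ℝ)

/-- Coefficients `A_I : V →ₗ W` (indexed by `I : Fin k → Fin n`) of a homogeneous linear
constant-coefficient differential operator `𝒜 u = ∑_I A_I ∂_I u` of order `k` on `ℝ^n`. -/
abbrev CoeffOp (n k : ℕ) (V W : Type*) [NormedAddCommGroup V] [InnerProductSpace ℝ V]
    [NormedAddCommGroup W] [InnerProductSpace ℝ W] : Type _ :=
  (Fin k → Fin n) → (V →ₗ[ℝ] W)

variable {V W F : Type*}
  [NormedAddCommGroup V] [InnerProductSpace ℝ V] [FiniteDimensional ℝ V]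
  [NormedAddCommGroup W] [InnerProductSpace ℝ W] [FiniteDimensional ℝ W]

/-- The coefficients represent a linear map on symmetric tensors `V ⊙^k ℝ^n`. -/
def IsSymmetricOp (n k : ℕ) (A : CoeffOp n k V W) : Prop :=
  ∀ (I : Fin k → Fin n) (σ : Equiv.Perm (Fin k)), A (I ∘ σ) = A I

/-- The symbol `𝒜[ξ] v = A (v ⊗^k ξ) = ∑_I (∏ i, ξ_{I i}) A_I v`. -/
def symbolMap (n k : ℕ) (A : CoeffOp n k V W) (ξ : Euc n) : V →ₗ[ℝ] W :=
  ∑ I : Fin k → Fin n, (∏ i, ξ (I i)) • A I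

/-- Ellipticity: the symbol is injective for all `ξ ≠ 0`. -/
def IsElliptic (n k : ℕ) (A : CoeffOp n k V W) : Prop :=
  ∀ ξ : Euc n, ξ ≠ 0 → Function.Injective (symbolMap n k A ξ)

/-- Van Schaftingen's cancellation condition: `⋂_{ξ ∈ 𝕊^{n-1}} im 𝒜[ξ] = {0}`. -/
def IsCanceling (n k : ℕ) (A : CoeffOp n k V W) : Prop :=
  (⋂ ξ ∈ sphere (0 : Euc n) 1, (LinearMap.range (symbolMap n k A ξ) : Set W)) = {0}

/-- Inverse of an endomorphism (junk value when not invertible), via matrix inversion. -/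
def linInv (f : V →ₗ[ℝ] V) : V →ₗ[ℝ] V :=
  letI b := Module.finBasis ℝ V
  Matrix.toLin b b ((LinearMap.toMatrix b b f)⁻¹)

/-- `𝒜†[ξ] = (𝒜*[ξ] 𝒜[ξ])⁻¹ 𝒜*[ξ]`. -/
def Adagger (n k : ℕ) (A : CoeffOp n k V W) (ξ : Euc n) : W →ₗ[ℝ] V :=
  linInv (LinearMap.adjoint (symbolMap n k A ξ) ∘ₗ symbolMap n k A ξ) ∘ₗ
    LinearMap.adjoint (symbolMap n k A ξ)

/-- Condition (WC): for every `w ∈ ⋂_{ξ ∈ 𝕊^{n-1}} im 𝒜[ξ]`,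
`∫_{𝕊^{n-1}} 𝒜†[ξ] w ⊗^{k-n} ξ dℋ^{n-1}(ξ) = 0`, written componentwise in the
tensor coordinates indexed by `J : Fin (k-n) → Fin n`. -/
def IsWeaklyCanceling (n k : ℕ) (A : CoeffOp n k V W) : Prop :=
  ∀ w : W, (∀ ξ ∈ sphere (0 : Euc n) 1, w ∈ LinearMap.range (symbolMap n k A ξ)) →
    ∀ J : Fin (k - n) → Fin n,
      (∫ ξ in sphere (0 : Euc n) 1,
        (∏ i, ξ (J i)) • (Adagger n k A ξ w) ∂(μH[(n : ℝ) - 1])) = 0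

section TestFun

variable [NormedAddCommGroup F] [NormedSpace ℝ F]

/-- Compactly supported smooth test function. -/
def IsTestFun (n : ℕ) (φ : Euc n → F) : Prop :=
  ContDiff ℝ (⊤ : ℕ∞) φ ∧ HasCompactSupport φ

/-- Iterated directional derivative `∂_{I 0} ⋯ ∂_{I (m-1)} φ (x)`. -/
def dirDeriv (n m : ℕ) (I : Fin m → Fin n) (φ : Euc n → F) (x : Euc n) : F :=
  iteratedFDeriv ℝ m φ x (fun i => stdVec n (I i))

/-- Smooth functions of degree-`≤ j` polynomial type. -/
def IsPolyDeg (n : ℕ) (j : ℕ) (P : Euc n → F) : Prop :=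
  ContDiff ℝ (⊤ : ℕ∞) P ∧ ∀ x, iteratedFDeriv ℝ (j + 1) P x = 0

end TestFun

/-- Pointwise application of the operator `𝒜` to a smooth map. -/
def Aapply (n k : ℕ) (A : CoeffOp n k V W) (u : Euc n → V) (x : Euc n) : W :=
  ∑ I : Fin k → Fin n, A I (dirDeriv n k I u x)

/-- `𝒜 u = f σ` (a `W`-valued measure with total-variation measure `σ` and polar density `f`)
in the sense of distributions. -/
def HasDistribA (n k : ℕ) (A : CoeffOp n k V W) (u : Euc n → V) (σ : Measure (Euc n))
    (f : Euc n → W) : Prop :=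
  ∀ φ : Euc n → W, IsTestFun n φ →
    ((-1 : ℝ) ^ k) * (∑ I : Fin k → Fin n,
        ∫ x, ⟪u x, LinearMap.adjoint (A I) (dirDeriv n k I φ x)⟫) =
      ∫ x, ⟪f x, φ x⟫ ∂σ

/-- `u ∈ BV^𝒜_loc(ℝ^n)`: `u` is locally integrable and `𝒜 u` is a `W`-valued Radon measure,
given by its polar decomposition `f σ` with `σ` locally finite and `‖f‖ = 1` σ-a.e. -/
def MemBVAloc (n k : ℕ) (A : CoeffOp n k V W) (u : Euc n → V) : Prop :=
  LocallyIntegrable u volume ∧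
    ∃ (σ : Measure (Euc n)) (f : Euc n → W), IsLocallyFiniteMeasure σ ∧
      LocallyIntegrable f σ ∧ (∀ᵐ x ∂σ, ‖f x‖ = 1) ∧ HasDistribA n k A u σ f

/-- `v` is the family of weak derivatives of order `m` of `u` (componentwise, indexed by
`I : Fin m → Fin n`). -/
def IsWeakDerivFamily (n m : ℕ) (u : Euc n → V) (v : (Fin m → Fin n) → Euc n → V) : Prop :=
  (∀ I, LocallyIntegrable (v I) volume) ∧
    ∀ (I : Fin m → Fin n) (φ : Euc n → ℝ), IsTestFun n φ →
      ∫ x, (dirDeriv n m I φ x) • u x = ((-1 : ℝ) ^ m) • ∫ x, φ x • v I x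

/-- `Q r = o(r^a)` as `r ↓ 0`. -/
def SmallO (Q : ℝ → ℝ≥0∞) (a : ℝ) : Prop :=
  Tendsto (fun r => Q r / ENNReal.ofReal (r ^ a)) (𝓝[>] (0 : ℝ)) (𝓝 0)

section Spaces

variable [NormedAddCommGroup F] [NormedSpace ℝ F]

/-- `f ∈ t^{j,p}(x)`: there is a polynomial `P` of degree at most `j` with
`(⨍_{B_r(x)} |f - P|^p)^{1/p} = o(r^j)` as `r ↓ 0`. -/
def MemT (n : ℕ) (j : ℕ) (p : ℝ) (f : Euc n → F) (x : Euc n) : Prop :=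
  ∃ P : Euc n → F, IsPolyDeg n j P ∧
    SmallO (fun r => ((volume (ball x r))⁻¹ *
      ∫⁻ y in ball x r, (‖f y - P y‖₊ : ℝ≥0∞) ^ p) ^ (1 / p)) (j : ℝ)

/-- `f ∈ t^{j,∞}(x)`: there is a polynomial `P` of degree at most `j` with
`‖f - P‖_{L^∞(B_r(x))} = o(r^j)` as `r ↓ 0`. -/
def MemTInf (n : ℕ) (j : ℕ) (f : Euc n → F) (x : Euc n) : Prop :=
  ∃ P : Euc n → F, IsPolyDeg n j P ∧
    SmallO (fun r => essSup (fun y => (‖f y - P y‖₊ : ℝ≥0∞))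
      (volume.restrict (ball x r))) (j : ℝ)

/-- The Lorentz `L^{p,q}` quasi-norm (for `p, q < ∞`). -/
def lorentzNorm {α : Type*} [MeasurableSpace α] (p q : ℝ) (μ : Measure α) (f : α → F) : ℝ≥0∞ :=
  ENNReal.ofReal p ^ (1 / q) *
    (∫⁻ t in Set.Ioi (0 : ℝ),
      (ENNReal.ofReal t * (μ {x | t < ‖f x‖}) ^ (1 / p)) ^ q * (ENNReal.ofReal t)⁻¹) ^ (1 / q)

/-- `f` is `L^{p,q}`-differentiable of order `j` at `x`:
`‖f - P‖_{L^{p,q}(B_r(x))} = o(r^{j + n/p})` for a polynomial `P` of degree at most `j`. -/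
def MemTLorentz (n : ℕ) (j : ℕ) (p q : ℝ) (f : Euc n → F) (x : Euc n) : Prop :=
  ∃ P : Euc n → F, IsPolyDeg n j P ∧
    SmallO (fun r => lorentzNorm p q (volume.restrict (ball x r)) (fun y => f y - P y))
      ((j : ℝ) + n / p)

/-- `f ∈ L^p_loc`. -/
def LocLp (n : ℕ) (p : ℝ) (f : Euc n → F) : Prop :=
  ∀ K : Set (Euc n), IsCompact K → ∫⁻ x in K, (‖f x‖₊ : ℝ≥0∞) ^ p < ⊤

end Spaces

end

/-- The coefficients of the (full) gradient operator `D` on maps `ℝ^n → ℝ^N`,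
valued in `ℝ^{N × n}`. -/
noncomputable def gradCoeff (n N : ℕ) : CoeffOp n 1 (EuclideanSpace ℝ (Fin N)) (EuclideanSpace ℝ (Fin N × Fin n)) :=
  fun I =>
    (EuclideanSpace.equiv (Fin N × Fin n) ℝ).symm.toLinearEquiv.toLinearMap ∘ₗ
      (LinearMap.pi fun p : Fin N × Fin n =>
        if p.2 = I 0 then (LinearMap.proj p.1 : (Fin N → ℝ) →ₗ[ℝ] ℝ) else 0) ∘ₗ
      (EuclideanSpace.equiv (Fin N) ℝ).toLinearEquiv.toLinearMap

section LorentzSobolev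

theorem exists_bound_deriv_smoothTransition :
    ∃ K : NNReal, ∀ s ∈ Set.Icc (0 : ℝ) 3, ‖deriv Real.smoothTransition s‖ ≤ K := by
  have h : Continuous (deriv Real.smoothTransition) :=
    (Real.smoothTransition.contDiff (n := 1)).continuous_deriv le_rfl
  obtain ⟨K, hK⟩ := (isCompact_Icc (a := (0 : ℝ)) (b := 3)).exists_bound_of_continuousOn
    h.continuousOn
  exact ⟨K.toNNReal, fun s hs => (hK s hs).trans (Real.le_coe_toNNReal K)⟩

theorem lintegral_indicator_inv_le {a : ℝ} (ha : 0 ≤ a) :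
    ∫⁻ t in Set.Ioi (0 : ℝ),
      (Set.Icc a (2 * a)).indicator (fun s => (ENNReal.ofReal s)⁻¹) t ≤ 1 := by
  rcases ha.eq_or_lt with rfl | ha
  · refine (lintegral_mono_ae (g := fun _ => 0) ?_).trans (by simp)
    filter_upwards [ae_restrict_mem measurableSet_Ioi] with t ht
    rw [Set.indicator_of_notMem]
    simpa using ht.ne'
  · calc _ ≤ ∫⁻ t, (Set.Icc a (2 * a)).indicator (fun s => (ENNReal.ofReal a)⁻¹) t := by
          refine (setLIntegral_le_lintegral _ _).trans (lintegral_mono fun t => ?_)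
          refine Set.indicator_le_indicator' fun ht => ?_
          gcongr
          exact ht.1
      _ = (ENNReal.ofReal a)⁻¹ * ENNReal.ofReal a := by
          rw [lintegral_indicator_const measurableSet_Icc, Real.volume_Icc]
          congr 2; ring
      _ ≤ 1 := ENNReal.inv_mul_le_one _

variable {E F : Type*} [NormedAddCommGroup F]

/-- Smooth truncation of `v` at height `t`. -/
noncomputable def smoothTrunc (v : E → F) (t : ℝ) (x : E) : ℝ :=
  Real.smoothTransition (4 / t ^ 2 * ‖v x‖ ^ 2 - 1)

theorem hasCompactSupport_smoothTrunc [TopologicalSpace E] {v : E → F} (hv : HasCompactSupport v) (t : ℝ) :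
    HasCompactSupport (smoothTrunc v t) :=
  hv.comp_left (g := fun y => Real.smoothTransition (4 / t ^ 2 * ‖y‖ ^ 2 - 1))
    (by simp)

theorem smoothTrunc_eq_one {v : E → F} {t : ℝ} (ht : 0 < t) {x : E} (hx : t ≤ ‖v x‖) :
    smoothTrunc v t x = 1 := by
  apply Real.smoothTransition.one_of_one_le
  have : t ^ 2 ≤ ‖v x‖ ^ 2 := by gcongr
  have : 4 / t ^ 2 * t ^ 2 ≤ 4 / t ^ 2 * ‖v x‖ ^ 2 := by gcongr
  rw [div_mul_cancel₀ _ (by positivity)] at this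
  linarith

theorem smoothTrunc_eq_zero {v : E → F} {t : ℝ} (ht : 0 < t) {x : E} (hx : ‖v x‖ ≤ t / 2) :
    smoothTrunc v t x = 0 := by
  apply Real.smoothTransition.zero_of_nonpos
  have : ‖v x‖ ^ 2 ≤ (t / 2) ^ 2 := by gcongr
  have : 4 / t ^ 2 * ‖v x‖ ^ 2 ≤ 4 / t ^ 2 * (t / 2) ^ 2 := by gcongr
  have h : 4 / t ^ 2 * (t / 2) ^ 2 = 1 := by field_simp; norm_num
  linarith

variable [NormedAddCommGroup E] [NormedSpace ℝ E] [InnerProductSpace ℝ F]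

theorem contDiff_smoothTrunc {v : E → F} (hv : ContDiff ℝ 1 v) (t : ℝ) :
    ContDiff ℝ 1 (smoothTrunc v t) :=
  (Real.smoothTransition.contDiff (n := 1)).comp
    ((contDiff_const.mul (hv.norm_sq ℝ)).sub contDiff_const)

theorem enorm_fderiv_smoothTrunc_le {K : NNReal}
    (hK : ∀ s ∈ Set.Icc (0 : ℝ) 3, ‖deriv Real.smoothTransition s‖ ≤ K)
    {v : E → F} (hv : ContDiff ℝ 1 v) {t : ℝ} (ht : 0 < t) (x : E) :
    ‖fderiv ℝ (smoothTrunc v t) x‖ₑ ≤ 8 * K *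
      (Set.Icc ‖v x‖ (2 * ‖v x‖)).indicator (fun s => (ENNReal.ofReal s)⁻¹) t *
        ‖fderiv ℝ v x‖ₑ := by
  have hcv : Continuous fun y => ‖v y‖ := hv.continuous.norm
  by_cases h1 : ‖v x‖ < t / 2
  · have : smoothTrunc v t =ᶠ[𝓝 x] fun _ => 0 := by
      filter_upwards [hcv.continuousAt.eventually_lt continuousAt_const h1] with y hy
      exact smoothTrunc_eq_zero ht hy.le
    rw [this.fderiv_eq, fderiv_fun_const, ← ofReal_norm]
    simp
  by_cases h2 : t < ‖v x‖
  · have : smoothTrunc v t =ᶠ[𝓝 x] fun _ => 1 := by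
      filter_upwards [continuousAt_const.eventually_lt hcv.continuousAt h2] with y hy
      exact smoothTrunc_eq_one ht hy.le
    rw [this.fderiv_eq, fderiv_fun_const, ← ofReal_norm]
    simp
  push Not at h1 h2
  have hd := ((hv.differentiable one_ne_zero x).hasFDerivAt.norm_sq.const_mul
    (4 / t ^ 2)).sub_const 1
  have hs : HasDerivAt Real.smoothTransition
      (deriv Real.smoothTransition (4 / t ^ 2 * ‖v x‖ ^ 2 - 1)) (4 / t ^ 2 * ‖v x‖ ^ 2 - 1) :=
    ((Real.smoothTransition.contDiff (n := 1)).differentiable (by simp) _).hasDerivAt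
  have hc := hs.comp_hasFDerivAt x hd
  have hmem : 4 / t ^ 2 * ‖v x‖ ^ 2 - 1 ∈ Set.Icc (0 : ℝ) 3 := by
    have e : (t / 2) ^ 2 ≤ ‖v x‖ ^ 2 := by gcongr
    have e' : ‖v x‖ ^ 2 ≤ t ^ 2 := by gcongr
    have a : 4 / t ^ 2 * (t / 2) ^ 2 ≤ 4 / t ^ 2 * ‖v x‖ ^ 2 := by gcongr
    have b : 4 / t ^ 2 * ‖v x‖ ^ 2 ≤ 4 / t ^ 2 * t ^ 2 := by gcongr
    have h : 4 / t ^ 2 * (t / 2) ^ 2 = 1 := by field_simp; norm_num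
    rw [div_mul_cancel₀ _ (by positivity)] at b
    constructor <;> linarith
  have hb : ‖fderiv ℝ (smoothTrunc v t) x‖ ≤ 8 * K * t⁻¹ * ‖fderiv ℝ v x‖ := by
    change HasFDerivAt (smoothTrunc v t) _ x at hc
    rw [hc.fderiv, norm_smul, norm_smul]
    have hn : ‖2 • (innerSL ℝ) (v x) ∘SL fderiv ℝ v x‖ ≤ 2 * (t * ‖fderiv ℝ v x‖) := by
      refine (norm_nsmul_le).trans ?_
      simp only [Nat.cast_ofNat]
      gcongr
      refine (ContinuousLinearMap.opNorm_comp_le _ _).trans ?_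
      rw [innerSL_apply_norm]
      gcongr
    calc _ ≤ K * (‖4 / t ^ 2‖ * (2 * (t * ‖fderiv ℝ v x‖))) := by
          gcongr
          exact hK _ hmem
      _ = _ := by
          rw [Real.norm_of_nonneg (by positivity)]
          field_simp; ring
  rw [Set.indicator_of_mem (by constructor <;> linarith)]
  have : ENNReal.ofReal (‖fderiv ℝ (smoothTrunc v t) x‖) ≤ ENNReal.ofReal _ :=
    ENNReal.ofReal_le_ofReal hb
  rw [ofReal_norm] at this
  refine this.trans_eq ?_
  rw [ENNReal.ofReal_mul (by positivity), ENNReal.ofReal_mul (by positivity),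
    ENNReal.ofReal_mul (by positivity), ofReal_norm, ENNReal.ofReal_inv_of_pos ht]
  simp

variable [MeasurableSpace E] [BorelSpace E] [FiniteDimensional ℝ E]

theorem rpow_measure_lt_norm_le {p : NNReal} (μ : Measure E) [μ.IsAddHaarMeasure]
    (hp : NNReal.HolderConjugate (Module.finrank ℝ E) p) {K : NNReal}
    (hK : ∀ s ∈ Set.Icc (0 : ℝ) 3, ‖deriv Real.smoothTransition s‖ ≤ K)
    {v : E → F} (hv : ContDiff ℝ 1 v) (hc : HasCompactSupport v) {t : ℝ} (ht : 0 < t) :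
    μ {x | t < ‖v x‖} ^ (1 / (p : ℝ)) ≤ eLpNormLESNormFDerivOneConst μ p * (8 * K) *
      ∫⁻ x, (Set.Icc ‖v x‖ (2 * ‖v x‖)).indicator (fun s => (ENNReal.ofReal s)⁻¹) t *
        ‖fderiv ℝ v x‖ₑ ∂μ := by
  have hw := contDiff_smoothTrunc hv t
  have hp0 : (p : ℝ) ≠ 0 := by exact_mod_cast hp.symm.ne_zero
  have h1 : μ {x | t < ‖v x‖} ≤ eLpNorm (smoothTrunc v t) p μ ^ (p : ℝ) := by
    refine le_trans (measure_mono ?_) ((meas_ge_le_mul_pow_eLpNorm_enorm (p := p) μ ?_ ?_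
      hw.continuous.aestronglyMeasurable (ε := 1) one_ne_zero (by simp)).trans_eq ?_)
    · intro x hx
      simp [smoothTrunc_eq_one ht (le_of_lt hx)]
    · exact_mod_cast hp.symm.ne_zero
    · simp
    · simp
  calc _ ≤ (eLpNorm (smoothTrunc v t) p μ ^ (p : ℝ)) ^ (1 / (p : ℝ)) := by gcongr
    _ = eLpNorm (smoothTrunc v t) p μ := by
        rw [← ENNReal.rpow_mul, mul_one_div_cancel hp0, ENNReal.rpow_one]
    _ ≤ _ := eLpNorm_le_eLpNorm_fderiv_one μ hw (hasCompactSupport_smoothTrunc hc t) hp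
    _ ≤ _ := by
        rw [mul_assoc, eLpNorm_one_eq_lintegral_enorm, ← lintegral_const_mul' (8 * (K : ℝ≥0∞)) _ (by finiteness)]
        gcongr with x
        rw [← mul_assoc]
        exact enorm_fderiv_smoothTrunc_le hK hv ht x

/-- The Lorentz refinement of the Gagliardo–Nirenberg–Sobolev inequality. -/
theorem exists_lintegral_rpow_measure_le {p : NNReal} (μ : Measure E) [μ.IsAddHaarMeasure]
    (hp : NNReal.HolderConjugate (Module.finrank ℝ E) p) :
    ∃ C : NNReal, ∀ v : E → F, ContDiff ℝ 1 v → HasCompactSupport v →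
      ∫⁻ t in Set.Ioi (0 : ℝ), μ {x | t < ‖v x‖} ^ (1 / (p : ℝ)) ≤
        C * ∫⁻ x, ‖fderiv ℝ v x‖ₑ ∂μ := by
  obtain ⟨K, hK⟩ := exists_bound_deriv_smoothTransition
  refine ⟨eLpNormLESNormFDerivOneConst μ p * (8 * K), fun v hv hc => ?_⟩
  have hmeas : Measurable fun z : ℝ × E =>
      (Set.Icc ‖v z.2‖ (2 * ‖v z.2‖)).indicator (fun s => (ENNReal.ofReal s)⁻¹) z.1 *
        ‖fderiv ℝ v z.2‖ₑ := by
    have hcv : Measurable fun z : ℝ × E => ‖v z.2‖ :=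
      (hv.continuous.norm.comp continuous_snd).measurable
    refine Measurable.mul ?_
      ((hv.continuous_fderiv one_ne_zero).enorm.comp continuous_snd).measurable
    have : (fun z : ℝ × E =>
      (Set.Icc ‖v z.2‖ (2 * ‖v z.2‖)).indicator (fun s => (ENNReal.ofReal s)⁻¹) z.1) =
      {z : ℝ × E | ‖v z.2‖ ≤ z.1 ∧ z.1 ≤ 2 * ‖v z.2‖}.indicator
        (fun z => (ENNReal.ofReal z.1)⁻¹) := by
      ext z; simp [Set.indicator]
    rw [this]
    refine Measurable.indicator (by fun_prop) ?_
    exact (measurableSet_le hcv measurable_fst).inter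
      (measurableSet_le measurable_fst (hcv.const_mul 2))
  calc _ ≤ ∫⁻ t in Set.Ioi (0 : ℝ), (eLpNormLESNormFDerivOneConst μ p * (8 * K)) *
      ∫⁻ x, (Set.Icc ‖v x‖ (2 * ‖v x‖)).indicator (fun s => (ENNReal.ofReal s)⁻¹) t *
        ‖fderiv ℝ v x‖ₑ ∂μ :=
        setLIntegral_mono' measurableSet_Ioi fun t ht => rpow_measure_lt_norm_le μ hp hK hv hc ht
    _ = (eLpNormLESNormFDerivOneConst μ p * (8 * K)) * ∫⁻ x, (∫⁻ t in Set.Ioi (0 : ℝ),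
      (Set.Icc ‖v x‖ (2 * ‖v x‖)).indicator (fun s => (ENNReal.ofReal s)⁻¹) t *
        ‖fderiv ℝ v x‖ₑ) ∂μ := by
        rw [lintegral_const_mul' _ _ (by finiteness), lintegral_lintegral_swap hmeas.aemeasurable]
    _ ≤ _ := by
        push_cast
        gcongr with x
        rw [lintegral_mul_const' _ _ (by finiteness)]
        exact (mul_le_mul_left (lintegral_indicator_inv_le (norm_nonneg _)) _).trans_eq
          (one_mul _)

end LorentzSobolev

section GradientGrowth

theorem setLIntegral_ball_add {E : Type*} [NormedAddCommGroup E] [MeasurableSpace E] [BorelSpace E]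
    (μ : Measure E) [μ.IsAddLeftInvariant] (G : E → ℝ≥0∞) (x : E) (S : ℝ) :
    ∫⁻ z in ball 0 S, G (x + z) ∂μ = ∫⁻ y in ball x S, G y ∂μ := by
  rw [← lintegral_indicator measurableSet_ball, ← lintegral_indicator measurableSet_ball,
    ← lintegral_add_left_eq_self ((ball x S).indicator G) x]
  congr 1 with z
  simp [Set.indicator]

variable {E F : Type*} [NormedAddCommGroup E] [NormedSpace ℝ E]
  [NormedAddCommGroup F] [NormedSpace ℝ F]

theorem enorm_le_lintegral_enorm_fderiv_smul {v : E → F} (hv : ContDiff ℝ 1 v)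
    (h0 : v 0 = 0) (z : E) :
    ‖v z‖ₑ ≤ ∫⁻ t in Set.Icc (0 : ℝ) 1, ‖fderiv ℝ v (t • z)‖ₑ * ‖z‖ₑ := by
  have hd : ∀ t : ℝ, HasDerivAt (fun t : ℝ => v (t • z)) (fderiv ℝ v (t • z) z) t := fun t => by
    have h1 : HasDerivAt (fun t : ℝ => t • z) z t := by
      simpa using (hasDerivAt_id t).smul_const z
    exact (hv.differentiable one_ne_zero (t • z)).hasFDerivAt.comp_hasDerivAt t h1
  have hc : ContDiff ℝ 1 fun t : ℝ => v (t • z) := hv.comp (contDiff_id.smul contDiff_const)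
  have := enorm_sub_le_lintegral_deriv_of_contDiffOn_Icc hc.contDiffOn zero_le_one
  simp only [one_smul, zero_smul, h0, sub_zero] at this
  refine this.trans (lintegral_mono fun t => ?_)
  rw [(hd t).deriv]
  exact ContinuousLinearMap.le_opENorm _ _

variable [MeasurableSpace E] [BorelSpace E] [FiniteDimensional ℝ E]
  (μ : Measure E) [μ.IsAddHaarMeasure]

theorem setLIntegral_ball_comp_smul {G : E → ℝ≥0∞} (hG : Measurable G) {t S : ℝ} (ht : 0 < t) :
    ∫⁻ z in ball 0 S, G (t • z) ∂μ =
      (ENNReal.ofReal t ^ Module.finrank ℝ E)⁻¹ * ∫⁻ z in ball 0 (t * S), G z ∂μ := by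
  have h : ∀ z, (ball (0 : E) S).indicator (fun z => G (t • z)) z =
      (ball (0 : E) (t * S)).indicator G (t • z) := fun z => by
    simp only [Set.indicator, mem_ball_zero_iff, norm_smul, Real.norm_of_nonneg ht.le,
      mul_lt_mul_iff_right₀ ht]
  rw [← lintegral_indicator measurableSet_ball, ← lintegral_indicator measurableSet_ball]
  simp_rw [h]
  rw [← lintegral_map (f := (ball (0 : E) (t * S)).indicator G)
    (hG.indicator measurableSet_ball) (measurable_const_smul t),
    Measure.map_addHaar_smul μ ht.ne', lintegral_smul_measure, smul_eq_mul,
    abs_of_nonneg (by positivity), ENNReal.ofReal_inv_of_pos (by positivity),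
    ENNReal.ofReal_pow ht.le]

theorem lintegral_ball_zero_enorm_le {v : E → F} (hv : ContDiff ℝ 1 v) (h0 : v 0 = 0)
    {M : ℝ≥0∞} {S : ℝ} (hS : 0 < S)
    (h : ∀ s, 0 < s → s ≤ S →
      ∫⁻ y in ball 0 s, ‖fderiv ℝ v y‖ₑ ∂μ ≤ M * ENNReal.ofReal s ^ Module.finrank ℝ E) :
    ∫⁻ y in ball 0 S, ‖v y‖ₑ ∂μ ≤ M * ENNReal.ofReal S ^ (Module.finrank ℝ E + 1) := by
  have hG : Continuous fun y => ‖fderiv ℝ v y‖ₑ := (hv.continuous_fderiv one_ne_zero).enorm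
  calc _ ≤ ∫⁻ z in ball 0 S, (∫⁻ t in Set.Icc (0 : ℝ) 1,
        ‖fderiv ℝ v (t • z)‖ₑ * ENNReal.ofReal S) ∂μ := by
        refine setLIntegral_mono' measurableSet_ball fun z hz => ?_
        refine (enorm_le_lintegral_enorm_fderiv_smul hv h0 z).trans
          (lintegral_mono fun t => ?_)
        dsimp only
        gcongr
        rw [← ofReal_norm]
        exact ENNReal.ofReal_le_ofReal (mem_ball_zero_iff.1 hz).le
    _ = ∫⁻ t in Set.Icc (0 : ℝ) 1, (∫⁻ z in ball 0 S, ‖fderiv ℝ v (t • z)‖ₑ ∂μ) *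
          ENNReal.ofReal S := by
        rw [lintegral_lintegral_swap]
        · simp_rw [lintegral_mul_const' _ _ ENNReal.ofReal_ne_top]
        · refine Measurable.aemeasurable ?_
          exact ((hG.comp (continuous_snd.smul continuous_fst)).measurable).mul_const _
    _ ≤ ∫⁻ t in Set.Icc (0 : ℝ) 1, M * ENNReal.ofReal S ^ (Module.finrank ℝ E + 1) := by
        have : ∀ᵐ t : ℝ ∂volume.restrict (Set.Icc (0 : ℝ) 1), t ≠ 0 := Measure.ae_ne _ 0
        refine lintegral_mono_ae ?_
        filter_upwards [this, ae_restrict_mem measurableSet_Icc] with t ht0 ht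
        have htp : 0 < t := lt_of_le_of_ne ht.1 ht0.symm
        rw [setLIntegral_ball_comp_smul μ hG.measurable htp, pow_succ, ← mul_assoc M]
        refine mul_le_mul_left ?_ _
        refine (mul_le_mul_right (h (t * S) (by positivity) ?_) _).trans_eq ?_
        · exact mul_le_of_le_one_left hS.le ht.2
        · rw [ENNReal.ofReal_mul htp.le, mul_pow, mul_left_comm, ← mul_assoc (_)⁻¹,
            ENNReal.inv_mul_cancel, one_mul]
          · simp [htp]
          · finiteness
    _ = _ := by simp

/-- A `C¹` map vanishing at `x` whose gradient has integral `O(s ^ d)` over balls centered at `x`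
has integral `O(S ^ (d + 1))`. -/
theorem lintegral_ball_enorm_le {v : E → F} (hv : ContDiff ℝ 1 v) {x : E} (h0 : v x = 0)
    {M : ℝ≥0∞} {S : ℝ} (hS : 0 < S)
    (h : ∀ s, 0 < s → s ≤ S →
      ∫⁻ y in ball x s, ‖fderiv ℝ v y‖ₑ ∂μ ≤ M * ENNReal.ofReal s ^ Module.finrank ℝ E) :
    ∫⁻ y in ball x S, ‖v y‖ₑ ∂μ ≤ M * ENNReal.ofReal S ^ (Module.finrank ℝ E + 1) := by
  have := lintegral_ball_zero_enorm_le μ (v := fun z => v (x + z))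
    (hv.comp (contDiff_const.add contDiff_id)) (by simpa using h0) (M := M) hS fun s hs hsS => by
      simp_rw [fderiv_comp_add_left]
      rw [setLIntegral_ball_add μ (fun y => ‖fderiv ℝ v y‖ₑ)]
      exact h s hs hsS
  rwa [setLIntegral_ball_add μ (fun y => ‖v y‖ₑ)] at this

end GradientGrowth
section LocalLorentz

variable {E : Type*} [NormedAddCommGroup E] [NormedSpace ℝ E] [FiniteDimensional ℝ E]

/-- Smooth cutoffs between concentric balls of radii `r` and `2 r`, with gradient `O(1 / r)`. -/
theorem exists_cutoff (E : Type*) [NormedAddCommGroup E] [NormedSpace ℝ E]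
    [FiniteDimensional ℝ E] : ∃ L : NNReal, ∀ (x : E) (r : ℝ), 0 < r → ∃ χ : E → ℝ,
      ContDiff ℝ 1 χ ∧ (∀ y ∈ ball x r, χ y = 1) ∧ (∀ y, ‖χ y‖ₑ ≤ 1) ∧
      (∀ y, 3 / 2 * r < dist y x → χ y = 0) ∧
      ∀ y, ‖fderiv ℝ χ y‖ₑ ≤ L * (ENNReal.ofReal r)⁻¹ := by
  let b : ContDiffBump (0 : E) := ⟨1, 3 / 2, one_pos, by norm_num⟩
  have hb : ContDiff ℝ 1 b := b.contDiff
  obtain ⟨L, hL⟩ := hb.lipschitzWith_of_hasCompactSupport b.hasCompactSupport one_ne_zero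
  refine ⟨L, fun x r hr => ⟨fun y => b (r⁻¹ • (y - x)), ?_, fun y hy => ?_, fun y => ?_,
    fun y hy => ?_, fun y => ?_⟩⟩
  · exact hb.comp ((contDiff_id.sub contDiff_const).const_smul _)
  · refine b.one_of_mem_closedBall (mem_closedBall_zero_iff.2 ?_)
    rw [norm_smul, norm_inv, Real.norm_of_nonneg hr.le, ← dist_eq_norm, inv_mul_le_iff₀ hr]
    simpa [b] using (mem_ball.1 hy).le
  · rw [← ofReal_norm, Real.norm_of_nonneg b.nonneg]
    exact ENNReal.ofReal_le_one.2 b.le_one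
  · refine b.zero_of_le_dist ?_
    rw [dist_zero_right, norm_smul, norm_inv, Real.norm_of_nonneg hr.le, ← dist_eq_norm,
      le_inv_mul_iff₀ hr]
    simp only [b]
    linarith
  · have hl : LipschitzWith (L * (Real.toNNReal r)⁻¹) fun y => b (r⁻¹ • (y - x)) := by
      refine LipschitzWith.of_dist_le_mul fun y z => (hL.dist_le_mul _ _).trans_eq ?_
      rw [dist_smul₀, dist_sub_right, norm_inv, Real.norm_of_nonneg hr.le]
      simp [hr.le, mul_assoc]
    have h1 := norm_fderiv_le_of_lipschitz ℝ hl (x₀ := y)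
    rw [← ofReal_norm]
    refine (ENNReal.ofReal_le_ofReal h1).trans_eq ?_
    rw [ENNReal.ofReal_coe_nnreal, ENNReal.coe_mul,
      ENNReal.coe_inv (by simpa using hr), ENNReal.ofReal]

variable {F : Type*} [NormedAddCommGroup F] [InnerProductSpace ℝ F]
  [MeasurableSpace E] [BorelSpace E]

theorem exists_lintegral_rpow_measure_ball_le {p : NNReal} (μ : Measure E) [μ.IsAddHaarMeasure]
    (hp : NNReal.HolderConjugate (Module.finrank ℝ E) p) :
    ∃ C : NNReal, ∀ v : E → F, ContDiff ℝ 1 v → ∀ x, v x = 0 → ∀ (M : ℝ≥0∞) (r : ℝ), 0 < r →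
      (∀ s, 0 < s → s ≤ 2 * r →
        ∫⁻ y in ball x s, ‖fderiv ℝ v y‖ₑ ∂μ ≤ M * ENNReal.ofReal s ^ Module.finrank ℝ E) →
      ∫⁻ t in Set.Ioi (0 : ℝ), μ.restrict (ball x r) {y | t < ‖v y‖} ^ (1 / (p : ℝ)) ≤
        C * (M * ENNReal.ofReal r ^ Module.finrank ℝ E) := by
  obtain ⟨C, hC⟩ := exists_lintegral_rpow_measure_le (F := F) μ hp
  obtain ⟨L, hL⟩ := exists_cutoff E
  refine ⟨C * (2 ^ Module.finrank ℝ E * (1 + L * 2)), fun v hv x hx M r hr h => ?_⟩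
  obtain ⟨χ, hχ, hχ1, hχle, hχ0, hχL⟩ := hL x r hr
  have hw : ContDiff ℝ 1 fun y => χ y • v y := hχ.smul hv
  have hwc : HasCompactSupport fun y => χ y • v y := by
    refine HasCompactSupport.intro (isCompact_closedBall x (3 / 2 * r)) fun y hy => ?_
    rw [hχ0 y (by simpa using hy), zero_smul]
  have hfd : ∀ y, ‖fderiv ℝ (fun y => χ y • v y) y‖ₑ ≤ (ball x (2 * r)).indicator
      (fun y => ‖fderiv ℝ v y‖ₑ + L * (ENNReal.ofReal r)⁻¹ * ‖v y‖ₑ) y := fun y => by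
    by_cases hy : y ∈ ball x (2 * r)
    · rw [Set.indicator_of_mem hy,
        fderiv_fun_smul (hχ.differentiable one_ne_zero y) (hv.differentiable one_ne_zero y)]
      refine (enorm_add_le (E := E →L[ℝ] F) _ _).trans ?_
      gcongr
      · rw [enorm_smul]
        exact mul_le_of_le_one_left' (hχle y)
      · rw [← ofReal_norm, ContinuousLinearMap.norm_smulRight_apply,
          ENNReal.ofReal_mul (norm_nonneg _), ofReal_norm, ofReal_norm]
        gcongr
        exact hχL y
    · have : (fun y => χ y • v y) =ᶠ[𝓝 y] fun _ => 0 := by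
        rw [mem_ball, not_lt] at hy
        filter_upwards [(continuous_id.dist continuous_const).continuousAt.eventually_const_lt
          (show 3 / 2 * r < dist y x by linarith)] with z hz
        rw [hχ0 z hz, zero_smul]
      rw [this.fderiv_eq, fderiv_fun_const, ← ofReal_norm]
      simp
  have hcv : Measurable fun y => ‖fderiv ℝ v y‖ₑ :=
    (hv.continuous_fderiv one_ne_zero).enorm.measurable
  have hrr : (ENNReal.ofReal r)⁻¹ * ENNReal.ofReal r = 1 :=
    ENNReal.inv_mul_cancel (by simpa using hr) ENNReal.ofReal_ne_top
  calc _ ≤ ∫⁻ t in Set.Ioi (0 : ℝ), μ {y | t < ‖χ y • v y‖} ^ (1 / (p : ℝ)) := by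
        refine lintegral_mono fun t => ?_
        refine ENNReal.rpow_le_rpow ?_ (by positivity)
        rw [Measure.restrict_apply (measurableSet_lt measurable_const hv.continuous.norm.measurable)]
        refine measure_mono fun y hy => ?_
        simpa [hχ1 y hy.2] using hy.1
    _ ≤ C * ∫⁻ y, ‖fderiv ℝ (fun y => χ y • v y) y‖ₑ ∂μ := hC _ hw hwc
    _ ≤ C * (∫⁻ y in ball x (2 * r), ‖fderiv ℝ v y‖ₑ ∂μ +
          L * (ENNReal.ofReal r)⁻¹ * ∫⁻ y in ball x (2 * r), ‖v y‖ₑ ∂μ) := by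
        gcongr
        refine (lintegral_mono hfd).trans_eq ?_
        rw [lintegral_indicator measurableSet_ball, lintegral_add_left hcv,
          lintegral_const_mul _ hv.continuous.enorm.measurable]
    _ ≤ C * (M * ENNReal.ofReal (2 * r) ^ Module.finrank ℝ E + L * (ENNReal.ofReal r)⁻¹ *
          (M * ENNReal.ofReal (2 * r) ^ (Module.finrank ℝ E + 1))) := by
        gcongr
        · exact h _ (by positivity) le_rfl
        · exact lintegral_ball_enorm_le μ hv hx (by positivity) h
    _ = _ := by
        rw [ENNReal.ofReal_mul zero_le_two, mul_pow, mul_pow, pow_succ (ENNReal.ofReal r),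
          ENNReal.ofReal_ofNat]
        push_cast
        calc _ = C * (M * (2 ^ Module.finrank ℝ E * ENNReal.ofReal r ^ Module.finrank ℝ E) +
              L * (M * (2 ^ (Module.finrank ℝ E + 1) * ENNReal.ofReal r ^ Module.finrank ℝ E)) *
              ((ENNReal.ofReal r)⁻¹ * ENNReal.ofReal r)) := by ring
          _ = _ := by rw [hrr]; ring

end LocalLorentz

section BallAverage

variable {E : Type*} [NormedAddCommGroup E] [NormedSpace ℝ E] [FiniteDimensional ℝ E]
  [MeasurableSpace E] [BorelSpace E]

theorem lintegral_ball_measure_closedBall_le (μ τ : Measure E) [μ.IsAddHaarMeasure] [SFinite τ]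
    (x : E) (s ε : ℝ) :
    ∫⁻ y in ball x s, τ (closedBall y ε) ∂μ ≤
      μ (closedBall 0 (min s ε)) * τ (closedBall x (s + ε)) := by
  have hm : MeasurableSet {z : E × E | dist z.2 z.1 ≤ ε} :=
    (isClosed_le (continuous_snd.dist continuous_fst) continuous_const).measurableSet
  calc _ = ∫⁻ y in ball x s, (∫⁻ z, {z : E × E | dist z.2 z.1 ≤ ε}.indicator 1 (y, z) ∂τ) ∂μ := by
        congr 1 with y
        rw [← lintegral_indicator_one measurableSet_closedBall]
        rfl
    _ = ∫⁻ z, (∫⁻ y in ball x s, {z : E × E | dist z.2 z.1 ≤ ε}.indicator 1 (y, z) ∂μ) ∂τ :=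
        lintegral_lintegral_swap (measurable_one.indicator hm).aemeasurable
    _ ≤ ∫⁻ z, (closedBall x (s + ε)).indicator (fun _ => μ (closedBall 0 (min s ε))) z ∂τ := by
        refine lintegral_mono fun z => ?_
        have e : (fun y => {z : E × E | dist z.2 z.1 ≤ ε}.indicator (1 : E × E → ℝ≥0∞) (y, z)) =
            (closedBall z ε).indicator 1 := by
          ext y; simp [Set.indicator, dist_comm]
        rw [e, lintegral_indicator_one measurableSet_closedBall,
          Measure.restrict_apply measurableSet_closedBall]
        by_cases hz : z ∈ closedBall x (s + ε)
        · rw [Set.indicator_of_mem hz]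
          rcases le_total s ε with h | h
          · rw [min_eq_left h, ← Measure.addHaar_closedBall_center μ x]
            exact measure_mono fun y hy => ball_subset_closedBall hy.2
          · rw [min_eq_right h, ← Measure.addHaar_closedBall_center μ z]
            exact measure_mono fun y hy => hy.1
        · rw [Set.indicator_of_notMem hz, nonpos_iff_eq_zero]
          convert measure_empty (μ := μ)
          ext y
          simp only [Set.mem_inter_iff, mem_closedBall, mem_ball, Set.mem_empty_iff_false, iff_false,
            not_and] at hz ⊢
          intro h1 h2
          apply hz
          have := dist_triangle z y x
          rw [dist_comm z y] at this
          linarith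
    _ = _ := lintegral_indicator_const measurableSet_closedBall _

/-- Averaging a measure over balls of any radius preserves upper density bounds at a point, up to
a dimensional factor. -/
theorem lintegral_ball_average_le (μ τ : Measure E) [μ.IsAddHaarMeasure] [SFinite τ]
    {x : E} {m : ℝ≥0∞} {R s ε : ℝ} (hs : 0 < s) (hε : 0 < ε) (hR : s + ε ≤ R)
    (h : ∀ ρ, 0 < ρ → ρ ≤ R →
      τ (closedBall x ρ) ≤ m * ENNReal.ofReal ρ ^ Module.finrank ℝ E) :
    ∫⁻ y in ball x s, (μ (closedBall 0 ε))⁻¹ * τ (closedBall y ε) ∂μ ≤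
      2 ^ Module.finrank ℝ E * m * ENNReal.ofReal s ^ Module.finrank ℝ E := by
  have hμ0 : μ (closedBall 0 ε) ≠ 0 := (measure_closedBall_pos μ 0 hε).ne'
  have hμt : μ (closedBall 0 ε) ≠ ⊤ := measure_closedBall_lt_top.ne
  rw [lintegral_const_mul' _ _ (ENNReal.inv_ne_top.2 hμ0), ENNReal.inv_mul_le_iff hμ0 hμt]
  refine (lintegral_ball_measure_closedBall_le μ τ x s ε).trans ?_
  refine (mul_le_mul_right (h (s + ε) (by positivity) hR) _).trans ?_
  have key : min s ε * (s + ε) ≤ 2 * s * ε := by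
    rcases le_total s ε with h | h
    · rw [min_eq_left h]; nlinarith
    · rw [min_eq_right h]; nlinarith
  rw [Measure.addHaar_closedBall μ _ hε.le, Measure.addHaar_closedBall μ _ (by positivity)]
  calc _ = ENNReal.ofReal (min s ε * (s + ε)) ^ Module.finrank ℝ E * (m * μ (ball 0 1)) := by
        rw [ENNReal.ofReal_mul (by positivity), ENNReal.ofReal_pow (by positivity)]
        ring
    _ ≤ ENNReal.ofReal (2 * s * ε) ^ Module.finrank ℝ E * (m * μ (ball 0 1)) := by gcongr
    _ = _ := by
        rw [ENNReal.ofReal_mul (by positivity), ENNReal.ofReal_mul (by positivity),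
          ENNReal.ofReal_pow (by positivity), ENNReal.ofReal_ofNat]
        ring

end BallAverage

section LowerSemicontinuity

variable {α F : Type*} [MeasurableSpace α] [NormedAddCommGroup F]

theorem measure_lt_norm_le_liminf {μ : Measure α} {v : ℕ → α → F}
    (hv : ∀ k t, MeasurableSet {y | t < ‖v k y‖})
    {w : α → F} (hw : ∀ᵐ y ∂μ, Tendsto (fun k => v k y) atTop (𝓝 (w y))) (t : ℝ) :
    μ {y | t < ‖w y‖} ≤ liminf (fun k => μ {y | t < ‖v k y‖}) atTop := by
  have hm : Measurable fun y => liminf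
      (fun k => {y | t < ‖v k y‖}.indicator (1 : α → ℝ≥0∞) y) atTop :=
    .liminf fun k => measurable_one.indicator (hv k t)
  calc μ {y | t < ‖w y‖} ≤
        μ {y | 1 ≤ liminf (fun k => {y | t < ‖v k y‖}.indicator (1 : α → ℝ≥0∞) y) atTop} := by
        refine measure_mono_ae ?_
        filter_upwards [hw] with y hy ht
        refine le_liminf_of_le (by isBoundedDefault) ?_
        filter_upwards [hy.norm.eventually_const_lt ht] with k hk
        rw [Set.indicator_of_mem (by exact hk), Pi.one_apply]
    _ ≤ ∫⁻ y, liminf (fun k => {y | t < ‖v k y‖}.indicator (1 : α → ℝ≥0∞) y) atTop ∂μ := by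
        simpa using mul_meas_ge_le_lintegral₀ hm.aemeasurable 1
    _ ≤ liminf (fun k => ∫⁻ y, {y | t < ‖v k y‖}.indicator (1 : α → ℝ≥0∞) y ∂μ) atTop :=
        lintegral_liminf_le fun k => measurable_one.indicator (hv k t)
    _ = _ := by simp_rw [lintegral_indicator_one (hv _ t)]

/-- Lower semicontinuity of the Lorentz functional `∫ μ {t < ‖w‖} ^ a dt` under a.e.
convergence. -/
theorem lintegral_rpow_measure_le_of_tendsto {μ : Measure α} {v : ℕ → α → F}
    (hv : ∀ k t, MeasurableSet {y | t < ‖v k y‖})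
    {w : α → F} (hw : ∀ᵐ y ∂μ, Tendsto (fun k => v k y) atTop (𝓝 (w y)))
    {a : ℝ} (ha : 0 < a) {K : ℝ≥0∞}
    (hK : ∀ k, ∫⁻ t in Set.Ioi (0 : ℝ), μ {y | t < ‖v k y‖} ^ a ≤ K) :
    ∫⁻ t in Set.Ioi (0 : ℝ), μ {y | t < ‖w y‖} ^ a ≤ K := by
  calc _ ≤ ∫⁻ t in Set.Ioi (0 : ℝ), liminf (fun k => μ {y | t < ‖v k y‖} ^ a) atTop := by
        refine lintegral_mono fun t => ?_
        refine (ENNReal.rpow_le_rpow (measure_lt_norm_le_liminf hv hw t) ha.le).trans_eq ?_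
        exact ((ENNReal.monotone_rpow_of_nonneg ha.le).map_liminf_of_continuousAt _
          (ENNReal.continuous_rpow_const.continuousAt))
    _ ≤ liminf (fun k => ∫⁻ t in Set.Ioi (0 : ℝ), μ {y | t < ‖v k y‖} ^ a) atTop := by
        refine lintegral_liminf_le fun k => ?_
        have : Antitone fun t => μ {y | t < ‖v k y‖} := fun s t hst =>
          measure_mono fun y hy => hst.trans_lt hy
        exact this.measurable.pow_const a
    _ ≤ K := liminf_le_of_le (by isBoundedDefault) fun b hb => by
        obtain ⟨k, hk⟩ := hb.exists
        exact hk.trans (hK k)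

end LowerSemicontinuity

section Mollification

variable {n N : ℕ}

/-- The rank-one tensor `c ⊗ ξ`. -/
noncomputable def rankOne (c : EuclideanSpace ℝ (Fin N)) (ξ : Euc n) :
    EuclideanSpace ℝ (Fin N × Fin n) :=
  WithLp.toLp 2 fun p => c p.1 * ξ p.2

theorem norm_rankOne (c : EuclideanSpace ℝ (Fin N)) (ξ : Euc n) :
    ‖rankOne c ξ‖ = ‖c‖ * ‖ξ‖ := by
  rw [EuclideanSpace.norm_eq, EuclideanSpace.norm_eq, EuclideanSpace.norm_eq,
    ← Real.sqrt_mul (by positivity), Finset.sum_mul_sum, Fintype.sum_prod_type]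
  simp [rankOne, mul_pow]

theorem inner_gradCoeff_rankOne (I : Fin 1 → Fin n) (w c : EuclideanSpace ℝ (Fin N)) (ξ : Euc n) :
    ⟪gradCoeff n N I w, rankOne c ξ⟫ = ⟪c, w⟫ * ξ (I 0) := by
  simp only [PiLp.inner_apply, Fintype.sum_prod_type, Finset.sum_mul]
  refine Finset.sum_congr rfl fun i _ => ?_
  rw [Finset.sum_eq_single (I 0)]
  · simp [gradCoeff, rankOne]; ring
  · intro j _ hj
    simp [gradCoeff, rankOne, hj]
  · simp

/-- The linear map `ξ ↦ G ξ` of a matrix `G`. -/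
noncomputable def matMap (G : EuclideanSpace ℝ (Fin N × Fin n)) :
    Euc n →L[ℝ] EuclideanSpace ℝ (Fin N) :=
  LinearMap.toContinuousLinearMap
    { toFun := fun ξ => WithLp.toLp 2 fun i => ∑ j, G (i, j) * ξ j
      map_add' := fun a b => by ext i; simp [mul_add, Finset.sum_add_distrib]
      map_smul' := fun t a => by ext i; simp [Finset.mul_sum, mul_left_comm] }

theorem inner_matMap (G : EuclideanSpace ℝ (Fin N × Fin n)) (c : EuclideanSpace ℝ (Fin N))
    (ξ : Euc n) : ⟪c, matMap G ξ⟫ = ⟪G, rankOne c ξ⟫ := by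
  simp only [PiLp.inner_apply, Fintype.sum_prod_type, matMap, rankOne,
    LinearMap.coe_toContinuousLinearMap', LinearMap.coe_mk, AddHom.coe_mk]
  refine Finset.sum_congr rfl fun i _ => ?_
  simp only [RCLike.inner_apply, conj_trivial, Finset.sum_mul]
  exact Finset.sum_congr rfl fun j _ => by ring

theorem dirDeriv_one_smul_const {F : Type*} [NormedAddCommGroup F] [NormedSpace ℝ F]
    {φ : Euc n → ℝ} (hφ : Differentiable ℝ φ) (I : Fin 1 → Fin n) (T : F) (x : Euc n) :
    dirDeriv n 1 I (fun z => φ z • T) x = fderiv ℝ φ x (stdVec n (I 0)) • T := by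
  rw [dirDeriv, iteratedFDeriv_one_apply, fderiv_smul_const (hφ x)]
  rfl

theorem sum_mul_fderiv_stdVec (L : Euc n →L[ℝ] ℝ) (ξ : Euc n) :
    ∑ I : Fin 1 → Fin n, ξ (I 0) * L (stdVec n (I 0)) = L ξ := by
  refine (Fintype.sum_equiv (Equiv.funUnique (Fin 1) (Fin n)) _
    (fun j => ξ j * L (stdVec n j)) fun I => rfl).trans ?_
  conv_rhs => rw [← (EuclideanSpace.basisFun (Fin n) ℝ).sum_repr ξ, map_sum]
  simp [stdVec]

variable {u : Euc n → EuclideanSpace ℝ (Fin N)} {σ : Measure (Euc n)}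
  {f : Euc n → EuclideanSpace ℝ (Fin N × Fin n)}

theorem HasDistribA.neg_integral_fderiv_mul_inner (hu : LocallyIntegrable u volume)
    (h : HasDistribA n 1 (gradCoeff n N) u σ f) {φ : Euc n → ℝ} (hφ : IsTestFun n φ)
    (c : EuclideanSpace ℝ (Fin N)) (ξ : Euc n) :
    -∫ x, fderiv ℝ φ x ξ * ⟪c, u x⟫ = ∫ x, φ x * ⟪f x, rankOne c ξ⟫ ∂σ := by
  have hd : Differentiable ℝ φ := hφ.1.differentiable (by simp)
  have hT : IsTestFun n fun z => φ z • rankOne c ξ :=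
    ⟨hφ.1.smul contDiff_const, hφ.2.smul_right⟩
  have key := h _ hT
  have hint : ∀ I : Fin 1 → Fin n, Integrable fun x =>
      ξ (I 0) * fderiv ℝ φ x (stdVec n (I 0)) * ⟪c, u x⟫ := fun I => by
    have h1 : LocallyIntegrable (fun x => ⟪c, u x⟫) := fun x =>
      (hu x).elim fun s hs => ⟨s, hs.1, hs.2.const_inner c⟩
    have h2 : Continuous fun x => ξ (I 0) * fderiv ℝ φ x (stdVec n (I 0)) :=
      continuous_const.mul ((hφ.1.continuous_fderiv (by simp)).clm_apply continuous_const)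
    exact h1.integrable_smul_left_of_hasCompactSupport h2
      ((hφ.2.fderiv_apply ℝ (stdVec n (I 0))).mul_left (f := fun _ => ξ (I 0)))
  simp_rw [LinearMap.adjoint_inner_right, dirDeriv_one_smul_const hd, inner_smul_right,
    inner_gradCoeff_rankOne] at key
  rw [← key, pow_one, neg_one_mul]
  congr 1
  calc _ = ∫ x, ∑ I : Fin 1 → Fin n, ξ (I 0) * fderiv ℝ φ x (stdVec n (I 0)) * ⟪c, u x⟫ := by
        congr 1 with x
        rw [← Finset.sum_mul, sum_mul_fderiv_stdVec]
    _ = _ := by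
        rw [integral_finsetSum _ fun I _ => hint I]
        refine Finset.sum_congr rfl fun I _ => ?_
        congr 1 with x
        ring

theorem HasDistribA.inner_fderiv_convolution (hu : LocallyIntegrable u volume)
    (h : HasDistribA n 1 (gradCoeff n N) u σ f) {ψ : Euc n → ℝ} (hψ : IsTestFun n ψ)
    (c : EuclideanSpace ℝ (Fin N)) (ξ y : Euc n) :
    ⟪c, fderiv ℝ (convolution ψ u (ContinuousLinearMap.lsmul ℝ ℝ) volume) y ξ⟫ =
      ∫ z, ψ (y - z) * ⟪f z, rankOne c ξ⟫ ∂σ := by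
  have hψ1 : ContDiff ℝ 1 ψ := hψ.1.of_le (by simp)
  have hd : Differentiable ℝ ψ := hψ1.differentiable one_ne_zero
  have hφ : IsTestFun n fun z => ψ (y - z) :=
    ⟨hψ.1.comp (contDiff_const.sub contDiff_id),
      hψ.2.comp_homeomorph (Homeomorph.subLeft y)⟩
  rw [← h.neg_integral_fderiv_mul_inner hu hφ c ξ,
    (hψ.2.hasFDerivAt_convolution_left (ContinuousLinearMap.lsmul ℝ ℝ) hψ1 hu y).fderiv]
  have hce : Integrable (fun t => ((ContinuousLinearMap.lsmul ℝ ℝ).precompL (Euc n))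
      (fderiv ℝ ψ t) (u (y - t))) :=
    (hψ.2.fderiv ℝ).convolutionExists_left _ (hψ1.continuous_fderiv one_ne_zero) hu y
  rw [convolution, ContinuousLinearMap.integral_apply hce,
    ← integral_inner (hce.apply_continuousLinearMap ξ),
    ← integral_sub_left_eq_self _ volume y, ← integral_neg]
  congr 1 with z
  have e : fderiv ℝ (fun z => ψ (y - z)) z = -fderiv ℝ ψ (y - z) := by
    have hz : HasFDerivAt (fun z => ψ (y - z)) _ z :=
      (hd (y - z)).hasFDerivAt.comp z ((hasFDerivAt_id z).const_sub y)
    rw [hz.fderiv]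
    ext; simp
  rw [e]
  simp [ContinuousLinearMap.precompL_apply, inner_smul_right]

end Mollification

section GradientBound

variable {n N : ℕ}

theorem enorm_le_of_enorm_inner_le {A : Euc n →L[ℝ] EuclideanSpace ℝ (Fin N)} {B : ℝ≥0∞}
    (h : ∀ c ξ, ‖⟪c, A ξ⟫‖ₑ ≤ B * (‖c‖ₑ * ‖ξ‖ₑ)) : ‖A‖ₑ ≤ B := by
  rcases eq_or_ne B ⊤ with rfl | hB
  · exact le_top
  lift B to NNReal using hB
  rw [← ofReal_norm]
  refine ENNReal.ofReal_le_of_le_toReal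
    (A.opNorm_le_bound ENNReal.toReal_nonneg fun ξ => ?_)
  rcases (norm_nonneg (A ξ)).eq_or_lt with h0 | h0
  · rw [← h0]; positivity
  have := ENNReal.toReal_mono (by finiteness) (h (A ξ) ξ)
  rw [real_inner_self_eq_norm_sq] at this
  simp only [toReal_enorm, norm_pow, norm_norm, ENNReal.toReal_mul, ENNReal.coe_toReal] at this
  refine le_of_mul_le_mul_left ?_ h0
  simp only [ENNReal.coe_toReal]
  linarith

theorem enorm_integral_mul_inner_le {H E : Type*} [NormedAddCommGroup H] [InnerProductSpace ℝ H]
    [NormedAddCommGroup E] [MeasurableSpace E] [BorelSpace E] {μ : Measure E} {ψ : E → ℝ} {κ ε : ℝ}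
    (hψ0 : ∀ z, 0 ≤ ψ z) (hψκ : ∀ z, ψ z ≤ κ) (hψε : ∀ z, ε < ‖z‖ → ψ z = 0)
    (F : E → H) (T : H) (y : E) :
    ‖∫ z, ψ (y - z) * ⟪F z, T⟫ ∂μ‖ₑ ≤
      ENNReal.ofReal κ * (∫⁻ z in closedBall y ε, ‖F z‖ₑ ∂μ) * ‖T‖ₑ := by
  calc _ ≤ ∫⁻ z, ‖ψ (y - z) * ⟪F z, T⟫‖ₑ ∂μ := enorm_integral_le_lintegral_enorm _
    _ ≤ ∫⁻ z, (closedBall y ε).indicator (fun z => ENNReal.ofReal κ * ‖T‖ₑ * ‖F z‖ₑ) z ∂μ := by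
        refine lintegral_mono fun z => ?_
        by_cases hz : z ∈ closedBall y ε
        · rw [Set.indicator_of_mem hz, enorm_mul, mul_assoc]
          gcongr
          · rw [Real.enorm_of_nonneg (hψ0 _)]
            exact ENNReal.ofReal_le_ofReal (hψκ _)
          · rw [← ofReal_norm, ← ofReal_norm T, ← ofReal_norm (F z),
              ← ENNReal.ofReal_mul (norm_nonneg _), mul_comm]
            exact ENNReal.ofReal_le_ofReal (norm_inner_le_norm _ _)
        · rw [hψε, zero_mul, enorm_zero]
          · exact zero_le
          · simpa [dist_eq_norm, norm_sub_rev] using hz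
    _ = _ := by
        rw [lintegral_indicator measurableSet_closedBall, lintegral_const_mul' _ _ (by finiteness)]
        ring

/-- The total variation of `f σ - G ℒⁿ`, for `f` of norm one. -/
noncomputable def deviation (σ : Measure (Euc n)) (f : Euc n → EuclideanSpace ℝ (Fin N × Fin n))
    (G : EuclideanSpace ℝ (Fin N × Fin n)) : Measure (Euc n) :=
  σ.singularPart volume +
    volume.withDensity fun z => ‖(σ.rnDeriv volume z).toReal • f z - G‖ₑ

instance (σ : Measure (Euc n)) (f : Euc n → EuclideanSpace ℝ (Fin N × Fin n))
    (G : EuclideanSpace ℝ (Fin N × Fin n)) [SigmaFinite σ] : SFinite (deviation σ f G) := by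
  unfold deviation; infer_instance

variable {σ : Measure (Euc n)} [IsLocallyFiniteMeasure σ]
  {f : Euc n → EuclideanSpace ℝ (Fin N × Fin n)}

theorem enorm_integral_sub_le (hf : StronglyMeasurable f) (hf1 : ∀ z, ‖f z‖ ≤ 1)
    {ψ : Euc n → ℝ} {κ ε : ℝ} (hψc : Continuous ψ) (hψs : HasCompactSupport ψ)
    (hψ0 : ∀ z, 0 ≤ ψ z) (hψκ : ∀ z, ψ z ≤ κ) (hψε : ∀ z, ε < ‖z‖ → ψ z = 0)
    (hψ1 : ∫ z, ψ z = 1) (G T : EuclideanSpace ℝ (Fin N × Fin n)) (y : Euc n) :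
    ‖∫ z, ψ (y - z) * ⟪f z, T⟫ ∂σ - ⟪G, T⟫‖ₑ ≤
      ENNReal.ofReal κ * deviation σ f G (closedBall y ε) * ‖T‖ₑ := by
  have hσ := Measure.haveLebesgueDecomposition_add σ (volume : Measure (Euc n))
  set σs := σ.singularPart volume
  set h := σ.rnDeriv volume
  have hψy : Continuous fun z => ψ (y - z) := hψc.comp (continuous_const.sub continuous_id)
  have hψys : HasCompactSupport fun z => ψ (y - z) := hψs.comp_homeomorph (Homeomorph.subLeft y)
  have hint : Integrable (fun z => ψ (y - z) * ⟪f z, T⟫) σ := by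
    refine (hψy.integrable_of_hasCompactSupport hψys).mul_bdd (c := ‖T‖)
      (hf.inner stronglyMeasurable_const).aestronglyMeasurable (ae_of_all _ fun z => ?_)
    exact (norm_inner_le_norm _ _).trans (mul_le_of_le_one_left (norm_nonneg _) (hf1 z))
  have hint1 : Integrable (fun z => ψ (y - z) * ⟪f z, T⟫) σs :=
    hint.mono_measure (Measure.singularPart_le _ _)
  have hint2 : Integrable (fun z => ψ (y - z) * ⟪f z, T⟫) (volume.withDensity h) :=
    hint.mono_measure (Measure.withDensity_rnDeriv_le _ _)
  have hlt : ∀ᵐ z : Euc n, h z < ⊤ := Measure.rnDeriv_lt_top _ _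
  have hint3 : Integrable fun z => (h z).toReal • (ψ (y - z) * ⟪f z, T⟫) :=
    (integrable_withDensity_iff_integrable_smul' (Measure.measurable_rnDeriv _ _) hlt).1 hint2
  have hint4 : Integrable fun z => ψ (y - z) * ⟪G, T⟫ :=
    (hψy.integrable_of_hasCompactSupport hψys).mul_const _
  have e : ∫ z, ψ (y - z) * ⟪f z, T⟫ ∂σ - ⟪G, T⟫ =
      ∫ z, ψ (y - z) * ⟪f z, T⟫ ∂σs + ∫ z, ψ (y - z) * ⟪(h z).toReal • f z - G, T⟫ := by
    have e1 : ∫ z, ψ (y - z) * ⟪G, T⟫ = ⟪G, T⟫ := by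
      rw [integral_mul_const, integral_sub_left_eq_self ψ volume y, hψ1, one_mul]
    conv_lhs => rw [hσ, integral_add_measure hint1 hint2,
      integral_withDensity_eq_integral_toReal_smul (Measure.measurable_rnDeriv _ _) hlt, ← e1,
      add_sub_assoc, ← integral_sub hint3 hint4]
    congr 2 with z
    rw [inner_sub_left, inner_smul_left]
    simp only [smul_eq_mul, conj_trivial]
    ring
  rw [e]
  refine (enorm_add_le _ _).trans ?_
  rw [deviation, Measure.add_apply, mul_add, add_mul,
    withDensity_apply _ measurableSet_closedBall]
  gcongr
  · refine (enorm_integral_mul_inner_le hψ0 hψκ hψε f T y).trans ?_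
    gcongr
    refine (lintegral_mono (g := 1) fun z => ?_).trans (by simp [σs])
    rw [← ofReal_norm]
    exact ENNReal.ofReal_le_one.2 (hf1 z)
  · exact enorm_integral_mul_inner_le hψ0 hψκ hψε _ T y

theorem HasDistribA.enorm_fderiv_convolution_sub_le {u : Euc n → EuclideanSpace ℝ (Fin N)}
    (hu : LocallyIntegrable u volume) (h : HasDistribA n 1 (gradCoeff n N) u σ f)
    (hf : StronglyMeasurable f) (hf1 : ∀ z, ‖f z‖ ≤ 1)
    {ψ : Euc n → ℝ} {κ ε : ℝ} (hψ : IsTestFun n ψ)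
    (hψ0 : ∀ z, 0 ≤ ψ z) (hψκ : ∀ z, ψ z ≤ κ) (hψε : ∀ z, ε < ‖z‖ → ψ z = 0)
    (hψ1 : ∫ z, ψ z = 1) (G : EuclideanSpace ℝ (Fin N × Fin n)) (y : Euc n) :
    ‖fderiv ℝ (convolution ψ u (ContinuousLinearMap.lsmul ℝ ℝ) volume) y - matMap G‖ₑ ≤
      ENNReal.ofReal κ * deviation σ f G (closedBall y ε) := by
  refine enorm_le_of_enorm_inner_le fun c ξ => ?_
  rw [sub_apply, inner_sub_right, h.inner_fderiv_convolution hu hψ,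
    inner_matMap]
  refine (enorm_integral_sub_le hf hf1 hψ.1.continuous hψ.2 hψ0 hψκ hψε hψ1 G _ y).trans_eq ?_
  rw [← ofReal_norm (rankOne c ξ), norm_rankOne, ENNReal.ofReal_mul (norm_nonneg _), ofReal_norm,
    ofReal_norm]

theorem ae_tendsto_deviation_div (hf : StronglyMeasurable f) (hf1 : ∀ z, ‖f z‖ ≤ 1) :
    ∀ᵐ x : Euc n, Tendsto (fun r =>
      deviation σ f ((σ.rnDeriv volume x).toReal • f x) (closedBall x r) /
        volume (closedBall x r)) (𝓝[>] 0) (𝓝 0) := by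
  have hsing := Besicovitch.ae_tendsto_rnDeriv (σ.singularPart volume) (volume : Measure (Euc n))
  have hz := (Measure.rnDeriv_eq_zero (σ.singularPart volume) (volume : Measure (Euc n))).2
    (Measure.mutuallySingular_singularPart σ volume)
  have hg : LocallyIntegrable (fun z => (σ.rnDeriv volume z).toReal • f z)
      (volume : Measure (Euc n)) := by
    refine (locallyIntegrable_iff).2 fun K hK => ?_
    have h1 : IntegrableOn (fun z => (σ.rnDeriv volume z).toReal) K volume :=
      Measure.integrableOn_toReal_rnDeriv hK.measure_lt_top.ne
    exact h1.smul_bdd 1 hf.aestronglyMeasurable (ae_of_all _ hf1)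
  have hleb := (Besicovitch.vitaliFamily (volume : Measure (Euc n))).ae_tendsto_lintegral_enorm_sub_div hg
  filter_upwards [hsing, hz, hleb] with x h1 h2 h3
  have h4 := h3.comp (Besicovitch.tendsto_filterAt volume x)
  rw [h2] at h1
  have := h1.add h4
  simp only [Pi.zero_apply, add_zero] at this
  refine this.congr fun r => ?_
  rw [deviation, Measure.add_apply, ENNReal.add_div,
    withDensity_apply _ measurableSet_closedBall]
  rfl

end GradientBound

section Differentiability

variable {n N : ℕ}

theorem isPolyDeg_one_affine {F : Type*} [NormedAddCommGroup F] [NormedSpace ℝ F]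
    (a : F) (L : Euc n →L[ℝ] F) (x : Euc n) : IsPolyDeg n 1 fun y => a + L (y - x) := by
  refine ⟨contDiff_const.add (L.contDiff.comp (contDiff_id.sub contDiff_const)), fun y => ?_⟩
  have e : fderiv ℝ (fun y => a + L (y - x)) = fun _ => L := by
    ext1 z
    exact ((L.hasFDerivAt.comp z ((hasFDerivAt_id z).sub_const x)).const_add a).fderiv
  rw [← norm_eq_zero, ← norm_iteratedFDeriv_fderiv, e,
    iteratedFDeriv_const_of_ne one_ne_zero, Pi.zero_apply, norm_zero]

variable {u : Euc n → EuclideanSpace ℝ (Fin N)} {σ : Measure (Euc n)} [IsLocallyFiniteMeasure σ]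
  {f : Euc n → EuclideanSpace ℝ (Fin N × Fin n)}

theorem HasDistribA.enorm_fderiv_convolution_bump_sub_le (hu : LocallyIntegrable u volume)
    (h : HasDistribA n 1 (gradCoeff n N) u σ f) (hf : StronglyMeasurable f) (hf1 : ∀ z, ‖f z‖ ≤ 1)
    (b : ContDiffBump (0 : Euc n)) (hb : b.rOut ≤ 2 * b.rIn)
    (G : EuclideanSpace ℝ (Fin N × Fin n)) (y : Euc n) :
    ‖fderiv ℝ (convolution (b.normed volume) u (ContinuousLinearMap.lsmul ℝ ℝ) volume) y -
        matMap G‖ₑ ≤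
      2 ^ n * ((volume (closedBall (0 : Euc n) b.rOut))⁻¹ *
        deviation σ f G (closedBall y b.rOut)) := by
  refine (h.enorm_fderiv_convolution_sub_le hu hf hf1 (ε := b.rOut)
    ⟨b.contDiff_normed, b.hasCompactSupport_normed⟩ b.nonneg_normed
    (b.normed_le_div_measure_closedBall_rOut volume 2 hb) (fun z hz => ?_)
    b.integral_normed G y).trans_eq ?_
  · rw [← Function.notMem_support, b.support_normed_eq]
    simpa using hz.le
  · rw [ENNReal.ofReal_div_of_pos, Measure.real, ENNReal.ofReal_toReal measure_closedBall_lt_top.ne,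
      ENNReal.ofReal_pow zero_le_two, ENNReal.ofReal_ofNat, finrank_euclideanSpace_fin,
      div_eq_mul_inv, mul_assoc]
    exact ENNReal.toReal_pos (measure_closedBall_pos _ _ b.rOut_pos).ne'
      measure_closedBall_lt_top.ne

theorem HasDistribA.lintegral_fderiv_convolution_bump_sub_le (hu : LocallyIntegrable u volume)
    (h : HasDistribA n 1 (gradCoeff n N) u σ f) (hf : StronglyMeasurable f) (hf1 : ∀ z, ‖f z‖ ≤ 1)
    (b : ContDiffBump (0 : Euc n)) (hb : b.rOut ≤ 2 * b.rIn)
    {G : EuclideanSpace ℝ (Fin N × Fin n)} {x : Euc n} {m : ℝ≥0∞} {R s : ℝ} (hs : 0 < s)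
    (hR : s + b.rOut ≤ R)
    (hG : ∀ ρ, 0 < ρ → ρ ≤ R → deviation σ f G (closedBall x ρ) ≤ m * ENNReal.ofReal ρ ^ n) :
    ∫⁻ y in ball x s,
        ‖fderiv ℝ (convolution (b.normed volume) u (ContinuousLinearMap.lsmul ℝ ℝ) volume) y -
          matMap G‖ₑ ≤ 4 ^ n * m * ENNReal.ofReal s ^ n := by
  refine (lintegral_mono fun y =>
    h.enorm_fderiv_convolution_bump_sub_le hu hf hf1 b hb G y).trans ?_
  rw [lintegral_const_mul' _ _ (by finiteness)]
  refine (mul_le_mul_right (lintegral_ball_average_le volume (deviation σ f G) hs b.rOut_pos hR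
    (by simpa using hG)) _).trans_eq ?_
  rw [finrank_euclideanSpace_fin, show (4 : ℝ≥0∞) = 2 * 2 by norm_num, mul_pow]
  ring

/-- Bumps at the origin of radius tending to zero. -/
noncomputable def smallBump (n k : ℕ) : ContDiffBump (0 : Euc n) where
  rIn := 1 / ((k : ℝ) + 1) / 2
  rOut := 1 / ((k : ℝ) + 1)
  rIn_pos := by positivity
  rIn_lt_rOut := half_lt_self (by positivity)

theorem tendsto_rOut_smallBump (n : ℕ) :
    Tendsto (fun k => (smallBump n k).rOut) atTop (𝓝 0) :=
  tendsto_one_div_add_atTop_nhds_zero_nat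

theorem rOut_smallBump_le (n k : ℕ) : (smallBump n k).rOut ≤ 2 * (smallBump n k).rIn := by
  simp only [smallBump]
  linarith

theorem exists_lintegral_rpow_measure_sub_affine_le (n N : ℕ) {p : NNReal}
    (hp : NNReal.HolderConjugate n p) :
    ∃ C : NNReal, ∀ (u : Euc n → EuclideanSpace ℝ (Fin N)) (σ : Measure (Euc n))
      (f : Euc n → EuclideanSpace ℝ (Fin N × Fin n)) [IsLocallyFiniteMeasure σ],
      LocallyIntegrable u volume → HasDistribA n 1 (gradCoeff n N) u σ f →
      StronglyMeasurable f → (∀ z, ‖f z‖ ≤ 1) →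
      (∀ᵐ y, Tendsto (fun k => convolution ((smallBump n k).normed volume) u
        (ContinuousLinearMap.lsmul ℝ ℝ) volume y) atTop (𝓝 (u y))) →
      ∀ x, Tendsto (fun k => convolution ((smallBump n k).normed volume) u
        (ContinuousLinearMap.lsmul ℝ ℝ) volume x) atTop (𝓝 (u x)) →
      ∀ (G : EuclideanSpace ℝ (Fin N × Fin n)) (m : ℝ≥0∞) (R : ℝ),
      (∀ ρ, 0 < ρ → ρ ≤ R → deviation σ f G (closedBall x ρ) ≤ m * ENNReal.ofReal ρ ^ n) →
      ∀ r, 0 < r → 4 * r ≤ R →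
      ∫⁻ t in Set.Ioi (0 : ℝ), volume.restrict (ball x r)
        {y | t < ‖u y - (u x + matMap G (y - x))‖} ^ (1 / (p : ℝ)) ≤
        C * (m * ENNReal.ofReal r ^ n) := by
  obtain ⟨C, hC⟩ := exists_lintegral_rpow_measure_ball_le (F := EuclideanSpace ℝ (Fin N))
    (volume : Measure (Euc n)) (p := p) (by simpa using hp)
  refine ⟨C * 4 ^ n, fun u σ f _ hu h hf hf1 hae x hx G m R hG r hr hR => ?_⟩
  set uk : ℕ → Euc n → EuclideanSpace ℝ (Fin N) := fun k =>
    convolution ((smallBump n k).normed volume) u (ContinuousLinearMap.lsmul ℝ ℝ) volume with huk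
  have hukC : ∀ k, ContDiff ℝ 1 (uk k) := fun k =>
    (smallBump n k).hasCompactSupport_normed.contDiff_convolution_left _
      (smallBump n k).contDiff_normed hu
  set v : ℕ → Euc n → EuclideanSpace ℝ (Fin N) := fun k y =>
    uk k y - (uk k x + matMap G (y - x)) with hv
  have hvC : ∀ k, ContDiff ℝ 1 (v k) := fun k =>
    (hukC k).sub (contDiff_const.add
      ((matMap G).contDiff.comp (contDiff_id.sub contDiff_const)))
  have hvd : ∀ k y, fderiv ℝ (v k) y = fderiv ℝ (uk k) y - matMap G := fun k y =>
    (((hukC k).differentiable one_ne_zero y).hasFDerivAt.sub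
      (((matMap G).hasFDerivAt.comp y ((hasFDerivAt_id y).sub_const x)).const_add _)).fderiv
  obtain ⟨k₀, hk₀⟩ := ((tendsto_rOut_smallBump n).eventually_le_const
    (show 0 < 2 * r by positivity)).exists_forall_of_atTop
  refine lintegral_rpow_measure_le_of_tendsto (v := fun k => v (k + k₀)) (fun k t => ?_) ?_
    (one_div_pos.2 (NNReal.coe_pos.2 hp.symm.pos)) (fun k => ?_)
  · exact (isOpen_lt continuous_const (hvC _).continuous.norm).measurableSet
  · filter_upwards [ae_restrict_of_ae hae] with y hy
    exact (hy.sub (hx.add_const _)).comp (tendsto_add_atTop_nat k₀)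
  · refine (hC (v (k + k₀)) (hvC _) x (by simp [hv]) (4 ^ n * m) r hr fun s hs hs2 => ?_).trans_eq ?_
    · simp_rw [hvd]
      rw [finrank_euclideanSpace_fin]
      refine h.lintegral_fderiv_convolution_bump_sub_le hu hf hf1 _ (rOut_smallBump_le n _) hs ?_ hG
      linarith [hk₀ (k + k₀) (Nat.le_add_left _ _)]
    · rw [finrank_euclideanSpace_fin]
      push_cast
      ring

theorem lorentzNorm_one {α F : Type*} [MeasurableSpace α] [NormedAddCommGroup F] [NormedSpace ℝ F]
    (p : ℝ) (μ : Measure α) (f : α → F) :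
    lorentzNorm p 1 μ f =
      ENNReal.ofReal p * ∫⁻ t in Set.Ioi (0 : ℝ), μ {x | t < ‖f x‖} ^ (1 / p) := by
  simp only [lorentzNorm, div_one, ENNReal.rpow_one]
  congr 1
  refine setLIntegral_congr_fun measurableSet_Ioi fun t ht => ?_
  have h0 : ENNReal.ofReal t ≠ 0 := by simpa using ht
  rw [mul_right_comm, ENNReal.mul_inv_cancel h0 ENNReal.ofReal_ne_top, one_mul]

theorem exists_forall_le_of_tendsto_div {τ : Measure (Euc n)} {x : Euc n}
    (h : Tendsto (fun r => τ (closedBall x r) / volume (closedBall x r)) (𝓝[>] 0) (𝓝 0))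
    {m : ℝ≥0∞} (hm : 0 < m) :
    ∃ R > 0, ∀ ρ, 0 < ρ → ρ ≤ R →
      τ (closedBall x ρ) ≤ m * volume (ball (0 : Euc n) 1) * ENNReal.ofReal ρ ^ n := by
  obtain ⟨R, hR, hR'⟩ := mem_nhdsGT_iff_exists_Ioc_subset.1 ((ENNReal.tendsto_nhds_zero.1 h) m hm)
  refine ⟨R, hR, fun ρ h0 h1 => ?_⟩
  have := hR' ⟨h0, h1⟩
  rw [Set.mem_ofPred_eq] at this
  rw [ENNReal.div_le_iff (measure_closedBall_pos _ _ h0).ne' measure_closedBall_lt_top.ne,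
    Measure.addHaar_closedBall volume _ h0.le, finrank_euclideanSpace_fin,
    ENNReal.ofReal_pow h0.le] at this
  refine this.trans_eq ?_
  ring

theorem HasDistribA.exists_stronglyMeasurable {u : Euc n → EuclideanSpace ℝ (Fin N)}
    {σ : Measure (Euc n)} {f : Euc n → EuclideanSpace ℝ (Fin N × Fin n)}
    (h : HasDistribA n 1 (gradCoeff n N) u σ f) (hf : AEStronglyMeasurable f σ)
    (hf1 : ∀ᵐ x ∂σ, ‖f x‖ = 1) :
    ∃ g, StronglyMeasurable g ∧ (∀ z, ‖g z‖ ≤ 1) ∧ HasDistribA n 1 (gradCoeff n N) u σ g := by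
  have hm := hf.stronglyMeasurable_mk
  refine ⟨{z | ‖hf.mk f z‖ ≤ 1}.indicator (hf.mk f),
    hm.indicator (measurableSet_le hm.norm.measurable measurable_const), fun z => ?_,
    fun φ hφ => (h φ hφ).trans (integral_congr_ae ?_)⟩
  · by_cases hz : z ∈ {z | ‖hf.mk f z‖ ≤ 1}
    · rwa [Set.indicator_of_mem hz]
    · rw [Set.indicator_of_notMem hz, norm_zero]; exact zero_le_one
  · filter_upwards [hf1, hf.ae_eq_mk] with z h1 h2
    rw [Set.indicator_of_mem (by simp [← h2, h1]), h2]

end Differentiability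

/-- every `u ∈ BV_loc(ℝ^n, ℝ^N)` is `L^{n/(n-1),1}`-differentiable at
`ℒ^n`-a.e. `x ∈ ℝ^n`. -/
theorem statement1 (n N : ℕ) (hn : 1 < n) (u : Euc n → EuclideanSpace ℝ (Fin N))
    (hu : MemBVAloc n 1 (gradCoeff n N) u) :
    ∀ᵐ x ∂(volume : Measure (Euc n)),
      MemTLorentz n 1 ((n : ℝ) / ((n : ℝ) - 1)) 1 u x := by
  obtain ⟨hui, σ, f₀, hσ, hf₀, hf₀1, hd₀⟩ := hu
  obtain ⟨f, hf, hf1, hd⟩ := hd₀.exists_stronglyMeasurable hf₀.aestronglyMeasurable hf₀1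
  have hn' : (1 : ℝ) < n := by exact_mod_cast hn
  have hq : (n : ℝ).HolderConjugate ((n : ℝ) / ((n : ℝ) - 1)) := Real.HolderConjugate.conjExponent hn'
  lift (n : ℝ) / ((n : ℝ) - 1) to NNReal using hq.symm.nonneg with p hp
  obtain ⟨C, hC⟩ := exists_lintegral_rpow_measure_sub_affine_le n N (p := p)
    (by exact_mod_cast hq)
  have hconv := ContDiffBump.ae_convolution_tendsto_right_of_locallyIntegrable
    (tendsto_rOut_smallBump n) (.of_forall (rOut_smallBump_le n)) hui
  filter_upwards [hconv, ae_tendsto_deviation_div (σ := σ) hf hf1] with x hx hdev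
  set G := (σ.rnDeriv volume x).toReal • f x
  refine ⟨fun y => u x + matMap G (y - x), isPolyDeg_one_affine _ _ _, ?_⟩
  have hexp : ((1 : ℕ) : ℝ) + n / (p : ℝ) = n := by
    rw [hp]
    field_simp
    simp
  rw [SmallO, hexp, ENNReal.tendsto_nhds_zero]
  intro ε hε
  set V := volume (ball (0 : Euc n) 1)
  have hVt : V ≠ ⊤ := measure_ball_lt_top.ne
  have hKt : p * C * V ≠ ⊤ := by finiteness
  obtain ⟨m, hm, hmε⟩ : ∃ m : ℝ≥0∞, 0 < m ∧ p * C * V * m ≤ ε := by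
    refine ⟨ε / (p * C * V), ENNReal.div_pos hε.ne' hKt, ENNReal.mul_div_le⟩
  obtain ⟨R, hR, hRm⟩ := exists_forall_le_of_tendsto_div hdev hm
  filter_upwards [Ioc_mem_nhdsGT (show 0 < R / 4 by positivity)] with r hr
  refine ENNReal.div_le_of_le_mul ?_
  rw [lorentzNorm_one, ENNReal.ofReal_coe_nnreal, Real.rpow_natCast, ENNReal.ofReal_pow hr.1.le]
  calc _ ≤ p * (C * (m * V * ENNReal.ofReal r ^ n)) := by
        gcongr
        exact hC u σ f hui hd hf hf1 hconv x hx G _ R hRm r hr.1 (by linarith [hr.2])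
    _ = p * C * V * m * ENNReal.ofReal r ^ n := by ring
    _ ≤ _ := by gcongr
end

section
/- Suppose 𝒜 is an elliptic homogeneous constant-coefficient differential operator of order k ≥ n ≥ 1. Then there is a constant C such that ‖D^{k−n}u‖_{L^∞(ℝ^n, V ⊙^{k−n} ℝ^n)} ≤ C ‖𝒜u‖_{L¹(ℝ^n, W)} holds for all u ∈ C^∞_c(ℝ^n, V) if and only if 𝒜 satisfies condition (WC). -/
open MeasureTheory Metric Filter
open scoped ENNReal RealInnerProductSpace Topology

/-- Two finite measures on a compact metric space, each giving the same mass to all balls of equal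
radius, are proportional. -/
theorem integral_proportional_of_measure_ball_eq {X : Type*} [MetricSpace X] [CompactSpace X]
    [MeasurableSpace X] [BorelSpace X] (μ ν : Measure X) [IsFiniteMeasure μ] [IsFiniteMeasure ν]
    (hμ : ∀ x y : X, ∀ r : ℝ, μ (ball x r) = μ (ball y r))
    (hν : ∀ x y : X, ∀ r : ℝ, ν (ball x r) = ν (ball y r))
    {g : X → ℝ} (hg : Continuous g) :
    ν.real Set.univ * ∫ x, g x ∂μ = μ.real Set.univ * ∫ x, g x ∂ν := by
  rcases eq_or_ne ν 0 with rfl | hν0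
  · simp
  have hne : Nonempty X := by
    by_contra h
    rw [not_nonempty_iff] at h
    exact hν0 (Measure.eq_zero_of_isEmpty ν)
  obtain ⟨x₀⟩ := hne
  obtain ⟨C, hC⟩ := isCompact_univ.exists_bound_of_continuousOn hg.continuousOn
  have hpos : ∀ r > 0, 0 < ν.real (ball x₀ r) := by
    intro r hr
    refine ENNReal.toReal_pos (fun h => hν0 ?_) (measure_ne_top _ _)
    rw [← Measure.measure_univ_eq_zero]
    refine isCompact_univ.measure_zero_of_nhdsWithin fun x _ => ⟨ball x r, ?_, ?_⟩
    · exact mem_nhdsWithin_of_mem_nhds (ball_mem_nhds x hr)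
    · rw [hν x x₀ r, h]
  set K : ℝ → X × X → ℝ := fun r => Set.indicator {p | dist p.1 p.2 < r} 1 with hK
  have hKm : ∀ r, Measurable (K r) := fun r =>
    measurable_one.indicator (measurableSet_lt (by fun_prop) (by fun_prop))
  have hK1 : ∀ r p, ‖K r p‖ ≤ 1 := by
    intro r p
    by_cases h : dist p.1 p.2 < r <;> simp [hK, h]
  have hK0 : ∀ r p, 0 ≤ K r p := by
    intro r p
    by_cases h : dist p.1 p.2 < r <;> simp [hK, h]
  have key : ∀ (μ ν : Measure X) [IsFiniteMeasure μ] [IsFiniteMeasure ν] (r : ℝ)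
      (h : X → ℝ), Continuous h → (∀ x, ‖h x‖ ≤ C) →
      Integrable (fun p : X × X => h p.1 * K r p) (μ.prod ν) := by
    intro μ ν _ _ r h hh hhC
    refine Integrable.mono' (integrable_const C)
      ((hh.measurable.comp measurable_fst).mul (hKm r)).aestronglyMeasurable
      (Eventually.of_forall fun p => ?_)
    rw [norm_mul]
    nlinarith [hhC p.1, hK1 r p, norm_nonneg (h p.1), norm_nonneg (K r p)]
  have hC' : ∀ x, ‖g x‖ ≤ C := fun x => hC x trivial
  have slice1 : ∀ r x, ∫ y, K r (x, y) ∂ν = ν.real (ball x₀ r) := by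
    intro r x
    have : (fun y => K r (x, y)) = Set.indicator (ball x r) 1 := by
      ext y; simp [hK, Set.indicator, dist_comm]
    rw [this, integral_indicator_one measurableSet_ball, measureReal_def, hν x x₀ r,
      measureReal_def]
  have slice2 : ∀ r y, ∫ x, K r (x, y) ∂μ = μ.real (ball x₀ r) := by
    intro r y
    have : (fun x => K r (x, y)) = Set.indicator (ball y r) 1 := by
      ext x; simp [hK, Set.indicator]
    rw [this, integral_indicator_one measurableSet_ball, measureReal_def, hμ y x₀ r,
      measureReal_def]
  have intK : ∀ r, Integrable (K r) (μ.prod ν) := fun r =>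
    Integrable.mono' (integrable_const 1) (hKm r).aestronglyMeasurable
      (Eventually.of_forall (hK1 r))
  have int1 : ∀ r, Integrable (fun p : X × X => g p.1 * K r p) (μ.prod ν) := fun r =>
    key μ ν r g hg hC'
  have int2 : ∀ r, Integrable (fun p : X × X => g p.2 * K r p) (μ.prod ν) := by
    intro r
    refine Integrable.mono' (integrable_const C)
      ((hg.measurable.comp measurable_snd).mul (hKm r)).aestronglyMeasurable
      (Eventually.of_forall fun p => ?_)
    rw [norm_mul]
    nlinarith [hC' p.2, hK1 r p, norm_nonneg (g p.2), norm_nonneg (K r p)]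
  have e1 : ∀ r, ∫ p, g p.1 * K r p ∂(μ.prod ν) = ν.real (ball x₀ r) * ∫ x, g x ∂μ := by
    intro r
    rw [integral_prod _ (int1 r), ← integral_const_mul]
    refine integral_congr_ae (Eventually.of_forall fun x => ?_)
    simp only [integral_const_mul, slice1]
    ring
  have e2 : ∀ r, ∫ p, g p.2 * K r p ∂(μ.prod ν) = μ.real (ball x₀ r) * ∫ x, g x ∂ν := by
    intro r
    rw [integral_prod_symm _ (int2 r), ← integral_const_mul]
    refine integral_congr_ae (Eventually.of_forall fun x => ?_)
    simp only [integral_const_mul, slice2]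
    ring
  have e3 : ∀ r, ∫ p, K r p ∂(μ.prod ν) = ν.real (ball x₀ r) * μ.real Set.univ := by
    intro r
    rw [integral_prod _ (intK r)]
    simp only [slice1]
    rw [integral_const, smul_eq_mul, mul_comm]
  have e4 : ∀ r, ∫ p, K r p ∂(μ.prod ν) = μ.real (ball x₀ r) * ν.real Set.univ := by
    intro r
    rw [integral_prod_symm _ (intK r)]
    simp only [slice2]
    rw [integral_const, smul_eq_mul, mul_comm]
  set M := μ.real Set.univ
  set N := ν.real Set.univ
  have hM : 0 ≤ M := measureReal_nonneg
  have hN : 0 ≤ N := measureReal_nonneg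
  have hbound : ∀ δ > 0, |N * ∫ x, g x ∂μ - M * ∫ x, g x ∂ν| ≤ δ * (N * M) := by
    intro δ hδ
    obtain ⟨r, hr, hgr⟩ := Metric.uniformContinuous_iff.1
      (CompactSpace.uniformContinuous_of_continuous hg) δ hδ
    have hb := hpos r hr
    have hdiff : |ν.real (ball x₀ r) * ∫ x, g x ∂μ - μ.real (ball x₀ r) * ∫ x, g x ∂ν|
        ≤ δ * (ν.real (ball x₀ r) * M) := by
      rw [← e1, ← e2, ← e3, ← integral_sub (int1 r) (int2 r), ← integral_const_mul]
      refine (norm_integral_le_integral_norm _).trans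
        (integral_mono_of_nonneg
          (Eventually.of_forall fun p => norm_nonneg (g p.1 * K r p - g p.2 * K r p))
          ((intK r).const_mul δ) (Eventually.of_forall fun p => ?_))
      by_cases h : dist p.1 p.2 < r
      · have := (hgr h).le
        rw [Real.dist_eq] at this
        simpa [hK, h] using this
      · simp [hK, h]
    have h34 := (e3 r).symm.trans (e4 r)
    have : ν.real (ball x₀ r) * |N * ∫ x, g x ∂μ - M * ∫ x, g x ∂ν| ≤
        ν.real (ball x₀ r) * (δ * (N * M)) := by
      calc ν.real (ball x₀ r) * |N * ∫ x, g x ∂μ - M * ∫ x, g x ∂ν|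
          = |N * (ν.real (ball x₀ r) * ∫ x, g x ∂μ) -
              (ν.real (ball x₀ r) * M) * ∫ x, g x ∂ν| := by
            rw [← abs_of_pos hb, ← abs_mul, abs_of_pos hb]; ring_nf
        _ = N * |ν.real (ball x₀ r) * ∫ x, g x ∂μ - μ.real (ball x₀ r) * ∫ x, g x ∂ν| := by
            rw [h34]; nth_rewrite 3 [← abs_of_nonneg hN]; rw [← abs_mul]; ring_nf
        _ ≤ N * (δ * (ν.real (ball x₀ r) * M)) := by gcongr
        _ = _ := by ring
    exact le_of_mul_le_mul_left this hb
  have hz : |N * ∫ x, g x ∂μ - M * ∫ x, g x ∂ν| ≤ 0 := by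
    refine le_of_forall_pos_le_add fun δ hδ => ?_
    have h := hbound (δ / (N * M + 1)) (by positivity)
    refine h.trans ?_
    rw [zero_add, div_mul_eq_mul_div, div_le_iff₀ (by positivity)]
    nlinarith [mul_nonneg hN hM]
  exact sub_eq_zero.1 (abs_nonpos_iff.1 hz)
theorem hausdorffMeasure_sphere_lt_top (m : ℕ) :
    μH[(m : ℝ)] (sphere (0 : Euc (m + 1)) 1) < ∞ := by
  set P : Fin (m + 1) → ℝ → (Fin m → ℝ) → Euc (m + 1) :=
    fun i s y => WithLp.toLp 2 (i.insertNth s y : Fin (m + 1) → ℝ) with hP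
  set f : Fin (m + 1) → ℝ → (Fin m → ℝ) → Euc (m + 1) :=
    fun i s y => ‖P i s y‖⁻¹ • P i s y with hf
  have hPi : ∀ i s y, P i s y i = s := fun i s y => by simp [hP]
  have hPsmooth : ∀ i s, ContDiff ℝ 1 (P i s) := by
    intro i s
    rw [contDiff_euclidean]
    intro j
    rcases eq_or_ne j i with rfl | h
    · simpa [hP] using contDiff_const
    · obtain ⟨l, rfl⟩ := Fin.exists_succAbove_eq h
      simpa [hP] using contDiff_apply ℝ ℝ l
  have hfin : ∀ i, ∀ s : ℝ, s ≠ 0 → μH[(m : ℝ)] (f i s '' Set.Icc (-1) 1) < ∞ := by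
    intro i s hs
    have hne : ∀ y, P i s y ≠ 0 := fun y h => hs (by rw [← hPi i s y, h]; rfl)
    have hcd : ContDiff ℝ 1 (f i s) :=
      (((hPsmooth i s).norm ℝ hne).inv fun y => norm_ne_zero_iff.2 (hne y)).smul (hPsmooth i s)
    obtain ⟨K, hK⟩ := hcd.contDiffOn.exists_lipschitzOnWith one_ne_zero
      (convex_Icc (-1 : Fin m → ℝ) 1) isCompact_Icc
    refine (hK.hausdorffMeasure_image_le (Nat.cast_nonneg m)).trans_lt ?_
    refine ENNReal.mul_lt_top (by simp) ?_
    have := hausdorffMeasure_pi_real (ι := Fin m)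
    rw [Fintype.card_fin] at this
    rw [this]
    exact isCompact_Icc.measure_lt_top
  have hcover : sphere (0 : Euc (m + 1)) 1 ⊆
      ⋃ i : Fin (m + 1), (f i 1 '' Set.Icc (-1) 1 ∪ f i (-1) '' Set.Icc (-1) 1) := by
    intro ω hω
    have hω1 : ‖ω‖ = 1 := by simpa using hω
    obtain ⟨i, -, hi⟩ := Finset.exists_max_image Finset.univ (fun i => |ω i|) ⟨0, Finset.mem_univ _⟩
    have hpos : 0 < |ω i| := by
      rw [abs_pos]
      intro h
      have : ω = 0 := by
        ext j
        have := hi j (Finset.mem_univ j)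
        rw [h, abs_zero] at this
        simpa using this
      rw [this, norm_zero] at hω1
      exact zero_ne_one hω1
    have key : ∀ s : ℝ, ω i = s * |ω i| → ω ∈ f i s '' Set.Icc (-1) 1 := by
      intro s hs
      refine ⟨fun l => |ω i|⁻¹ * ω (i.succAbove l), ?_, ?_⟩
      · have : ∀ l, |(|ω i|⁻¹ * ω (i.succAbove l))| ≤ 1 := by
          intro l
          rw [abs_mul, abs_inv, abs_abs, inv_mul_le_iff₀ hpos, mul_one]
          exact hi _ (Finset.mem_univ _)
        exact ⟨fun l => (abs_le.1 (this l)).1, fun l => (abs_le.1 (this l)).2⟩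
      · have hp : P i s (fun l => |ω i|⁻¹ * ω (i.succAbove l)) = |ω i|⁻¹ • ω := by
          ext j
          rcases eq_or_ne j i with rfl | h
          · rw [hPi, PiLp.smul_apply, smul_eq_mul]
            nth_rewrite 2 [hs]
            field_simp
          · obtain ⟨l, rfl⟩ := Fin.exists_succAbove_eq h
            simp [hP]
        simp only [hf, hp]
        rw [norm_smul, hω1, norm_inv, Real.norm_eq_abs, abs_abs, mul_one, inv_inv,
          smul_inv_smul₀ hpos.ne']
    refine Set.mem_iUnion.2 ⟨i, ?_⟩
    rcases abs_cases (ω i) with ⟨h, -⟩ | ⟨h, -⟩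
    · exact Or.inl (key 1 (by rw [h, one_mul]))
    · exact Or.inr (key (-1) (by rw [h]; ring))
  refine (measure_mono hcover).trans_lt ((measure_iUnion_le _).trans_lt ?_)
  rw [tsum_fintype]
  refine ENNReal.sum_lt_top.2 fun i _ => (measure_union_le _ _).trans_lt ?_
  exact ENNReal.add_lt_top.2 ⟨hfin i 1 one_ne_zero, hfin i (-1) (by norm_num)⟩

theorem hausdorffMeasure_sphere_ne_zero (m : ℕ) :
    μH[(m : ℝ)] (sphere (0 : Euc (m + 1)) 1) ≠ 0 := by
  set π : Euc (m + 1) → (Fin m → ℝ) := fun x l => x l.succ with hπ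
  have hlip : LipschitzWith 1 π := by
    refine LipschitzWith.of_dist_le_mul fun x y => ?_
    rw [NNReal.coe_one, one_mul, dist_pi_le_iff dist_nonneg]
    intro l
    simpa [dist_eq_norm] using PiLp.norm_apply_le (x - y) l.succ
  have hsub : ball (0 : Fin m → ℝ) (m + 1 : ℝ)⁻¹ ⊆ π '' sphere (0 : Euc (m + 1)) 1 := by
    intro y hy
    have hy1 : ∀ l, |y l| < (m + 1 : ℝ)⁻¹ := by
      rw [mem_ball_zero_iff, pi_norm_lt_iff (by positivity)] at hy
      simpa using hy
    have hsum : ∑ l, y l ^ 2 ≤ 1 := by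
      have h1 : ∀ l, y l ^ 2 ≤ (m + 1 : ℝ)⁻¹ := by
        intro l
        have h2 : (m + 1 : ℝ)⁻¹ ≤ 1 := inv_le_one_of_one_le₀ (by linarith [m.cast_nonneg (α := ℝ)])
        rw [← sq_abs]
        nlinarith [hy1 l, abs_nonneg (y l)]
      calc ∑ l, y l ^ 2 ≤ ∑ _l : Fin m, (m + 1 : ℝ)⁻¹ := Finset.sum_le_sum fun l _ => h1 l
        _ = m * (m + 1 : ℝ)⁻¹ := by simp
        _ ≤ 1 := by rw [← div_eq_mul_inv, div_le_one (by positivity)]; linarith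
    refine ⟨WithLp.toLp 2 (Fin.cons (√(1 - ∑ l, y l ^ 2)) y), ?_, ?_⟩
    · rw [mem_sphere_zero_iff_norm, EuclideanSpace.norm_eq, Real.sqrt_eq_one, Fin.sum_univ_succ]
      simp [Real.sq_sqrt (sub_nonneg.2 hsum)]
    · ext l; simp [hπ]
  intro h0
  have h1 := hlip.hausdorffMeasure_image_le (Nat.cast_nonneg m) (sphere (0 : Euc (m + 1)) 1)
  rw [h0, mul_zero] at h1
  have h2 := (measure_mono hsub).trans h1
  have h3 := hausdorffMeasure_pi_real (ι := Fin m)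
  rw [Fintype.card_fin] at h3
  rw [h3] at h2
  exact absurd h2 (not_le.2 (measure_ball_pos volume _ (by positivity)))
/-- Integration against the Hausdorff measure of the sphere, written as integration of the
`-n`-homogeneous extension against a radial density supported away from the origin. -/
theorem exists_setIntegral_sphere_eq (n : ℕ) (hn : 1 ≤ n) {ρ : Euc n → ℝ} (hc : Continuous ρ)
    (hs : HasCompactSupport ρ) (h0 : ∀ x, 0 ≤ ρ x) (hz : ∃ r > 0, ∀ x, ‖x‖ < r → ρ x = 0)
    (hrad : ∀ x y, ‖x‖ = ‖y‖ → ρ x = ρ y) (hne : ∃ x, ρ x ≠ 0) :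
    ∃ c : ℝ, c ≠ 0 ∧ ∀ g : Euc n → ℝ, ContinuousOn g {0}ᶜ →
      (∀ t : ℝ, 0 < t → ∀ x, x ≠ 0 → g (t • x) = (t ^ n)⁻¹ * g x) →
      ∫ ξ in sphere (0 : Euc n) 1, g ξ ∂(μH[(n : ℝ) - 1]) = c * ∫ ξ, g ξ * ρ ξ := by
  obtain ⟨m, rfl⟩ : ∃ m, n = m + 1 := ⟨n - 1, by omega⟩
  have hcast : ((m + 1 : ℕ) : ℝ) - 1 = m := by push_cast; ring
  rw [hcast]
  obtain ⟨r, hr, hzr⟩ := hz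
  have hρ0 : ρ 0 = 0 := hzr 0 (by simp [hr])
  set X := sphere (0 : Euc (m + 1)) 1 with hX
  have e₀ : X := ⟨stdVec (m + 1) 0, by simp [hX, stdVec]⟩
  have hXne : ∀ x : X, (x : Euc (m + 1)) ≠ 0 := fun x h => by
    have := x.2
    rw [h] at this
    simp [hX] at this
  have hX1 : ∀ x : X, ‖(x : Euc (m + 1))‖ = 1 := fun x => by simp
  set p : Euc (m + 1) → X := fun x =>
    ⟨if x = 0 then e₀ else ‖x‖⁻¹ • x, by
      split_ifs with h
      · exact e₀.2
      · simp [hX, norm_smul, h]⟩ with hp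
  have hpv : ∀ x, x ≠ 0 → (p x : Euc (m + 1)) = ‖x‖⁻¹ • x := fun x h => by simp [hp, h]
  have hpm : Measurable p := by
    refine Measurable.subtype_mk (Measurable.ite (measurableSet_singleton 0) measurable_const ?_)
    fun_prop
  set q : Euc (m + 1) → ℝ := fun x => ρ x * (‖x‖ ^ (m + 1))⁻¹ with hq
  have hq0 : ∀ x, 0 ≤ q x := fun x => mul_nonneg (h0 x) (by positivity)
  have hqz : q 0 = 0 := by simp [hq, hρ0]
  have hqc : Continuous q := by
    rw [continuous_iff_continuousAt]
    intro x
    rcases eq_or_ne x 0 with rfl | hx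
    · have : q =ᶠ[𝓝 0] fun _ => 0 := by
        filter_upwards [ball_mem_nhds (0 : Euc (m + 1)) hr] with y hy
        simp [hq, hzr y (by simpa using hy)]
      exact continuousAt_const.congr this.symm
    · exact hc.continuousAt.mul ((continuous_norm.pow _).continuousAt.inv₀
        (pow_ne_zero _ (norm_ne_zero_iff.2 hx)))
  have hqi : Integrable q := hqc.integrable_of_hasCompactSupport hs.mul_right
  set ν₀ : Measure (Euc (m + 1)) := volume.withDensity fun x => ENNReal.ofReal (q x) with hν₀
  set ν : Measure X := ν₀.map p with hν
  have hqm : Measurable fun x => ENNReal.ofReal (q x) := hqc.measurable.ennreal_ofReal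
  have : IsFiniteMeasure ν₀ := isFiniteMeasure_withDensity_ofReal hqi.2
  have : IsFiniteMeasure ν := Measure.isFiniteMeasure_map _ _
  set μ : Measure X := Measure.comap Subtype.val μH[(m : ℝ)] with hμ
  have hSm : MeasurableSet (sphere (0 : Euc (m + 1)) 1) := isClosed_sphere.measurableSet
  have hemb : MeasurableEmbedding (Subtype.val : X → Euc (m + 1)) := .subtype_coe hSm
  have hμa : ∀ s : Set X, μ s = μH[(m : ℝ)] (Subtype.val '' s) := fun s => hemb.comap_apply _ _
  have hμu : μ Set.univ = μH[(m : ℝ)] (sphere (0 : Euc (m + 1)) 1) := by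
    rw [hμa, Set.image_univ, Subtype.range_coe]
  have : IsFiniteMeasure μ := ⟨by rw [hμu]; exact hausdorffMeasure_sphere_lt_top m⟩
  have hrefl : ∀ x y : X, ∃ R : Euc (m + 1) ≃ₗᵢ[ℝ] Euc (m + 1), R x = y := fun x y =>
    ⟨_, Submodule.reflection_sub ((hX1 x).trans (hX1 y).symm)⟩
  have hμb : ∀ x y : X, ∀ r : ℝ, μ (ball x r) = μ (ball y r) := by
    intro x y r
    obtain ⟨R, hR⟩ := hrefl x y
    have him : ∀ x : X, (Subtype.val '' ball x r : Set (Euc (m + 1))) =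
        sphere (0 : Euc (m + 1)) 1 ∩ ball (x : Euc (m + 1)) r := by
      intro x
      ext z
      constructor
      · rintro ⟨w, hw, rfl⟩
        exact ⟨w.2, hw⟩
      · rintro ⟨h1, h2⟩
        exact ⟨⟨z, h1⟩, h2, rfl⟩
    rw [hμa, hμa, him, him, ← R.toIsometryEquiv.hausdorffMeasure_image]
    congr 1
    rw [LinearIsometryEquiv.coe_toIsometryEquiv, Set.image_inter R.injective]
    have h1 := R.image_sphere 0 1
    have h2 := R.image_ball x r
    rw [map_zero] at h1
    rw [hR] at h2
    exact congrArg₂ _ h1 h2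
  have hνb : ∀ x y : X, ∀ r : ℝ, ν (ball x r) = ν (ball y r) := by
    intro x y r
    obtain ⟨R, hR⟩ := hrefl x y
    have hval : ∀ x : X, ν (ball x r) =
        ∫⁻ z, (p ⁻¹' ball x r).indicator (fun z => ENNReal.ofReal (q z)) z := by
      intro x
      rw [hν, Measure.map_apply hpm measurableSet_ball, hν₀,
        withDensity_apply _ (hpm measurableSet_ball),
        lintegral_indicator (hpm measurableSet_ball)]
    rw [hval, hval, ← R.measurePreserving.lintegral_comp_emb
      R.toHomeomorph.measurableEmbedding ((p ⁻¹' ball y r).indicator _)]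
    refine lintegral_congr fun z => ?_
    rcases eq_or_ne z 0 with rfl | hz
    · simp [Set.indicator, hqz]
    · have hRz : R z ≠ 0 := by simpa using hz
      have hqR : q (R z) = q z := by simp [hq, hrad (R z) z (R.norm_map z)]
      have hiff : z ∈ p ⁻¹' ball x r ↔ R z ∈ p ⁻¹' ball y r := by
        simp only [Set.mem_preimage, mem_ball, Subtype.dist_eq]
        rw [hpv z hz, hpv _ hRz, R.norm_map, ← hR, ← map_smul, R.dist_map]
      by_cases h : z ∈ p ⁻¹' ball x r
      · rw [Set.indicator_of_mem h, Set.indicator_of_mem (hiff.1 h), hqR]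
      · rw [Set.indicator_of_notMem h, Set.indicator_of_notMem (fun h' => h (hiff.2 h'))]
  have hνu : ν.real Set.univ ≠ 0 := by
    have h1 : ν.real Set.univ = ∫ x, q x := by
      rw [measureReal_def, hν, Measure.map_apply hpm MeasurableSet.univ, Set.preimage_univ, hν₀,
        withDensity_apply _ MeasurableSet.univ, Measure.restrict_univ,
        ← ofReal_integral_eq_lintegral_ofReal hqi (Eventually.of_forall hq0),
        ENNReal.toReal_ofReal (integral_nonneg hq0)]
    obtain ⟨x, hx⟩ := hne
    have hx0 : x ≠ 0 := fun h => hx (h ▸ hρ0)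
    rw [h1]
    exact (hqc.integral_pos_of_hasCompactSupport_nonneg_nonzero hs.mul_right hq0
      (x := x) (mul_ne_zero hx (inv_ne_zero (pow_ne_zero _ (norm_ne_zero_iff.2 hx0))))).ne'
  have hμr : μ.real Set.univ ≠ 0 := by
    rw [measureReal_def, hμu]
    exact (ENNReal.toReal_pos (hausdorffMeasure_sphere_ne_zero m)
      (hausdorffMeasure_sphere_lt_top m).ne).ne'
  refine ⟨μ.real Set.univ / ν.real Set.univ, div_ne_zero hμr hνu, fun g hg hhom => ?_⟩
  have hgc : Continuous fun x : X => g x :=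
    hg.comp_continuous continuous_subtype_val fun x => hXne x
  have hmain := integral_proportional_of_measure_ball_eq μ ν hμb hνb hgc
  have h1 : ∫ ξ in sphere (0 : Euc (m + 1)) 1, g ξ ∂μH[(m : ℝ)] = ∫ x : X, g x ∂μ :=
    (integral_subtype_comap hSm g).symm
  have h2 : ∫ x : X, g x ∂ν = ∫ ξ, g ξ * ρ ξ := by
    rw [hν, integral_map hpm.aemeasurable hgc.aestronglyMeasurable, hν₀,
      integral_withDensity_eq_integral_toReal_smul hqm (by simp)]
    refine integral_congr_ae (Eventually.of_forall fun x => ?_)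
    rcases eq_or_ne x 0 with rfl | hx
    · simp [hqz, hρ0]
    · have hxn : 0 < ‖x‖ := norm_pos_iff.2 hx
      simp only [hpv x hx, ENNReal.toReal_ofReal (hq0 x), smul_eq_mul]
      rw [hhom _ (inv_pos.2 hxn) x hx]
      simp only [hq, inv_pow, inv_inv]
      field_simp
  rw [h1, ← h2, div_mul_eq_mul_div, ← hmain, mul_div_cancel_left₀ _ hνu]

section Symbol

variable {n k : ℕ} {V W : Type*}
  [NormedAddCommGroup V] [InnerProductSpace ℝ V] [FiniteDimensional ℝ V]
  [NormedAddCommGroup W] [InnerProductSpace ℝ W] [FiniteDimensional ℝ W]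

omit [FiniteDimensional ℝ V] [FiniteDimensional ℝ W] in
theorem symbolMap_apply (A : CoeffOp n k V W) (ξ : Euc n) (v : V) :
    symbolMap n k A ξ v = ∑ I : Fin k → Fin n, (∏ i, ξ (I i)) • A I v := by
  simp [symbolMap, LinearMap.sum_apply]

theorem prod_smul_apply {m : ℕ} (J : Fin m → Fin n) (t : ℝ) (ξ : Euc n) :
    ∏ i, (t • ξ) (J i) = t ^ m * ∏ i, ξ (J i) := by
  simp [Finset.prod_mul_distrib]

omit [FiniteDimensional ℝ V] [FiniteDimensional ℝ W] in
theorem symbolMap_smul (A : CoeffOp n k V W) (t : ℝ) (ξ : Euc n) :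
    symbolMap n k A (t • ξ) = t ^ k • symbolMap n k A ξ := by
  ext v
  simp [symbolMap_apply, Finset.prod_mul_distrib, Finset.smul_sum, mul_smul]

omit [FiniteDimensional ℝ V] in
theorem linInv_eq_of_comp_eq_id [FiniteDimensional ℝ V] {f g : V →ₗ[ℝ] V}
    (h : g ∘ₗ f = LinearMap.id) : linInv f = g := by
  unfold linInv
  rw [Matrix.inv_eq_left_inv (B := LinearMap.toMatrix (Module.finBasis ℝ V)
    (Module.finBasis ℝ V) g), Matrix.toLin_toMatrix]
  rw [← LinearMap.toMatrix_comp, h, LinearMap.toMatrix_id]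

theorem injective_adjoint_comp_self {f : V →ₗ[ℝ] W} (hf : Function.Injective f) :
    Function.Injective (LinearMap.adjoint f ∘ₗ f) := by
  rw [injective_iff_map_eq_zero]
  intro v hv
  have : ⟪f v, f v⟫ = 0 := by
    rw [← LinearMap.adjoint_inner_left, ← LinearMap.comp_apply, hv, inner_zero_left]
  exact (injective_iff_map_eq_zero f).1 hf v (inner_self_eq_zero.1 this)

theorem linInv_comp_self {f : V →ₗ[ℝ] V} (hf : Function.Injective f) :
    linInv f ∘ₗ f = LinearMap.id := by
  obtain ⟨g, hg⟩ := LinearMap.exists_leftInverse_of_injective f (LinearMap.ker_eq_bot.2 hf)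
  rwa [linInv_eq_of_comp_eq_id hg]

theorem Adagger_symbolMap {A : CoeffOp n k V W} (hell : IsElliptic n k A) {ξ : Euc n}
    (hξ : ξ ≠ 0) (v : V) : Adagger n k A ξ (symbolMap n k A ξ v) = v :=
  LinearMap.congr_fun (linInv_comp_self (injective_adjoint_comp_self (hell ξ hξ))) v

theorem Adagger_smul {A : CoeffOp n k V W} (hell : IsElliptic n k A) {t : ℝ} (ht : t ≠ 0)
    {ξ : Euc n} (hξ : ξ ≠ 0) :
    Adagger n k A (t • ξ) = (t ^ k)⁻¹ • Adagger n k A ξ := by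
  have h := linInv_comp_self (injective_adjoint_comp_self (hell ξ hξ))
  set G := LinearMap.adjoint (symbolMap n k A ξ) ∘ₗ symbolMap n k A ξ with hG
  have htk : t ^ k ≠ 0 := pow_ne_zero k ht
  have hinv : linInv (t ^ k • t ^ k • G) = (t ^ k)⁻¹ • (t ^ k)⁻¹ • linInv G := by
    apply linInv_eq_of_comp_eq_id
    simp only [LinearMap.comp_smul, LinearMap.smul_comp, h]
    simp only [smul_smul]
    rw [show t ^ k * (t ^ k * ((t ^ k)⁻¹ * (t ^ k)⁻¹)) = 1 by field_simp, one_smul]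
  unfold Adagger
  have hs : LinearMap.adjoint (t ^ k • symbolMap n k A ξ)
      = t ^ k • LinearMap.adjoint (symbolMap n k A ξ) := by simp
  rw [symbolMap_smul, hs, LinearMap.comp_smul, LinearMap.comp_smul, LinearMap.smul_comp, ← hG,
    hinv]
  simp only [LinearMap.smul_comp, smul_smul]
  congr 1
  field_simp

theorem inner_symbolMap_Adagger_comm (A : CoeffOp n k V W) {ξ : Euc n}
    (hell : IsElliptic n k A) (hξ : ξ ≠ 0) (w w' : W) :
    ⟪symbolMap n k A ξ (Adagger n k A ξ w), w'⟫ =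
      ⟪w, symbolMap n k A ξ (Adagger n k A ξ w')⟫ := by
  have h := linInv_comp_self (injective_adjoint_comp_self (hell ξ hξ))
  set G := LinearMap.adjoint (symbolMap n k A ξ) ∘ₗ symbolMap n k A ξ with hG
  have h' : G ∘ₗ linInv G = LinearMap.id := by
    rwa [LinearMap.comp_eq_id_comm] at h
  have key : ∀ v v', ⟪linInv G v, v'⟫ = ⟪v, linInv G v'⟫ := by
    intro v v'
    have e (v) : G (linInv G v) = v := LinearMap.congr_fun h' v
    conv_lhs => rw [← e v']
    conv_rhs => rw [← e v]
    simp only [hG, LinearMap.comp_apply, LinearMap.adjoint_inner_right,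
      LinearMap.adjoint_inner_left]
  simp only [Adagger, LinearMap.comp_apply, ← hG]
  rw [← LinearMap.adjoint_inner_right (symbolMap n k A ξ), key,
    LinearMap.adjoint_inner_left (symbolMap n k A ξ)]

theorem inner_residual_eq_norm_sq {A : CoeffOp n k V W} (hell : IsElliptic n k A)
    {ξ : Euc n} (hξ : ξ ≠ 0) (w : W) :
    ⟪w - symbolMap n k A ξ (Adagger n k A ξ w), w⟫ =
      ‖w - symbolMap n k A ξ (Adagger n k A ξ w)‖ ^ 2 := by
  rw [← real_inner_self_eq_norm_sq]
  set P := symbolMap n k A ξ (Adagger n k A ξ w) with hP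
  have : ⟪w - P, P⟫ = 0 := by
    have h := inner_symbolMap_Adagger_comm A hell hξ w P
    conv_rhs at h => rw [hP, Adagger_symbolMap hell hξ]
    rw [inner_sub_left, ← hP] at *
    rw [h, sub_self]
  rw [inner_sub_right (w - P), this, sub_zero]

theorem contDiffAt_Adagger {A : CoeffOp n k V W} (hell : IsElliptic n k A) {ξ : Euc n}
    (hξ : ξ ≠ 0) (v : V) (w : W) :
    ContDiffAt ℝ (⊤ : ℕ∞) (fun ξ => ⟪v, Adagger n k A ξ w⟫) ξ := by
  have hprod (I : Fin k → Fin n) : ContDiff ℝ (⊤ : ℕ∞) (fun ξ : Euc n => ∏ i, ξ (I i)) := by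
    fun_prop
  have hadj (ξ : Euc n) : LinearMap.adjoint (symbolMap n k A ξ) =
      ∑ I : Fin k → Fin n, (∏ i, ξ (I i)) • LinearMap.adjoint (A I) := by
    simp [symbolMap]
  let G : Euc n → (V →L[ℝ] V) := fun ξ => ∑ I : Fin k → Fin n, ∑ I' : Fin k → Fin n,
    ((∏ i, ξ (I i)) * ∏ i, ξ (I' i)) • (LinearMap.adjoint (A I) ∘ₗ A I').toContinuousLinearMap
  have hG (ξ : Euc n) : (G ξ : V →ₗ[ℝ] V) =
      LinearMap.adjoint (symbolMap n k A ξ) ∘ₗ symbolMap n k A ξ := by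
    ext v
    simp only [G, hadj, LinearMap.comp_apply, symbolMap_apply, map_sum, map_smul,
      LinearMap.sum_apply, LinearMap.smul_apply, ContinuousLinearMap.coe_coe,
      sum_apply, smul_apply, Finset.smul_sum,
      LinearMap.coe_toContinuousLinearMap', smul_smul]
    rw [Finset.sum_comm]
    refine Finset.sum_congr rfl fun I _ => Finset.sum_congr rfl fun J _ => ?_
    rw [mul_comm]
  have hGs : ContDiff ℝ (⊤ : ℕ∞) G := by
    refine ContDiff.sum fun I _ => ContDiff.sum fun J _ => ?_
    exact ((hprod I).mul (hprod J)).smul contDiff_const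
  have hunit {ξ : Euc n} (hξ : ξ ≠ 0) : IsUnit (G ξ) ∧
      ((Ring.inverse (G ξ) : V →L[ℝ] V) : V →ₗ[ℝ] V) = linInv (G ξ : V →ₗ[ℝ] V) := by
    have h := linInv_comp_self (injective_adjoint_comp_self (hell ξ hξ))
    rw [← hG] at h
    have h' := h
    rw [LinearMap.comp_eq_id_comm] at h'
    let L : V →L[ℝ] V := (linInv (G ξ : V →ₗ[ℝ] V)).toContinuousLinearMap
    have h1 : G ξ * L = 1 := by
      ext v; exact LinearMap.congr_fun h' v
    have h2 : L * G ξ = 1 := by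
      ext v; exact LinearMap.congr_fun h v
    let U : (V →L[ℝ] V)ˣ := ⟨G ξ, L, h1, h2⟩
    refine ⟨U.isUnit, ?_⟩
    have : Ring.inverse (G ξ) = L := Ring.inverse_unit U
    rw [this]
    rfl
  obtain ⟨⟨U, hU⟩, -⟩ := hunit hξ
  have hinv : ContDiffAt ℝ (⊤ : ℕ∞) (fun ξ => Ring.inverse (G ξ)) ξ :=
    ContDiffAt.comp (g := Ring.inverse) ξ (hU ▸ contDiffAt_ringInverse ℝ U) hGs.contDiffAt
  have hw : ContDiff ℝ (⊤ : ℕ∞) (fun ξ : Euc n => ∑ I : Fin k → Fin n,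
      (∏ i, ξ (I i)) • LinearMap.adjoint (A I) w) :=
    ContDiff.sum fun I _ => (hprod I).smul contDiff_const
  refine ((contDiffAt_const (c := v)).inner ℝ (hinv.clm_apply hw.contDiffAt)).congr_of_eventuallyEq
    (f₁ := fun ξ => ⟪v, Adagger n k A ξ w⟫) ?_
  filter_upwards [isOpen_ne.mem_nhds hξ] with η hη
  have hB := LinearMap.congr_fun (hunit hη).2 (LinearMap.adjoint (symbolMap n k A η) w)
  rw [hG, ContinuousLinearMap.coe_coe] at hB
  simp only [Adagger, LinearMap.comp_apply]
  rw [← hB, hadj]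
  simp [LinearMap.sum_apply]

end Symbol

section Cutoff

variable {n : ℕ}

/-- A smooth radial cutoff on `ℝ^n`, equal to `1` on the unit ball. -/
noncomputable def cutoff (ξ : Euc n) : ℝ := Real.smoothTransition (2 - ‖ξ‖ ^ 2)

/-- The dyadic annular bump `cutoff ξ - cutoff (2 ξ)`. -/
noncomputable def annularBump (ξ : Euc n) : ℝ := cutoff ξ - cutoff ((2 : ℝ) • ξ)

theorem contDiff_cutoff : ContDiff ℝ (⊤ : ℕ∞) (cutoff : Euc n → ℝ) :=
  Real.smoothTransition.contDiff.comp (contDiff_const.sub (contDiff_norm_sq ℝ))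

theorem cutoff_eq_one {ξ : Euc n} (h : ‖ξ‖ ≤ 1) : cutoff ξ = 1 :=
  Real.smoothTransition.one_of_one_le (by nlinarith [norm_nonneg ξ])

theorem cutoff_eq_zero {ξ : Euc n} (h : 2 ≤ ‖ξ‖) : cutoff ξ = 0 :=
  Real.smoothTransition.zero_of_nonpos (by nlinarith [norm_nonneg ξ])

theorem cutoff_nonneg (ξ : Euc n) : 0 ≤ cutoff ξ := Real.smoothTransition.nonneg _

theorem cutoff_le_one (ξ : Euc n) : cutoff ξ ≤ 1 := Real.smoothTransition.le_one _

theorem cutoff_eq_of_norm_eq {ξ η : Euc n} (h : ‖ξ‖ = ‖η‖) : cutoff ξ = cutoff η := by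
  simp [cutoff, h]

theorem cutoff_anti {ξ η : Euc n} (h : ‖ξ‖ ≤ ‖η‖) : cutoff η ≤ cutoff ξ :=
  Real.smoothTransition.monotone (by gcongr)

theorem hasCompactSupport_cutoff : HasCompactSupport (cutoff : Euc n → ℝ) :=
  HasCompactSupport.intro (isCompact_closedBall (0 : Euc n) 2) fun ξ hξ =>
    cutoff_eq_zero (by simpa using (not_le.1 (mt mem_closedBall_zero_iff.2 hξ)).le)

theorem contDiff_annularBump : ContDiff ℝ (⊤ : ℕ∞) (annularBump : Euc n → ℝ) :=
  contDiff_cutoff.sub (contDiff_cutoff.comp (contDiff_const_smul (2 : ℝ)))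

theorem annularBump_nonneg (ξ : Euc n) : 0 ≤ annularBump ξ :=
  sub_nonneg.2 (cutoff_anti (by rw [norm_smul]; norm_num; linarith [norm_nonneg ξ]))

theorem annularBump_eq_zero_of_le {ξ : Euc n} (h : ‖ξ‖ ≤ 1 / 2) : annularBump ξ = 0 := by
  rw [annularBump, cutoff_eq_one (by linarith), cutoff_eq_one, sub_self]
  rw [norm_smul]; norm_num; linarith

theorem annularBump_eq_zero_of_ge {ξ : Euc n} (h : 2 ≤ ‖ξ‖) : annularBump ξ = 0 := by
  rw [annularBump, cutoff_eq_zero h, cutoff_eq_zero, sub_self]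
  rw [norm_smul]; norm_num; linarith

theorem annularBump_eq_one {ξ : Euc n} (h : ‖ξ‖ = 1) : annularBump ξ = 1 := by
  rw [annularBump, cutoff_eq_one h.le, cutoff_eq_zero, sub_zero]
  rw [norm_smul, h]; norm_num

theorem annularBump_eq_of_norm_eq {ξ η : Euc n} (h : ‖ξ‖ = ‖η‖) :
    annularBump ξ = annularBump η := by
  rw [annularBump, annularBump, cutoff_eq_of_norm_eq h,
    cutoff_eq_of_norm_eq (ξ := (2 : ℝ) • ξ) (η := (2 : ℝ) • η) (by simp [norm_smul, h])]

theorem hasCompactSupport_annularBump : HasCompactSupport (annularBump : Euc n → ℝ) :=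
  HasCompactSupport.intro (isCompact_closedBall (0 : Euc n) 2) fun ξ hξ =>
    annularBump_eq_zero_of_ge (by simpa using (not_le.1 (mt mem_closedBall_zero_iff.2 hξ)).le)

theorem sum_annularBump (s : ℝ) (N : ℕ) (ξ : Euc n) :
    ∑ j ∈ Finset.range N, annularBump ((2 ^ j * s) • ξ) =
      cutoff (s • ξ) - cutoff ((2 ^ N * s) • ξ) := by
  induction N with
  | zero => simp
  | succ N ih =>
    rw [Finset.sum_range_succ, ih, annularBump, smul_smul, pow_succ']
    ring_nf

/-- The product of the annular bump with a function which is smooth away from the origin is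
smooth. -/
theorem contDiff_mul_annularBump {g : Euc n → ℝ}
    (hg : ∀ ξ, ξ ≠ 0 → ContDiffAt ℝ (⊤ : ℕ∞) g ξ) :
    ContDiff ℝ (⊤ : ℕ∞) (fun ξ => g ξ * annularBump ξ) := by
  rw [contDiff_iff_contDiffAt]
  intro ξ
  by_cases h : ξ = 0
  · refine (contDiffAt_const (c := (0 : ℝ))).congr_of_eventuallyEq ?_
    filter_upwards [ball_mem_nhds ξ (by norm_num : (0 : ℝ) < 1 / 2)] with η hη
    rw [annularBump_eq_zero_of_le, mul_zero]
    exact (mem_ball_zero_iff.1 (h ▸ hη)).le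
  · exact (hg ξ h).mul contDiff_annularBump.contDiffAt

/-- Spherical integrals of functions homogeneous of degree `-n` as integrals against the annular
bump. -/
theorem exists_setIntegral_sphere_eq_annularBump (hn : 1 ≤ n) :
    ∃ c : ℝ, c ≠ 0 ∧ ∀ g : Euc n → ℝ, ContinuousOn g {0}ᶜ →
      (∀ t, 0 < t → ∀ x, x ≠ 0 → g (t • x) = (t ^ n)⁻¹ * g x) →
      ∫ ξ in sphere 0 1, g ξ ∂(μH[(n : ℝ) - 1]) = c * ∫ ξ, g ξ * annularBump ξ := by
  refine exists_setIntegral_sphere_eq n hn contDiff_annularBump.continuous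
    hasCompactSupport_annularBump annularBump_nonneg
    ⟨1 / 2, by norm_num, fun x hx => annularBump_eq_zero_of_le hx.le⟩
    (fun x y h => annularBump_eq_of_norm_eq h) ⟨stdVec n ⟨0, hn⟩, ?_⟩
  rw [annularBump_eq_one (by simp [stdVec])]
  exact one_ne_zero

end Cutoff

section DyadicSum

open scoped SchwartzMap

theorem le_telescope_of_le_of_mul_le {C x a : ℝ} (hx : 0 ≤ x) (hC : 0 ≤ C)
    (h1 : a ≤ C * x) (h2 : x * a ≤ C) :
    a ≤ 6 * C * (2 * x / (1 + 2 * x) - x / (1 + x)) := by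
  have e : 2 * x / (1 + 2 * x) - x / (1 + x) = x / ((1 + 2 * x) * (1 + x)) := by
    field_simp; ring
  rw [e, ← mul_div_assoc, le_div_iff₀ (by positivity)]
  rcases le_total x 1 with h | h
  · have : (1 + 2 * x) * (1 + x) ≤ 6 := by nlinarith
    calc a * ((1 + 2 * x) * (1 + x)) ≤ (C * x) * ((1 + 2 * x) * (1 + x)) := by gcongr
      _ ≤ (C * x) * 6 := by gcongr
      _ = 6 * C * x := by ring
  · have hxp : 0 < x := by linarith
    have ha : a ≤ C / x := by rw [le_div_iff₀ hxp]; linarith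
    calc a * ((1 + 2 * x) * (1 + x)) ≤ (C / x) * ((1 + 2 * x) * (1 + x)) := by gcongr
      _ ≤ (C / x) * (6 * x ^ 2) := mul_le_mul_of_nonneg_left (by nlinarith) (by positivity)
      _ = 6 * C * x := by field_simp

theorem sum_norm_dyadic_le {E F : Type*} [NormedAddCommGroup E] [NormedSpace ℝ E]
    [NormedAddCommGroup F] {θ : E → F} {C : ℝ} (hC : 0 ≤ C) (h1 : ∀ z, ‖θ z‖ ≤ C * ‖z‖)
    (h2 : ∀ z, ‖z‖ * ‖θ z‖ ≤ C) {s : ℝ} (hs : 0 < s) (N : ℕ) (y : E) :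
    ∑ j ∈ Finset.range N, ‖θ ((2 ^ j * s)⁻¹ • y)‖ ≤ 6 * C := by
  let φ : ℝ → ℝ := fun x => x / (1 + x)
  let x : ℕ → ℝ := fun j => ‖y‖ / (2 ^ j * s)
  have hx0 (j) : 0 ≤ x j := by positivity
  have hx (j) : x j = 2 * x (j + 1) := by
    simp only [x, pow_succ]; field_simp
  have hnorm (j) : ‖(2 ^ j * s)⁻¹ • y‖ = x j := by
    rw [norm_smul, norm_inv, Real.norm_of_nonneg (by positivity)]
    simp only [x]; rw [div_eq_inv_mul]
  have hmain : ∑ j ∈ Finset.range N, ‖θ ((2 ^ j * s)⁻¹ • y)‖ ≤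
      6 * C * (φ (2 * x 0) - φ (2 * x N)) := by
    induction N with
    | zero => simp
    | succ N ih =>
      rw [Finset.sum_range_succ]
      have := le_telescope_of_le_of_mul_le (hx0 N) hC ((h1 _).trans_eq (by rw [hnorm]))
        (show x N * ‖θ ((2 ^ N * s)⁻¹ • y)‖ ≤ C from hnorm N ▸ h2 _)
      rw [← hx N]
      change _ ≤ 6 * C * (φ (2 * x N) - φ (x N)) at this
      linarith
  have hφ0 : 0 ≤ φ (2 * x N) := by have := hx0 N; positivity
  have hφ1 : φ (2 * x 0) ≤ 1 := by
    have := hx0 0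
    exact (div_le_one (by positivity)).2 (by linarith)
  calc _ ≤ _ := hmain
    _ ≤ 6 * C * 1 := by gcongr; linarith
    _ = 6 * C := mul_one _

theorem SchwartzMap.exists_sum_norm_dyadic_le {E F : Type*} [NormedAddCommGroup E]
    [NormedSpace ℝ E] [NormedAddCommGroup F] [NormedSpace ℝ F] (θ : 𝓢(E, F)) (h0 : θ 0 = 0) :
    ∃ C : ℝ, 0 ≤ C ∧ ∀ s : ℝ, 0 < s → ∀ (N : ℕ) (y : E),
      ∑ j ∈ Finset.range N, ‖θ ((2 ^ j * s)⁻¹ • y)‖ ≤ C := by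
  obtain ⟨C₁, hC₁, h₁⟩ := θ.decay 1 0
  obtain ⟨C₂, hC₂, h₂⟩ := θ.decay 0 1
  simp only [pow_one, pow_zero, one_mul, norm_iteratedFDeriv_zero] at h₁ h₂
  have hlip (z : E) : ‖θ z‖ ≤ C₂ * ‖z‖ := by
    have := convex_univ.norm_image_sub_le_of_norm_fderiv_le (𝕜 := ℝ) (f := θ) (x := 0) (y := z)
      (fun x _ => θ.differentiableAt)
      (fun x _ => by rw [← norm_iteratedFDeriv_one]; exact h₂ x) trivial trivial
    simpa [h0] using this
  refine ⟨6 * (C₁ + C₂), by positivity, fun s hs N y => ?_⟩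
  exact sum_norm_dyadic_le (by positivity)
    (fun z => (hlip z).trans (by gcongr; linarith)) (fun z => (h₁ z).trans (by linarith)) hs N y

end DyadicSum

section Fourier

open scoped FourierTransform SchwartzMap LineDeriv

variable {n : ℕ}

theorem dirDeriv_schwartzMap {m : ℕ} (I : Fin m → Fin n) (f : 𝓢(Euc n, ℂ)) (x : Euc n) :
    dirDeriv n m I f x = ∂^{fun i => stdVec n (I i)} f x :=
  SchwartzMap.iteratedLineDerivOp_eq_iteratedFDeriv.symm

theorem fourier_iteratedLineDerivOp {m : ℕ} (I : Fin m → Fin n) (f : 𝓢(Euc n, ℂ)) (ξ : Euc n) :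
    𝓕 (∂^{fun i => stdVec n (I i)} f) ξ =
      (2 * Real.pi * Complex.I) ^ m * ((∏ i, ξ (I i) : ℝ) : ℂ) * 𝓕 f ξ := by
  induction m with
  | zero => simp
  | succ m ih =>
    rw [LineDeriv.iteratedLineDerivOp_succ_left, SchwartzMap.fourier_lineDerivOp_eq,
      smul_apply, SchwartzMap.smulLeftCLM_apply_apply (by fun_prop)]
    have := ih (Fin.tail I)
    simp only [Fin.tail_def] at this ⊢
    rw [this, Fin.prod_univ_succ, pow_succ']
    simp only [stdVec, EuclideanSpace.inner_single_right]
    simp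
    ring

theorem dirDeriv_eq_integral_fourier {m : ℕ} (I : Fin m → Fin n) (f : 𝓢(Euc n, ℂ)) (x : Euc n) :
    dirDeriv n m I f x = ∫ ξ, Complex.exp ((2 * Real.pi * ⟪ξ, x⟫ : ℝ) * Complex.I) *
      ((2 * Real.pi * Complex.I) ^ m * ((∏ i, ξ (I i) : ℝ) : ℂ) * 𝓕 f ξ) := by
  rw [dirDeriv_schwartzMap]
  conv_lhs => rw [← FourierTransform.fourierInv_fourier_eq (F := 𝓢(Euc n, ℂ))
    (∂^{fun i => stdVec n (I i)} f)]
  rw [SchwartzMap.fourierInv_coe, Real.fourierInv_eq']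
  simp only [fourier_iteratedLineDerivOp, smul_eq_mul]

theorem dirDeriv_zero_eq_integral_fourier {m : ℕ} (I : Fin m → Fin n) (f : 𝓢(Euc n, ℂ)) :
    dirDeriv n m I f 0 = (2 * Real.pi * Complex.I) ^ m *
      ∫ ξ : Euc n, ((∏ i, ξ (I i) : ℝ) : ℂ) * 𝓕 f ξ := by
  rw [dirDeriv_eq_integral_fourier, ← integral_const_mul]
  simp [mul_assoc]

theorem integrable_prod_mul {m : ℕ} (I : Fin m → Fin n) (f : 𝓢(Euc n, ℂ)) :
    Integrable fun ξ : Euc n => ((∏ i, ξ (I i) : ℝ) : ℂ) * f ξ := by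
  let g : 𝓢(Euc n, ℂ) := 𝓕 (∂^{fun i => stdVec n (I i)} (𝓕⁻ f : 𝓢(Euc n, ℂ)))
  have h : Integrable (fun ξ => g ξ) volume := g.integrable
  simp only [g, fourier_iteratedLineDerivOp, FourierTransform.fourier_fourierInv_eq,
    mul_assoc] at h
  refine (h.const_mul (((2 * (Real.pi * Complex.I)) ^ m)⁻¹)).congr
    (Eventually.of_forall fun ξ => inv_mul_cancel_left₀ ?_ _)
  simp [Real.pi_ne_zero]

/-- Dilations of Schwartz functions under the Fourier transform. -/
theorem fourier_comp_smul (f : Euc n → ℂ) {t : ℝ} (ht : 0 < t) (y : Euc n) :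
    𝓕 (fun ξ => f (t • ξ)) y = ((t ^ n)⁻¹ : ℝ) * 𝓕 f (t⁻¹ • y) := by
  rw [Real.fourier_eq', Real.fourier_eq']
  have := Measure.integral_comp_smul_of_nonneg volume (fun v : Euc n =>
    Complex.exp ((-2 * Real.pi * ⟪v, t⁻¹ • y⟫ : ℝ) * Complex.I) • f v) t (hR := ht.le)
  rw [finrank_euclideanSpace_fin, Complex.real_smul] at this
  rw [← this]
  congr with v
  rw [real_inner_smul_left, real_inner_smul_right, mul_inv_cancel_left₀ ht.ne']

theorem dirDeriv_clm_comp {E F : Type*} [NormedAddCommGroup E] [NormedSpace ℝ E]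
    [NormedAddCommGroup F] [NormedSpace ℝ F] (L : E →L[ℝ] F) {u : Euc n → E}
    (hu : ContDiff ℝ (⊤ : ℕ∞) u) {m : ℕ} (I : Fin m → Fin n) (x : Euc n) :
    dirDeriv n m I (fun x => L (u x)) x = L (dirDeriv n m I u x) := by
  have := L.iteratedFDeriv_comp_left (f := u) (x := x) (i := m) hu.contDiffAt (mod_cast le_top)
  unfold dirDeriv
  change iteratedFDeriv ℝ m (L ∘ u) x _ = _
  rw [this]
  rfl

end Fourier

section KernelEstimate

open scoped FourierTransform SchwartzMap LineDeriv

variable {n k : ℕ} {V W : Type*}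
  [NormedAddCommGroup V] [InnerProductSpace ℝ V] [FiniteDimensional ℝ V]
  [NormedAddCommGroup W] [InnerProductSpace ℝ W] [FiniteDimensional ℝ W]

omit [FiniteDimensional ℝ V] in
theorem continuous_dirDeriv {u : Euc n → V} (hu : ContDiff ℝ (⊤ : ℕ∞) u) {m : ℕ}
    (I : Fin m → Fin n) : Continuous (dirDeriv n m I u) :=
  (ContinuousMultilinearMap.apply ℝ (fun _ : Fin m => Euc n) V
    (fun i => stdVec n (I i))).continuous.comp
    (hu.continuous_iteratedFDeriv (mod_cast le_top))

omit [FiniteDimensional ℝ W] in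
theorem continuous_Aapply (A : CoeffOp n k V W) {u : Euc n → V} (hu : ContDiff ℝ (⊤ : ℕ∞) u) :
    Continuous (Aapply n k A u) :=
  continuous_finsetSum _ fun I _ =>
    (A I).continuous_of_finiteDimensional.comp (continuous_dirDeriv hu I)

omit [FiniteDimensional ℝ V] [FiniteDimensional ℝ W] in
theorem hasCompactSupport_Aapply (A : CoeffOp n k V W) {u : Euc n → V}
    (hc : HasCompactSupport u) : HasCompactSupport (Aapply n k A u) := by
  refine HasCompactSupport.intro hc.isCompact fun x hx => ?_
  refine Finset.sum_eq_zero fun I _ => ?_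
  have : dirDeriv n k I u x = 0 := by
    unfold dirDeriv
    have h := image_eq_zero_of_notMem_tsupport
      (mt (tsupport_iteratedFDeriv_subset (𝕜 := ℝ) (f := u) k ·) hx)
    rw [h]; rfl
  rw [this, map_zero]

/-- The complex-valued Schwartz functions `⟪e, u⟫`, for a test function `u` and `e : V`. -/
noncomputable def innerSchwartz {u : Euc n → V} (hu : ContDiff ℝ (⊤ : ℕ∞) u)
    (hc : HasCompactSupport u) : V →ₗ[ℝ] 𝓢(Euc n, ℂ) where
  toFun e := HasCompactSupport.toSchwartzMap (f := fun x => ((⟪e, u x⟫ : ℝ) : ℂ))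
    (hc.comp_left (g := fun v => ((⟪e, v⟫ : ℝ) : ℂ)) (by simp))
    (Complex.ofRealCLM.contDiff.comp (contDiff_const.inner ℝ hu))
  map_add' e e' := by
    ext x
    change ((⟪e + e', u x⟫ : ℝ) : ℂ) = (⟪e, u x⟫ : ℝ) + (⟪e', u x⟫ : ℝ)
    simp [inner_add_left]
  map_smul' c e := by
    ext x
    change ((⟪c • e, u x⟫ : ℝ) : ℂ) = c • ((⟪e, u x⟫ : ℝ) : ℂ)
    simp [real_inner_smul_left]

omit [FiniteDimensional ℝ V] in
theorem dirDeriv_innerSchwartz {u : Euc n → V} (hu : ContDiff ℝ (⊤ : ℕ∞) u)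
    (hc : HasCompactSupport u) (e : V) {m : ℕ} (I : Fin m → Fin n) (x : Euc n) :
    dirDeriv n m I (innerSchwartz hu hc e) x = ((⟪e, dirDeriv n m I u x⟫ : ℝ) : ℂ) :=
  dirDeriv_clm_comp (Complex.ofRealCLM ∘L innerSL ℝ e) hu I x

/-- The complex-valued Schwartz function `⟪w, 𝒜 u⟫`. -/
noncomputable def innerAapplySchwartz (A : CoeffOp n k V W) {u : Euc n → V}
    (hu : ContDiff ℝ (⊤ : ℕ∞) u) (hc : HasCompactSupport u) (w : W) : 𝓢(Euc n, ℂ) :=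
  ∑ I : Fin k → Fin n,
    ∂^{fun i => stdVec n (I i)} (innerSchwartz hu hc (LinearMap.adjoint (A I) w))

theorem innerAapplySchwartz_apply (A : CoeffOp n k V W) {u : Euc n → V}
    (hu : ContDiff ℝ (⊤ : ℕ∞) u) (hc : HasCompactSupport u) (w : W) (x : Euc n) :
    innerAapplySchwartz A hu hc w x = ((⟪w, Aapply n k A u x⟫ : ℝ) : ℂ) := by
  simp [innerAapplySchwartz, Aapply, ← dirDeriv_schwartzMap,
    dirDeriv_innerSchwartz, inner_sum, LinearMap.adjoint_inner_left]

theorem fourier_innerAapplySchwartz (A : CoeffOp n k V W) {u : Euc n → V}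
    (hu : ContDiff ℝ (⊤ : ℕ∞) u) (hc : HasCompactSupport u) (w : W) (ξ : Euc n) :
    𝓕 (innerAapplySchwartz A hu hc w) ξ = (2 * Real.pi * Complex.I) ^ k *
      𝓕 (innerSchwartz hu hc (LinearMap.adjoint (symbolMap n k A ξ) w)) ξ := by
  have hsum : LinearMap.adjoint (symbolMap n k A ξ) w =
      ∑ I : Fin k → Fin n, (∏ i, ξ (I i)) • LinearMap.adjoint (A I) w := by
    simp [symbolMap, LinearMap.sum_apply]
  rw [hsum, innerAapplySchwartz, map_sum]
  simp only [map_smul, FourierTransform.fourier_sum, FourierTransform.fourier_smul,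
    sum_apply, smul_apply, fourier_iteratedLineDerivOp, Finset.mul_sum,
    Complex.real_smul]
  exact Finset.sum_congr rfl fun I _ => by ring

theorem integral_fourier_dilation_mul {g : Euc n → ℝ} (hg : ContDiff ℝ (⊤ : ℕ∞) g)
    (hgc : HasCompactSupport g) {t : ℝ} (ht : 0 < t) (f : 𝓢(Euc n, ℂ)) :
    ∫ y, 𝓕 (fun ξ => (g ξ : ℂ)) (t⁻¹ • y) * f y =
      ∫ ξ, ((t ^ n * g (t • ξ) : ℝ) : ℂ) * 𝓕 f ξ := by
  let G : 𝓢(Euc n, ℂ) := HasCompactSupport.toSchwartzMap (f := fun ξ => ((g (t • ξ) : ℝ) : ℂ))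
    ((hgc.comp_smul ht.ne').comp_left (g := fun v : ℝ => (v : ℂ)) (by simp))
    (Complex.ofRealCLM.contDiff.comp (hg.comp (contDiff_const_smul t)))
  have h := SchwartzMap.integral_fourier_mul_eq G f
  have hG (y : Euc n) : 𝓕 G y = ((t ^ n)⁻¹ : ℝ) * 𝓕 (fun ξ => (g ξ : ℂ)) (t⁻¹ • y) := by
    rw [SchwartzMap.fourier_coe]
    exact fourier_comp_smul (fun ξ => (g ξ : ℂ)) ht y
  have h' := congrArg (fun z => ((t ^ n : ℝ) : ℂ) * z) h
  simp only [← integral_const_mul] at h'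
  convert! h' using 2
  · ext y
    rw [hG, ← mul_assoc, ← mul_assoc, ← Complex.ofReal_mul, mul_inv_cancel₀ (by positivity)]
    simp
  · ext ξ
    rw [Complex.ofReal_mul, mul_assoc]
    rfl

/-- The frequency-localised representation formula for `∂_J ⟪e, u⟫` in terms of `𝒜 u`. -/
theorem sum_integral_fourier_mul_innerAapplySchwartz {m : ℕ} (hk : m + n = k)
    {A : CoeffOp n k V W} {J : Fin m → Fin n} {e : V} {ι : Type*} [Fintype ι] {w : ι → W}
    {μ : ι → Euc n → ℝ} (hμ : ∀ b, ContDiff ℝ (⊤ : ℕ∞) (μ b))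
    (hμc : ∀ b, HasCompactSupport (μ b))
    (hsum : ∀ ξ, ∑ b, μ b ξ • LinearMap.adjoint (symbolMap n k A ξ) (w b) =
      ((∏ i, ξ (J i)) * annularBump ξ) • e)
    {u : Euc n → V} (hu : ContDiff ℝ (⊤ : ℕ∞) u) (hc : HasCompactSupport u)
    {t : ℝ} (ht : 0 < t) :
    ∑ b, ∫ y, 𝓕 (fun ξ => (μ b ξ : ℂ)) (t⁻¹ • y) * innerAapplySchwartz A hu hc (w b) y =
      (2 * Real.pi * Complex.I) ^ k * ∫ ξ : Euc n, ((annularBump (t • ξ) : ℝ) : ℂ) *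
        (((∏ i, ξ (J i) : ℝ) : ℂ) * 𝓕 (innerSchwartz hu hc e) ξ) := by
  simp only [fun b => integral_fourier_dilation_mul (hμ b) (hμc b) ht
    (innerAapplySchwartz A hu hc (w b))]
  rw [← integral_finsetSum, ← integral_const_mul]
  · congr with ξ
    have h := hsum (t • ξ)
    have hadj : ∀ v, LinearMap.adjoint (symbolMap n k A (t • ξ)) v =
        t ^ k • LinearMap.adjoint (symbolMap n k A ξ) v := fun v => by
      rw [symbolMap_smul]; simp
    simp only [hadj, prod_smul_apply] at h
    have htk : t ^ k ≠ 0 := by positivity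
    have h2 : ∑ b, (t ^ n * μ b (t • ξ)) • LinearMap.adjoint (symbolMap n k A ξ) (w b) =
        ((∏ i, ξ (J i)) * annularBump (t • ξ)) • e := by
      have := congrArg (fun v => (t ^ n * (t ^ k)⁻¹) • v) h
      simp only [Finset.smul_sum, smul_smul] at this
      have hscal : (∏ i, ξ (J i)) * annularBump (t • ξ) =
          t ^ n * (t ^ k)⁻¹ * ((t ^ m * ∏ i, ξ (J i)) * annularBump (t • ξ)) := by
        rw [← hk, pow_add]
        field_simp
      rw [hscal, ← this]
      refine Finset.sum_congr rfl fun b _ => ?_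
      congr 1
      field_simp
    have h3 := congrArg (fun e => 𝓕 (innerSchwartz hu hc e) ξ) h2
    simp only [map_sum, map_smul, FourierTransform.fourier_sum, FourierTransform.fourier_smul,
      sum_apply, smul_apply] at h3
    simp only [fourier_innerAapplySchwartz]
    calc _ = (2 * Real.pi * Complex.I) ^ k * ∑ b, (t ^ n * μ b (t • ξ)) •
          𝓕 (innerSchwartz hu hc (LinearMap.adjoint (symbolMap n k A ξ) (w b))) ξ := by
          rw [Finset.mul_sum]
          refine Finset.sum_congr rfl fun b _ => ?_
          rw [Complex.real_smul]; ring
      _ = _ := by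
          rw [h3, Complex.real_smul, Complex.ofReal_mul]; ring
  · intro b _
    refine Continuous.integrable_of_hasCompactSupport ?_ ?_
    · have := (hμ b).continuous
      have := (𝓕 (innerAapplySchwartz A hu hc (w b))).continuous
      fun_prop
    · refine HasCompactSupport.mul_right ?_
      refine ((hμc b).comp_smul ht.ne').comp_left
        (g := fun v : ℝ => ((t ^ n * v : ℝ) : ℂ)) (by simp)

theorem tendsto_cutoff_sub_cutoff {ξ : Euc n} (hξ : ξ ≠ 0) :
    Tendsto (fun M : ℕ => cutoff (((2 : ℝ) ^ M)⁻¹ • ξ) -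
      cutoff ((2 ^ (2 * M) * ((2 : ℝ) ^ M)⁻¹) • ξ)) atTop (𝓝 1) := by
  have hpos : 0 < ‖ξ‖ := norm_pos_iff.2 hξ
  have htop : Tendsto (fun M : ℕ => (2 : ℝ) ^ M) atTop atTop :=
    tendsto_pow_atTop_atTop_of_one_lt one_lt_two
  refine tendsto_const_nhds.congr' ?_
  filter_upwards [htop.eventually_ge_atTop ‖ξ‖, htop.eventually_ge_atTop (2 / ‖ξ‖)] with M h1 h2
  have hM : (0 : ℝ) < 2 ^ M := by positivity
  rw [cutoff_eq_one, cutoff_eq_zero, sub_zero]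
  · rw [norm_smul, Real.norm_of_nonneg (by positivity), pow_mul', pow_two, mul_assoc (2 ^ M),
      mul_inv_cancel₀ hM.ne', mul_one]
    rwa [div_le_iff₀ hpos] at h2
  · rw [norm_smul, Real.norm_of_nonneg (by positivity), inv_mul_le_iff₀ hM, mul_one]
    exact h1

/-- Pointwise control of `∂_J ⟪e, u⟫` at the origin by `‖𝒜 u‖_{L¹}`, given a multiplier of mean
zero on the unit annulus which reproduces `∂_J ⟪e, u⟫` from `𝒜 u`. -/
theorem exists_abs_inner_dirDeriv_zero_le (hn : 1 ≤ n) {m : ℕ} (hk : m + n = k)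
    {A : CoeffOp n k V W} {J : Fin m → Fin n} {e : V} {ι : Type*} [Fintype ι] {w : ι → W}
    {μ : ι → Euc n → ℝ} (hμ : ∀ b, ContDiff ℝ (⊤ : ℕ∞) (μ b))
    (hμc : ∀ b, HasCompactSupport (μ b)) (hμ0 : ∀ b, ∫ ξ, μ b ξ = 0)
    (hsum : ∀ ξ, ∑ b, μ b ξ • LinearMap.adjoint (symbolMap n k A ξ) (w b) =
      ((∏ i, ξ (J i)) * annularBump ξ) • e) :
    ∃ C : ℝ, 0 ≤ C ∧ ∀ u : Euc n → V, ContDiff ℝ (⊤ : ℕ∞) u → HasCompactSupport u →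
      |⟪e, dirDeriv n m J u 0⟫| ≤ C * ∫ x, ‖Aapply n k A u x‖ := by
  have : Nonempty (Fin n) := ⟨⟨0, hn⟩⟩
  let S (b : ι) : 𝓢(Euc n, ℂ) := HasCompactSupport.toSchwartzMap
    (f := fun ξ => ((μ b ξ : ℝ) : ℂ))
    ((hμc b).comp_left (g := fun v : ℝ => (v : ℂ)) (by simp))
    (Complex.ofRealCLM.contDiff.comp (hμ b))
  have hS (b) (y : Euc n) : 𝓕 (fun ξ => (μ b ξ : ℂ)) y = 𝓕 (S b) y := by
    rw [SchwartzMap.fourier_coe]; rfl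
  have hS0 (b) : 𝓕 (S b) 0 = 0 := by
    rw [← hS, Real.fourier_eq']
    simp only [inner_zero_right, mul_zero, Complex.ofReal_zero, zero_mul, Complex.exp_zero,
      one_smul]
    rw [integral_complex_ofReal, hμ0, Complex.ofReal_zero]
  choose C hC0 hC using fun b => SchwartzMap.exists_sum_norm_dyadic_le (𝓕 (S b)) (hS0 b)
  refine ⟨((2 * Real.pi) ^ n)⁻¹ * ∑ b, C b * ‖w b‖, mul_nonneg (by positivity)
    (Finset.sum_nonneg fun b _ => mul_nonneg (hC0 b) (norm_nonneg _)), fun u hu hc => ?_⟩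
  set f : Euc n → ℂ := fun ξ => ((∏ i, ξ (J i) : ℝ) : ℂ) * 𝓕 (innerSchwartz hu hc e) ξ with hf
  have hfi : Integrable f := integrable_prod_mul J _
  have hint : Integrable fun x => ‖Aapply n k A u x‖ :=
    ((continuous_Aapply A hu).integrable_of_hasCompactSupport
      (hasCompactSupport_Aapply A hc)).norm
  have hbound (s : ℝ) (hs : 0 < s) (N : ℕ) :
      ‖(2 * Real.pi * Complex.I) ^ k *
        ∫ ξ, ((cutoff (s • ξ) - cutoff ((2 ^ N * s) • ξ) : ℝ) : ℂ) * f ξ‖ ≤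
      (∑ b, C b * ‖w b‖) * ∫ x, ‖Aapply n k A u x‖ := by
    have hrep : (2 * Real.pi * Complex.I) ^ k *
        ∫ ξ, ((cutoff (s • ξ) - cutoff ((2 ^ N * s) • ξ) : ℝ) : ℂ) * f ξ =
        ∑ b, ∫ y, (∑ j ∈ Finset.range N, 𝓕 (S b) ((2 ^ j * s)⁻¹ • y)) *
          innerAapplySchwartz A hu hc (w b) y := by
      simp only [← sum_annularBump, Complex.ofReal_sum, Finset.sum_mul]
      rw [integral_finsetSum, Finset.mul_sum]
      · simp only [hf, ← fun j : ℕ => sum_integral_fourier_mul_innerAapplySchwartz hk hμ hμc hsum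
          hu hc (by positivity : 0 < 2 ^ j * s)]
        rw [Finset.sum_comm]
        refine Finset.sum_congr rfl fun b _ => ?_
        rw [integral_finsetSum]
        · simp only [hS]
        · intro j _
          obtain ⟨B, hB, hB'⟩ := (𝓕 (S b)).decay 0 0
          refine (innerAapplySchwartz A hu hc (w b)).integrable.bdd_mul (c := B) ?_
            (Eventually.of_forall fun y => by simpa using hB' _)
          have := (𝓕 (S b)).continuous
          exact Continuous.aestronglyMeasurable (by fun_prop)
      · intro j _
        refine hfi.bdd_mul (c := 1) ?_ (Eventually.of_forall fun y => ?_)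
        · have := (contDiff_annularBump (n := n)).continuous
          exact Continuous.aestronglyMeasurable (by fun_prop)
        · rw [Complex.norm_real, Real.norm_of_nonneg (annularBump_nonneg _)]
          exact (sub_le_self _ (cutoff_nonneg _)).trans (cutoff_le_one _)
    rw [hrep, Finset.sum_mul]
    refine (norm_sum_le _ _).trans (Finset.sum_le_sum fun b _ => ?_)
    rw [← integral_const_mul]
    refine norm_integral_le_of_norm_le (hint.const_mul _) (Eventually.of_forall fun y => ?_)
    rw [norm_mul, innerAapplySchwartz_apply, Complex.norm_real, mul_assoc]
    gcongr
    · exact hC0 b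
    · exact (norm_sum_le _ _).trans (hC b s hs N y)
    · exact norm_inner_le_norm _ _
  have hlim : Tendsto (fun M : ℕ => ∫ ξ, ((cutoff (((2 : ℝ) ^ M)⁻¹ • ξ) -
      cutoff ((2 ^ (2 * M) * ((2 : ℝ) ^ M)⁻¹) • ξ) : ℝ) : ℂ) * f ξ) atTop (𝓝 (∫ ξ, f ξ)) := by
    refine tendsto_integral_of_dominated_convergence (fun ξ => ‖f ξ‖) ?_ hfi.norm ?_ ?_
    · intro M
      have := (contDiff_cutoff (n := n)).continuous
      exact Continuous.aestronglyMeasurable (by fun_prop) |>.mul hfi.aestronglyMeasurable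
    · refine fun M => Eventually.of_forall fun ξ => ?_
      rw [norm_mul, Complex.norm_real, Real.norm_eq_abs]
      refine mul_le_of_le_one_left (norm_nonneg _) (abs_le.2 ⟨?_, ?_⟩)
      · linarith [cutoff_nonneg (((2 : ℝ) ^ M)⁻¹ • ξ),
          cutoff_le_one ((2 ^ (2 * M) * ((2 : ℝ) ^ M)⁻¹) • ξ)]
      · linarith [cutoff_le_one (((2 : ℝ) ^ M)⁻¹ • ξ),
          cutoff_nonneg ((2 ^ (2 * M) * ((2 : ℝ) ^ M)⁻¹) • ξ)]
    · filter_upwards [compl_mem_ae_iff.2 (measure_singleton (0 : Euc n))] with ξ hξ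
      have := (Complex.continuous_ofReal.tendsto 1).comp (tendsto_cutoff_sub_cutoff hξ)
      simpa using this.mul_const (f ξ)
  have hle := le_of_tendsto ((hlim.const_mul _).norm)
    (Eventually.of_forall fun M => hbound (((2 : ℝ) ^ M)⁻¹) (by positivity) (2 * M))
  have hval := dirDeriv_zero_eq_integral_fourier J (innerSchwartz hu hc e)
  rw [dirDeriv_innerSchwartz] at hval
  have hnorm : |⟪e, dirDeriv n m J u 0⟫| = (2 * Real.pi) ^ m * ‖∫ ξ, f ξ‖ := by
    rw [← Real.norm_eq_abs, ← Complex.norm_real, hval]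
    simp [abs_of_pos Real.pi_pos, hf]
  have hnorm' : ‖(2 * Real.pi * Complex.I) ^ k * ∫ ξ, f ξ‖ =
      (2 * Real.pi) ^ n * |⟪e, dirDeriv n m J u 0⟫| := by
    rw [hnorm, ← hk]
    simp [abs_of_pos Real.pi_pos]
    ring
  rw [hnorm'] at hle
  rw [mul_assoc, ← div_eq_inv_mul, le_div_iff₀ (by positivity)]
  linarith

end KernelEstimate

section Multiplier

variable {n k : ℕ} {V W : Type*}
  [NormedAddCommGroup V] [InnerProductSpace ℝ V] [FiniteDimensional ℝ V]
  [NormedAddCommGroup W] [InnerProductSpace ℝ W] [FiniteDimensional ℝ W]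

theorem contDiffAt_prod_mul_inner_Adagger {m : ℕ} {A : CoeffOp n k V W}
    (hell : IsElliptic n k A) (J : Fin m → Fin n) (e : V) (w : W) (ξ : Euc n) (hξ : ξ ≠ 0) :
    ContDiffAt ℝ (⊤ : ℕ∞) (fun ξ : Euc n => (∏ i, ξ (J i)) * ⟪e, Adagger n k A ξ w⟫) ξ := by
  have : ContDiff ℝ (⊤ : ℕ∞) (fun ξ : Euc n => ∏ i, ξ (J i)) := by fun_prop
  exact this.contDiffAt.mul (contDiffAt_Adagger hell hξ e w)

theorem prod_mul_inner_Adagger_smul {m : ℕ} (hk : m + n = k) {A : CoeffOp n k V W}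
    (hell : IsElliptic n k A) (J : Fin m → Fin n) (e : V) (w : W) {t : ℝ} (ht : 0 < t)
    {ξ : Euc n} (hξ : ξ ≠ 0) :
    (∏ i, (t • ξ) (J i)) * ⟪e, Adagger n k A (t • ξ) w⟫ =
      (t ^ n)⁻¹ * ((∏ i, ξ (J i)) * ⟪e, Adagger n k A ξ w⟫) := by
  rw [prod_smul_apply, Adagger_smul hell ht.ne' hξ, LinearMap.smul_apply, real_inner_smul_right]
  have : t ^ k = t ^ m * t ^ n := by rw [← hk, pow_add]
  rw [this]
  field_simp

/-- The tensor components of the spherical integral in condition (WC), expressed as volume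
integrals. -/
theorem exists_inner_setIntegral_sphere_Adagger (hn : 1 ≤ n) {m : ℕ} (hk : m + n = k)
    {A : CoeffOp n k V W} (hell : IsElliptic n k A) :
    ∃ c : ℝ, c ≠ 0 ∧ ∀ (J : Fin m → Fin n) (e : V) (w : W),
      ⟪e, ∫ ξ in sphere (0 : Euc n) 1,
        (∏ i, ξ (J i)) • (Adagger n k A ξ w) ∂(μH[(n : ℝ) - 1])⟫ =
      c * ∫ ξ, ((∏ i, ξ (J i)) * ⟪e, Adagger n k A ξ w⟫) * annularBump ξ := by
  obtain ⟨c, hc, h⟩ := exists_setIntegral_sphere_eq_annularBump hn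
  refine ⟨c, hc, fun J e w => ?_⟩
  have hg := contDiffAt_prod_mul_inner_Adagger hell J
  rw [← h _ (fun ξ hξ => (hg e w ξ hξ).continuousAt.continuousWithinAt)
    (fun t ht ξ hξ => prod_mul_inner_Adagger_smul hk hell J e w ht hξ)]
  have hcont : ContinuousOn (fun ξ : Euc n => (∏ i, ξ (J i)) • Adagger n k A ξ w)
      (sphere (0 : Euc n) 1) := by
    let b := stdOrthonormalBasis ℝ V
    have : (fun ξ : Euc n => (∏ i, ξ (J i)) • Adagger n k A ξ w) =
        fun ξ => ∑ i, ((∏ i, ξ (J i)) * ⟪b i, Adagger n k A ξ w⟫) • b i := by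
      ext ξ
      conv_lhs => rw [← b.sum_repr' (Adagger n k A ξ w), Finset.smul_sum]
      simp only [smul_smul]
    rw [this]
    refine continuousOn_finsetSum _ fun i _ => ContinuousOn.smul (fun ξ hξ => ?_)
      continuousOn_const
    refine (hg (b i) w ξ ?_).continuousAt.continuousWithinAt
    exact ne_of_mem_sphere hξ one_ne_zero
  have hfin : (μH[(n : ℝ) - 1] : Measure (Euc n)) (sphere 0 1) ≠ ∞ := by
    obtain ⟨p, rfl⟩ : ∃ p, n = p + 1 := ⟨n - 1, by omega⟩
    have := hausdorffMeasure_sphere_lt_top p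
    push_cast
    rw [add_sub_cancel_right]
    exact this.ne
  have hint := hcont.integrableOn_of_subset_isCompact (isCompact_sphere 0 1)
    isClosed_sphere.measurableSet subset_rfl hfin
  rw [← integral_inner hint]
  simp only [real_inner_smul_right]

/-- Under condition (WC), the multiplier `ξ^J ⟪e, 𝒜†[ξ] ·⟫` can be corrected by a multiplier
vanishing on the range of the symbol to have mean zero on the unit annulus. -/
theorem IsWeaklyCanceling.exists_meanZero_multiplier (hn : 1 ≤ n) (hnk : n ≤ k)
    {A : CoeffOp n k V W} (hell : IsElliptic n k A) (hwc : IsWeaklyCanceling n k A)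
    (J : Fin (k - n) → Fin n) (e : V) {ι : Type*} [Fintype ι] (b : OrthonormalBasis ι ℝ W) :
    ∃ μ : ι → Euc n → ℝ, (∀ i, ContDiff ℝ (⊤ : ℕ∞) (μ i)) ∧ (∀ i, HasCompactSupport (μ i)) ∧
      (∀ i, ∫ ξ, μ i ξ = 0) ∧
      ∀ ξ, ∑ i, μ i ξ • LinearMap.adjoint (symbolMap n k A ξ) (b i) =
        ((∏ i, ξ (J i)) * annularBump ξ) • e := by
  let Q (ξ : Euc n) (w : W) : W := w - symbolMap n k A ξ (Adagger n k A ξ w)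
  let q (w w' : W) (ξ : Euc n) : ℝ := ⟪Q ξ w, w'⟫
  let p (w : W) (ξ : Euc n) : ℝ := (∏ i, ξ (J i)) * ⟪e, Adagger n k A ξ w⟫
  have hp (w ξ) (hξ : ξ ≠ 0) : ContDiffAt ℝ (⊤ : ℕ∞) (p w) ξ :=
    contDiffAt_prod_mul_inner_Adagger hell J e w ξ hξ
  have hq (w w' ξ) (hξ : ξ ≠ 0) : ContDiffAt ℝ (⊤ : ℕ∞) (q w w') ξ := by
    have : q w w' = fun ξ => ⟪w, w'⟫ - ∑ I : Fin k → Fin n,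
        (∏ i, ξ (I i)) * ⟪LinearMap.adjoint (A I) w', Adagger n k A ξ w⟫ := by
      ext ξ
      simp only [q, Q, inner_sub_left, symbolMap_apply, sum_inner, real_inner_smul_left,
        LinearMap.adjoint_inner_left]
      simp only [real_inner_comm]
    rw [this]
    exact contDiffAt_const.sub (ContDiffAt.sum fun I _ =>
      contDiffAt_prod_mul_inner_Adagger hell I _ w ξ hξ)
  have hpi (w) : Integrable (fun ξ => p w ξ * annularBump ξ) :=
    (contDiff_mul_annularBump (hp w)).continuous.integrable_of_hasCompactSupport
      hasCompactSupport_annularBump.mul_left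
  have hqi (w w') : Integrable (fun ξ => q w w' ξ * annularBump ξ) :=
    (contDiff_mul_annularBump (hq w w')).continuous.integrable_of_hasCompactSupport
      hasCompactSupport_annularBump.mul_left
  have hbsum (w w' : W) : ∑ i, ⟪w, b i⟫ * ⟪b i, w'⟫ = ⟪w, w'⟫ := b.sum_inner_mul_inner w w'
  let T : W →ₗ[ℝ] W :=
    { toFun := fun w => ∑ i, (∫ ξ, q w (b i) ξ * annularBump ξ) • b i
      map_add' := fun w w' => by
        simp only [q, Q, map_add, add_sub_add_comm, inner_add_left, add_mul]
        rw [← Finset.sum_add_distrib]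
        refine Finset.sum_congr rfl fun i _ => ?_
        rw [← add_smul]
        congr 1
        exact integral_add (hqi w (b i)) (hqi w' (b i))
      map_smul' := fun c w => by
        simp only [q, Q, map_smul, ← smul_sub, real_inner_smul_left, mul_assoc,
          integral_const_mul, mul_smul, Finset.smul_sum, RingHom.id_apply] }
  have hT (w w' : W) : ⟪T w, w'⟫ = ∫ ξ, q w w' ξ * annularBump ξ := by
    calc ⟪T w, w'⟫ = ∑ i, (∫ ξ, q w (b i) ξ * annularBump ξ) * ⟪b i, w'⟫ := by
          simp only [T, LinearMap.coe_mk, AddHom.coe_mk, sum_inner, real_inner_smul_left]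
      _ = ∫ ξ, ∑ i, q w (b i) ξ * annularBump ξ * ⟪b i, w'⟫ := by
          rw [integral_finsetSum _ fun i _ => (hqi w (b i)).mul_const _]
          simp only [integral_mul_const]
      _ = _ := by
          congr with ξ
          simp only [q]
          rw [← hbsum, Finset.sum_mul]
          exact Finset.sum_congr rfl fun i _ => by ring
  have hq_symm (w w' ξ) (hξ : ξ ≠ 0) : q w w' ξ = q w' w ξ := by
    simp only [q, Q, inner_sub_left]
    rw [inner_symbolMap_Adagger_comm A hell hξ, real_inner_comm,
      real_inner_comm w (symbolMap n k A ξ _)]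
  have hzero : annularBump (0 : Euc n) = 0 := annularBump_eq_zero_of_le (by simp)
  have hTsymm : T.IsSymmetric := by
    intro w w'
    rw [hT, real_inner_comm, hT]
    congr with ξ
    by_cases hξ : ξ = 0
    · simp [hξ, hzero]
    · rw [hq_symm w w' ξ hξ]
  obtain ⟨c, hc, hsphere⟩ := exists_inner_setIntegral_sphere_Adagger (m := k - n) hn
    (Nat.sub_add_cancel hnk) hell
  have hker (w : W) (hw : T w = 0) : ∫ ξ, p w ξ * annularBump ξ = 0 := by
    have hrange : ∀ ξ ∈ sphere (0 : Euc n) 1, w ∈ LinearMap.range (symbolMap n k A ξ) := by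
      intro ξ hξ
      have hξ0 : ξ ≠ 0 := ne_of_mem_sphere hξ one_ne_zero
      by_contra hnot
      have hQ : Q ξ w ≠ 0 := fun h => hnot ⟨_, (sub_eq_zero.1 h).symm⟩
      have hpos : 0 < ∫ ξ, q w w ξ * annularBump ξ := by
        refine (contDiff_mul_annularBump (hq w w)).continuous
          |>.integral_pos_of_hasCompactSupport_nonneg_nonzero
          hasCompactSupport_annularBump.mul_left (fun η => ?_) (x := ξ) ?_
        · by_cases hη : η = 0
          · simp [hη, hzero]
          · simp only [q, Q, inner_residual_eq_norm_sq hell hη]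
            exact mul_nonneg (by positivity) (annularBump_nonneg η)
        · rw [annularBump_eq_one (by simpa using hξ), mul_one]
          simp only [q, Q, inner_residual_eq_norm_sq hell hξ0]
          exact pow_ne_zero 2 (norm_ne_zero_iff.2 hQ)
      rw [← hT, hw, inner_zero_left] at hpos
      exact hpos.false
    have h := hsphere J e w
    rw [hwc w hrange J, inner_zero_right] at h
    exact (mul_eq_zero.1 h.symm).resolve_left hc
  let z : W := ∑ i, (∫ ξ, p (b i) ξ * annularBump ξ) • b i
  have hz (w : W) : ⟪z, w⟫ = ∫ ξ, p w ξ * annularBump ξ := by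
    calc ⟪z, w⟫ = ∑ i, (∫ ξ, p (b i) ξ * annularBump ξ) * ⟪b i, w⟫ := by
          simp only [z, sum_inner, real_inner_smul_left]
      _ = ∫ ξ, ∑ i, p (b i) ξ * annularBump ξ * ⟪b i, w⟫ := by
          rw [integral_finsetSum _ fun i _ => (hpi (b i)).mul_const _]
          simp only [integral_mul_const]
      _ = _ := by
          congr with ξ
          conv_rhs => rw [← b.sum_repr' w]
          simp only [p, map_sum, map_smul, inner_sum, real_inner_smul_right, Finset.mul_sum,
            Finset.sum_mul]
          exact Finset.sum_congr rfl fun i _ => by ring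
  have hzT : z ∈ LinearMap.range T := by
    rw [← Submodule.orthogonal_orthogonal (LinearMap.range T), hTsymm.orthogonal_range,
      Submodule.mem_orthogonal']
    intro w hw
    rw [hz, hker w hw]
  obtain ⟨w₀, hw₀⟩ := hzT
  have hμ (i ξ) (hξ : ξ ≠ 0) :
      ContDiffAt ℝ (⊤ : ℕ∞) (fun ξ => p (b i) ξ - q w₀ (b i) ξ) ξ :=
    (hp (b i) ξ hξ).sub (hq w₀ (b i) ξ hξ)
  refine ⟨fun i ξ => (p (b i) ξ - q w₀ (b i) ξ) * annularBump ξ,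
    fun i => contDiff_mul_annularBump (hμ i),
    fun i => hasCompactSupport_annularBump.mul_left, fun i => ?_, fun ξ => ?_⟩
  · simp only [sub_mul]
    rw [integral_sub (hpi _) (hqi _ _), ← hz, ← hT, hw₀, sub_self]
  · by_cases hξ : ξ = 0
    · simp [hξ, hzero]
    refine ext_inner_right ℝ fun v => ?_
    have h1 : ∑ i, p (b i) ξ * ⟪b i, symbolMap n k A ξ v⟫ = (∏ i, ξ (J i)) * ⟪e, v⟫ := by
      conv_rhs => rw [← Adagger_symbolMap hell hξ v, ← b.sum_repr' (symbolMap n k A ξ v)]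
      simp only [p, map_sum, map_smul, inner_sum, real_inner_smul_right, Finset.mul_sum]
      exact Finset.sum_congr rfl fun i _ => by ring
    have h2 : ∑ i, q w₀ (b i) ξ * ⟪b i, symbolMap n k A ξ v⟫ = 0 := by
      simp only [q]
      rw [hbsum]
      change q w₀ _ ξ = 0
      rw [hq_symm _ _ ξ hξ]
      simp only [q, Q, Adagger_symbolMap hell hξ, sub_self, inner_zero_left]
    simp only [sum_inner, real_inner_smul_left, LinearMap.adjoint_inner_left]
    calc _ = (∑ i, p (b i) ξ * ⟪b i, symbolMap n k A ξ v⟫ -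
          ∑ i, q w₀ (b i) ξ * ⟪b i, symbolMap n k A ξ v⟫) * annularBump ξ := by
          rw [← Finset.sum_sub_distrib, Finset.sum_mul]
          exact Finset.sum_congr rfl fun i _ => by ring
      _ = _ := by rw [h1, h2]; ring

end Multiplier

section Sufficiency

variable {n k : ℕ} {V W : Type*}
  [NormedAddCommGroup V] [InnerProductSpace ℝ V] [FiniteDimensional ℝ V]
  [NormedAddCommGroup W] [InnerProductSpace ℝ W] [FiniteDimensional ℝ W]

theorem ContinuousMultilinearMap.norm_le_sum_stdVec {E : Type*} [NormedAddCommGroup E]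
    [NormedSpace ℝ E] {m : ℕ} (L : ContinuousMultilinearMap ℝ (fun _ : Fin m => Euc n) E) :
    ‖L‖ ≤ ∑ J : Fin m → Fin n, ‖L fun i => stdVec n (J i)‖ := by
  refine L.opNorm_le_bound (Finset.sum_nonneg fun _ _ => norm_nonneg _) fun v => ?_
  have hv : v = fun i => ∑ j, v i j • stdVec n j := by
    ext i j
    simp [stdVec, Pi.single_apply]
  conv_lhs => rw [hv, L.map_sum]
  simp only [L.map_smul_univ]
  refine (norm_sum_le _ _).trans ?_
  rw [Finset.sum_mul]
  refine Finset.sum_le_sum fun J _ => ?_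
  rw [norm_smul, mul_comm, norm_prod]
  gcongr with i
  exact PiLp.norm_apply_le (v i) (J i)

theorem OrthonormalBasis.norm_le_sum_abs_inner {ι E : Type*} [Fintype ι] [NormedAddCommGroup E]
    [InnerProductSpace ℝ E] (b : OrthonormalBasis ι ℝ E) (v : E) : ‖v‖ ≤ ∑ i, |⟪b i, v⟫| := by
  conv_lhs => rw [← b.sum_repr' v]
  refine (norm_sum_le _ _).trans_eq (Finset.sum_congr rfl fun i _ => ?_)
  rw [norm_smul, b.norm_eq_one, mul_one, Real.norm_eq_abs]

omit [FiniteDimensional ℝ V] in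
theorem dirDeriv_comp_add_right {m : ℕ} (J : Fin m → Fin n) (u : Euc n → V) (a x : Euc n) :
    dirDeriv n m J (fun z => u (z + a)) x = dirDeriv n m J u (x + a) := by
  rw [dirDeriv, iteratedFDeriv_comp_add_right, dirDeriv]

theorem IsWeaklyCanceling.exists_norm_iteratedFDeriv_le (hn : 1 ≤ n) (hnk : n ≤ k)
    {A : CoeffOp n k V W} (hell : IsElliptic n k A) (hwc : IsWeaklyCanceling n k A) :
    ∃ C : ℝ, 0 ≤ C ∧ ∀ u : Euc n → V, ContDiff ℝ (⊤ : ℕ∞) u → HasCompactSupport u →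
      ∀ x, ‖iteratedFDeriv ℝ (k - n) u x‖ ≤ C * ∫ x, ‖Aapply n k A u x‖ := by
  let b := stdOrthonormalBasis ℝ V
  have h (J : Fin (k - n) → Fin n) (i) : ∃ C : ℝ, 0 ≤ C ∧ ∀ u : Euc n → V,
      ContDiff ℝ (⊤ : ℕ∞) u → HasCompactSupport u →
      |⟪b i, dirDeriv n (k - n) J u 0⟫| ≤ C * ∫ x, ‖Aapply n k A u x‖ := by
    obtain ⟨μ, h1, h2, h3, h4⟩ := hwc.exists_meanZero_multiplier hn hnk hell J (b i)
      (stdOrthonormalBasis ℝ W)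
    exact exists_abs_inner_dirDeriv_zero_le hn (Nat.sub_add_cancel hnk) h1 h2 h3 h4
  choose C hC0 hC using h
  refine ⟨∑ J, ∑ i, C J i, Finset.sum_nonneg fun J _ => Finset.sum_nonneg fun i _ => hC0 J i,
    fun u hu hc x => ?_⟩
  refine (ContinuousMultilinearMap.norm_le_sum_stdVec _).trans ?_
  simp only [Finset.sum_mul]
  refine Finset.sum_le_sum fun J _ => (b.norm_le_sum_abs_inner _).trans
    (Finset.sum_le_sum fun i _ => ?_)
  have := hC J i (fun z => u (z + x)) (hu.comp (contDiff_id.add contDiff_const))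
    (hc.comp_homeomorph (Homeomorph.addRight x))
  rw [dirDeriv_comp_add_right, zero_add] at this
  refine this.trans_eq ?_
  simp only [Aapply, dirDeriv_comp_add_right]
  rw [integral_add_right_eq_self (fun z => ‖∑ I, A I (dirDeriv n k I u z)‖) x]

theorem IsWeaklyCanceling.exists_essSup_le (hn : 1 ≤ n) (hnk : n ≤ k)
    {A : CoeffOp n k V W} (hell : IsElliptic n k A) (hwc : IsWeaklyCanceling n k A) :
    ∃ C : ℝ, ∀ u : Euc n → V, ContDiff ℝ (⊤ : ℕ∞) u → HasCompactSupport u →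
        essSup (fun x => (‖iteratedFDeriv ℝ (k - n) u x‖₊ : ℝ≥0∞)) volume ≤
          ENNReal.ofReal C * ∫⁻ x, (‖Aapply n k A u x‖₊ : ℝ≥0∞) := by
  obtain ⟨C, hC0, hC⟩ := hwc.exists_norm_iteratedFDeriv_le hn hnk hell
  refine ⟨C, fun u hu hc => essSup_le_of_ae_le _ (Eventually.of_forall fun x => ?_)⟩
  have hint : Integrable (Aapply n k A u) :=
    (continuous_Aapply A hu).integrable_of_hasCompactSupport (hasCompactSupport_Aapply A hc)
  change ‖iteratedFDeriv ℝ (k - n) u x‖ₑ ≤ ENNReal.ofReal C * ∫⁻ x, ‖Aapply n k A u x‖ₑ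
  rw [← ofReal_integral_norm_eq_lintegral_enorm hint, ← ENNReal.ofReal_mul hC0,
    ← ofReal_norm]
  exact ENNReal.ofReal_le_ofReal (hC u hu hc x)

end Sufficiency

section Truncation

open scoped SchwartzMap

variable {n k : ℕ} {V W : Type*}
  [NormedAddCommGroup V] [InnerProductSpace ℝ V] [NormedAddCommGroup W] [InnerProductSpace ℝ W]

theorem norm_stdVec (i : Fin n) : ‖stdVec n i‖ = 1 := by simp [stdVec]

theorem norm_dirDeriv_le {m : ℕ} (I : Fin m → Fin n) (u : Euc n → V) (x : Euc n) :
    ‖dirDeriv n m I u x‖ ≤ ‖iteratedFDeriv ℝ m u x‖ := by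
  simpa [norm_stdVec, dirDeriv] using (iteratedFDeriv ℝ m u x).le_opNorm fun i => stdVec n (I i)

theorem Filter.EventuallyEq.Aapply_eq (A : CoeffOp n k V W) {u v : Euc n → V} {x : Euc n}
    (h : u =ᶠ[𝓝 x] v) : Aapply n k A u x = Aapply n k A v x := by
  simp only [Aapply, dirDeriv, (h.iteratedFDeriv ℝ k).eq_of_nhds]

theorem exists_norm_Aapply_le [FiniteDimensional ℝ V] (A : CoeffOp n k V W) :
    ∃ C : ℝ, 0 ≤ C ∧ ∀ (u : Euc n → V) (x : Euc n),
      ‖Aapply n k A u x‖ ≤ C * ‖iteratedFDeriv ℝ k u x‖ := by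
  refine ⟨∑ I, ‖(A I).toContinuousLinearMap‖, Finset.sum_nonneg fun I _ => norm_nonneg _,
    fun u x => (norm_sum_le _ _).trans ?_⟩
  rw [Finset.sum_mul]
  exact Finset.sum_le_sum fun I _ => ((A I).toContinuousLinearMap.le_opNorm _).trans
    (mul_le_mul_of_nonneg_left (norm_dirDeriv_le I u x) (norm_nonneg _))

theorem cutoff_smul_eventuallyEq {t : ℝ} {x : Euc n} (h : ‖t • x‖ < 1) (u : Euc n → V) :
    (fun y => cutoff (t • y) • u y) =ᶠ[𝓝 x] u := by
  have : ∀ᶠ y in 𝓝 x, ‖t • y‖ < 1 :=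
    (continuous_const_smul t).norm.continuousAt.eventually_lt continuousAt_const h
  filter_upwards [this] with y hy
  rw [cutoff_eq_one hy.le, one_smul]

/-- Derivatives of truncations by slowly varying cutoffs are dominated uniformly. -/
theorem exists_norm_iteratedFDeriv_cutoff_smul_le (m : ℕ) : ∃ C : ℝ, 0 ≤ C ∧
    ∀ (t : ℝ), |t| ≤ 1 → ∀ u : Euc n → V, ContDiff ℝ (⊤ : ℕ∞) u → ∀ x,
      ‖iteratedFDeriv ℝ m (fun y => cutoff (t • y) • u y) x‖ ≤
        C * ∑ i ∈ Finset.range (m + 1), ‖iteratedFDeriv ℝ i u x‖ := by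
  have hM (i : ℕ) : ∃ M : ℝ, ∀ x, ‖iteratedFDeriv ℝ i (cutoff : Euc n → ℝ) x‖ ≤ M :=
    (contDiff_cutoff.continuous_iteratedFDeriv (mod_cast le_top)).bounded_above_of_compact_support
      (hasCompactSupport_cutoff.iteratedFDeriv i)
  choose M hM using hM
  have hM0 (i : ℕ) : 0 ≤ M i := (norm_nonneg _).trans (hM i 0)
  have hC0 : ∀ i ∈ Finset.range (m + 1), 0 ≤ (m.choose i : ℝ) * M i := fun i _ =>
    mul_nonneg (Nat.cast_nonneg _) (hM0 i)
  refine ⟨∑ i ∈ Finset.range (m + 1), (m.choose i : ℝ) * M i, Finset.sum_nonneg hC0,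
    fun t ht u hu x => ?_⟩
  have hφ : ContDiff ℝ (⊤ : ℕ∞) fun y : Euc n => cutoff (t • y) :=
    contDiff_cutoff.comp (contDiff_const_smul t)
  refine (norm_iteratedFDeriv_smul_le hφ hu x (n := m) (mod_cast le_top)).trans ?_
  rw [Finset.sum_mul]
  refine Finset.sum_le_sum fun i hi => ?_
  have h1 : ‖iteratedFDeriv ℝ i (fun y : Euc n => cutoff (t • y)) x‖ ≤ M i := by
    rw [iteratedFDeriv_comp_const_smul t (contDiff_cutoff.of_le (mod_cast le_top)), norm_smul,
      norm_pow, Real.norm_eq_abs]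
    exact (mul_le_of_le_one_left (norm_nonneg _) (pow_le_one₀ (abs_nonneg t) ht)).trans (hM i _)
  have h2 : ‖iteratedFDeriv ℝ (m - i) u x‖ ≤
      ∑ j ∈ Finset.range (m + 1), ‖iteratedFDeriv ℝ j u x‖ :=
    Finset.single_le_sum (f := fun j => ‖iteratedFDeriv ℝ j u x‖) (fun j _ => norm_nonneg _)
      (Finset.mem_range.2 (by omega))
  have := hM0 i
  gcongr

/-- An estimate at the origin for test functions extends to Schwartz functions. -/
theorem norm_iteratedFDeriv_zero_le_of_schwartzMap [FiniteDimensional ℝ V]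
    [FiniteDimensional ℝ W] (A : CoeffOp n k V W) {m : ℕ} {C : ℝ}
    (h : ∀ u : Euc n → V, ContDiff ℝ (⊤ : ℕ∞) u → HasCompactSupport u →
      ‖iteratedFDeriv ℝ m u 0‖ ≤ C * ∫ x, ‖Aapply n k A u x‖) (u : 𝓢(Euc n, V)) :
    ‖iteratedFDeriv ℝ m u 0‖ ≤ C * ∫ x, ‖Aapply n k A u x‖ := by
  let t (j : ℕ) : ℝ := 1 / ((j : ℝ) + 1)
  have ht0 (j : ℕ) : 0 < t j := by positivity
  have ht1 (j : ℕ) : |t j| ≤ 1 := by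
    rw [abs_of_pos (ht0 j)]
    exact div_le_one_of_le₀ (by linarith [(Nat.cast_nonneg j : (0 : ℝ) ≤ j)]) (by positivity)
  have ht : Tendsto t atTop (𝓝 0) := tendsto_one_div_add_atTop_nhds_zero_nat
  have hu : ContDiff ℝ (⊤ : ℕ∞) u := u.smooth ⊤
  let v (j : ℕ) (x : Euc n) : V := cutoff (t j • x) • u x
  have hv (j : ℕ) : ContDiff ℝ (⊤ : ℕ∞) (v j) :=
    (contDiff_cutoff.comp (contDiff_const_smul (t j))).smul hu
  have hvc (j : ℕ) : HasCompactSupport (v j) :=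
    (hasCompactSupport_cutoff.comp_smul (ht0 j).ne').smul_right
  obtain ⟨C₁, hC₁, h1⟩ := exists_norm_Aapply_le A
  obtain ⟨C₂, hC₂, h2⟩ := exists_norm_iteratedFDeriv_cutoff_smul_le (n := n) (V := V) k
  have hlim : Tendsto (fun j => ∫ x, ‖Aapply n k A (v j) x‖) atTop
      (𝓝 (∫ x, ‖Aapply n k A u x‖)) := by
    refine tendsto_integral_of_dominated_convergence
      (fun x => C₁ * (C₂ * ∑ i ∈ Finset.range (k + 1), ‖iteratedFDeriv ℝ i u x‖))
      (fun j => (continuous_Aapply A (hv j)).norm.aestronglyMeasurable) ?_ (fun j => ?_) ?_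
    · refine ((integrable_finsetSum _ fun i _ => ?_).const_mul C₂).const_mul C₁
      simpa using u.integrable_pow_mul_iteratedFDeriv volume 0 i
    · refine Eventually.of_forall fun x => ?_
      rw [norm_norm]
      exact (h1 _ x).trans (mul_le_mul_of_nonneg_left (h2 _ (ht1 j) u hu x) hC₁)
    · refine Eventually.of_forall fun x => ?_
      have hx : Tendsto (fun j => ‖t j • x‖) atTop (𝓝 0) := by
        simpa using (ht.smul_const x).norm
      refine tendsto_const_nhds.congr' ?_
      filter_upwards [hx.eventually_lt_const one_pos] with j hj
      rw [(cutoff_smul_eventuallyEq hj u).Aapply_eq A]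
  refine ge_of_tendsto' (hlim.const_mul C) fun j => ?_
  have h0 : v j =ᶠ[𝓝 0] u := cutoff_smul_eventuallyEq (by simp) u
  rw [← (h0.iteratedFDeriv ℝ m).eq_of_nhds]
  exact h (v j) (hv j) (hvc j)

end Truncation

section Necessity

open scoped FourierTransform SchwartzMap LineDeriv

variable {n k : ℕ} {V W : Type*}
  [NormedAddCommGroup V] [InnerProductSpace ℝ V] [FiniteDimensional ℝ V]
  [NormedAddCommGroup W] [InnerProductSpace ℝ W] [FiniteDimensional ℝ W]

theorem symbolMap_Adagger_of_mem_range {A : CoeffOp n k V W} (hell : IsElliptic n k A) {w : W}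
    (hw : ∀ ξ ∈ sphere (0 : Euc n) 1, w ∈ LinearMap.range (symbolMap n k A ξ)) {ξ : Euc n}
    (hξ : ξ ≠ 0) : symbolMap n k A ξ (Adagger n k A ξ w) = w := by
  obtain ⟨v, hv⟩ := hw (‖ξ‖⁻¹ • ξ) (by simp [norm_smul, hξ])
  have : symbolMap n k A ξ ((‖ξ‖⁻¹) ^ k • v) = w := by
    rw [← hv, symbolMap_smul, map_smul, LinearMap.smul_apply]
  rw [← this, Adagger_symbolMap hell hξ]

/-- A real test function, as a complex-valued Schwartz function. -/
noncomputable def testSchwartz {g : Euc n → ℝ} (hg : ContDiff ℝ (⊤ : ℕ∞) g)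
    (hc : HasCompactSupport g) : 𝓢(Euc n, ℂ) :=
  HasCompactSupport.toSchwartzMap (f := fun ξ => (g ξ : ℂ))
    (hc.comp_left (g := fun v : ℝ => (v : ℂ)) (by simp)) (Complex.ofRealCLM.contDiff.comp hg)

theorem testSchwartz_apply {g : Euc n → ℝ} (hg : ContDiff ℝ (⊤ : ℕ∞) g)
    (hc : HasCompactSupport g) (ξ : Euc n) : testSchwartz hg hc ξ = (g ξ : ℂ) := rfl

theorem integral_norm_fourierInv_comp_smul {f g : 𝓢(Euc n, ℂ)} {t : ℝ} (ht : 0 < t)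
    (h : ∀ ξ, g ξ = f (t • ξ)) :
    ∫ x, ‖(𝓕⁻ g : 𝓢(Euc n, ℂ)) x‖ = ∫ x, ‖(𝓕⁻ f : 𝓢(Euc n, ℂ)) x‖ := by
  have hinv (f : 𝓢(Euc n, ℂ)) : ∫ x, ‖(𝓕⁻ f : 𝓢(Euc n, ℂ)) x‖ = ∫ x, ‖𝓕 (f : Euc n → ℂ) x‖ := by
    rw [← integral_neg_eq_self]
    simp only [SchwartzMap.fourierInv_coe, Real.fourierInv_eq_fourier_neg, neg_neg]
  have hg : (g : Euc n → ℂ) = fun ξ => f (t • ξ) := funext h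
  rw [hinv, hinv, hg]
  simp only [fourier_comp_smul f ht, norm_mul]
  rw [integral_const_mul, Measure.integral_comp_inv_smul_of_nonneg volume
    (fun x => ‖𝓕 (f : Euc n → ℂ) x‖) ht.le, finrank_euclideanSpace_fin, smul_eq_mul,
    Complex.norm_real, norm_inv, Real.norm_of_nonneg (by positivity),
    inv_mul_cancel_left₀ (by positivity)]

/-- The sum of the first `N` dyadic annular bumps towards the origin. -/
noncomputable def dyadicBump (N : ℕ) (ξ : Euc n) : ℝ :=
  ∑ j ∈ Finset.range N, annularBump ((2 : ℝ) ^ j • ξ)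

theorem contDiff_mul_dyadicBump {g : Euc n → ℝ} (hg : ∀ ξ, ξ ≠ 0 → ContDiffAt ℝ (⊤ : ℕ∞) g ξ)
    (N : ℕ) : ContDiff ℝ (⊤ : ℕ∞) fun ξ => g ξ * dyadicBump N ξ := by
  simp only [dyadicBump, Finset.mul_sum]
  refine ContDiff.sum fun j _ => ?_
  have h2 : (2 : ℝ) ^ j ≠ 0 := by positivity
  have h : ContDiff ℝ (⊤ : ℕ∞) fun ξ => g (((2 : ℝ) ^ j)⁻¹ • ξ) * annularBump ξ :=
    contDiff_mul_annularBump fun ξ hξ =>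
      (hg _ (smul_ne_zero (inv_ne_zero h2) hξ)).comp ξ (contDiff_const_smul _).contDiffAt
  simpa [Function.comp_def, smul_smul, h2] using h.comp (contDiff_const_smul ((2 : ℝ) ^ j))

theorem dyadicBump_eq (N : ℕ) (ξ : Euc n) :
    dyadicBump N ξ = cutoff ξ - cutoff ((2 : ℝ) ^ N • ξ) := by
  simpa [dyadicBump] using sum_annularBump 1 N ξ

theorem hasCompactSupport_dyadicBump (N : ℕ) :
    HasCompactSupport (dyadicBump N : Euc n → ℝ) := by
  have : (dyadicBump N : Euc n → ℝ) = fun ξ => cutoff ξ - cutoff ((2 : ℝ) ^ N • ξ) :=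
    funext (dyadicBump_eq N)
  rw [this]
  exact hasCompactSupport_cutoff.sub (hasCompactSupport_cutoff.comp_smul (by positivity))

theorem dyadicBump_zero (N : ℕ) : dyadicBump N (0 : Euc n) = 0 := by simp [dyadicBump_eq]

theorem contDiff_dyadicBump (N : ℕ) : ContDiff ℝ (⊤ : ℕ∞) (dyadicBump N : Euc n → ℝ) := by
  simpa using contDiff_mul_dyadicBump (g := fun _ => 1) (fun _ _ => contDiffAt_const) N

theorem integral_mul_dyadicBump {g : Euc n → ℝ} (hg : ∀ ξ, ξ ≠ 0 → ContDiffAt ℝ (⊤ : ℕ∞) g ξ)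
    (hh : ∀ t, 0 < t → ∀ x, x ≠ 0 → g (t • x) = (t ^ n)⁻¹ * g x) (N : ℕ) :
    ∫ ξ, g ξ * dyadicBump N ξ = N * ∫ ξ, g ξ * annularBump ξ := by
  have hint : Integrable fun ξ => g ξ * annularBump ξ :=
    (contDiff_mul_annularBump hg).continuous.integrable_of_hasCompactSupport
      hasCompactSupport_annularBump.mul_left
  have heq (j : ℕ) (ξ : Euc n) : g ξ * annularBump ((2 : ℝ) ^ j • ξ) =
      ((2 : ℝ) ^ j) ^ n * (g ((2 : ℝ) ^ j • ξ) * annularBump ((2 : ℝ) ^ j • ξ)) := by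
    rcases eq_or_ne ξ 0 with rfl | hξ
    · simp [annularBump_eq_zero_of_le (n := n) (ξ := 0) (by simp)]
    · rw [hh _ (by positivity) ξ hξ]
      field_simp
  simp only [dyadicBump, Finset.mul_sum]
  rw [integral_finsetSum _ fun j _ => ?_]
  · rw [Finset.sum_congr rfl fun j _ => ?_, Finset.sum_const, Finset.card_range, nsmul_eq_mul]
    simp only [heq j]
    rw [integral_const_mul, Measure.integral_comp_smul_of_nonneg volume
      (fun ξ : Euc n => g ξ * annularBump ξ) _ (hR := by positivity), finrank_euclideanSpace_fin,
      smul_eq_mul, mul_inv_cancel_left₀ (by positivity)]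
  · simp only [heq j]
    exact (hint.comp_smul (by positivity)).const_mul _

theorem integral_norm_fourierInv_dyadicBump_le (N : ℕ) :
    ∫ x, ‖(𝓕⁻ (testSchwartz (contDiff_dyadicBump N) (hasCompactSupport_dyadicBump N)) :
      𝓢(Euc n, ℂ)) x‖ ≤
    2 * ∫ x, ‖(𝓕⁻ (testSchwartz contDiff_cutoff hasCompactSupport_cutoff) : 𝓢(Euc n, ℂ)) x‖ := by
  set f : 𝓢(Euc n, ℂ) := testSchwartz contDiff_cutoff hasCompactSupport_cutoff
  have h2 : (0 : ℝ) < 2 ^ N := by positivity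
  let g : 𝓢(Euc n, ℂ) := testSchwartz
    (contDiff_cutoff.comp (contDiff_const_smul ((2 : ℝ) ^ N)))
    (hasCompactSupport_cutoff.comp_smul h2.ne')
  have hsub : testSchwartz (contDiff_dyadicBump N) (hasCompactSupport_dyadicBump N) = f - g := by
    ext ξ
    simp [f, g, testSchwartz_apply, dyadicBump_eq]
  rw [hsub, two_mul]
  nth_rw 2 [← integral_norm_fourierInv_comp_smul (f := f) (g := g) h2 fun ξ => rfl]
  rw [← integral_add (SchwartzMap.integrable _).norm (SchwartzMap.integrable _).norm]
  refine integral_mono (SchwartzMap.integrable _).norm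
    ((SchwartzMap.integrable _).norm.add (SchwartzMap.integrable _).norm) fun x => ?_
  rw [sub_eq_add_neg, FourierTransform.fourierInv_add, FourierTransform.fourierInv_neg,
    ← sub_eq_add_neg]
  exact norm_sub_le _ _

omit [FiniteDimensional ℝ V] [FiniteDimensional ℝ W] in
theorem inner_Aapply_eq_sum (A : CoeffOp n k V W) {ι : Type*} [Fintype ι]
    (b : OrthonormalBasis ι ℝ V) (u : Euc n → V) (x : Euc n) (w : W) :
    ⟪w, Aapply n k A u x⟫ = ∑ I, ∑ i, ⟪w, A I (b i)⟫ * ⟪b i, dirDeriv n k I u x⟫ := by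
  rw [Aapply, inner_sum]
  refine Finset.sum_congr rfl fun I _ => ?_
  conv_lhs => rw [← b.sum_repr' (dirDeriv n k I u x)]
  simp [inner_sum, real_inner_smul_right, mul_comm]

omit [FiniteDimensional ℝ V] [FiniteDimensional ℝ W] in
theorem inner_symbolMap_eq_sum (A : CoeffOp n k V W) {ι : Type*} [Fintype ι]
    (b : OrthonormalBasis ι ℝ V) (ξ : Euc n) (v : V) (w : W) :
    ⟪w, symbolMap n k A ξ v⟫ = ∑ I, ∑ i, ⟪w, A I (b i)⟫ * ((∏ j, ξ (I j)) * ⟪b i, v⟫) := by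
  rw [symbolMap_apply, inner_sum]
  refine Finset.sum_congr rfl fun I _ => ?_
  conv_lhs => rw [← b.sum_repr' v]
  simp only [map_sum, map_smul, real_inner_smul_right, inner_sum, Finset.mul_sum]
  exact Finset.sum_congr rfl fun i _ => by ring

/-- A Schwartz potential `u` with `𝒜 u` a truncated Dirac mass at the origin in direction `w`. -/
theorem exists_schwartzMap_potential {m : ℕ} (hk : m + n = k) {A : CoeffOp n k V W}
    (hell : IsElliptic n k A) {w : W}
    (hw : ∀ ξ ∈ sphere (0 : Euc n) 1, w ∈ LinearMap.range (symbolMap n k A ξ))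
    {ι : Type*} [Fintype ι] (b : OrthonormalBasis ι ℝ V) (N : ℕ) :
    ∃ u : 𝓢(Euc n, V),
      (∀ x, ‖Aapply n k A u x‖ ≤ (2 * Real.pi) ^ n * ‖w‖ *
        ‖(𝓕⁻ (testSchwartz (contDiff_dyadicBump N) (hasCompactSupport_dyadicBump N)) :
          𝓢(Euc n, ℂ)) x‖) ∧
      ∀ (J : Fin m → Fin n) (i : ι), ⟪b i, dirDeriv n m J u 0⟫ =
        ∫ ξ, ((∏ j, ξ (J j)) * ⟪b i, Adagger n k A ξ w⟫) * dyadicBump N ξ := by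
  classical
  have hpi : (2 * Real.pi * Complex.I : ℂ) ≠ 0 := by simp [Real.pi_ne_zero]
  set χ : 𝓢(Euc n, ℂ) := testSchwartz (contDiff_dyadicBump N) (hasCompactSupport_dyadicBump N)
  let c : ℂ := ((2 * Real.pi * Complex.I) ^ m)⁻¹
  let H (i : ι) : 𝓢(Euc n, ℂ) := testSchwartz
    (contDiff_mul_dyadicBump (fun ξ hξ => contDiffAt_Adagger hell hξ (b i) w) N)
    (hasCompactSupport_dyadicBump N).mul_left
  let G (i : ι) : 𝓢(Euc n, ℂ) := 𝓕⁻ (c • H i)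
  have hG (i : ι) (ξ : Euc n) : 𝓕 (G i) ξ =
      c * ((⟪b i, Adagger n k A ξ w⟫ * dyadicBump N ξ : ℝ) : ℂ) := by
    simp only [G, FourierTransform.fourier_fourierInv_eq]
    rfl
  let u : 𝓢(Euc n, V) := ∑ i, (G i).postcompCLM (Complex.reCLM.smulRight (b i))
  have hu (i : ι) {l : ℕ} (I : Fin l → Fin n) (x : Euc n) :
      ⟪b i, dirDeriv n l I u x⟫ = (dirDeriv n l I (G i) x).re := by
    have h1 := dirDeriv_clm_comp (innerSL ℝ (b i)) (u := u) (u.smooth ⊤) I x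
    have h2 := dirDeriv_clm_comp Complex.reCLM (u := G i) ((G i).smooth ⊤) I x
    rw [innerSL_apply_apply] at h1
    rw [← h1]
    refine Eq.trans ?_ h2
    congr 1
    ext y
    simp [u, sum_apply, b.inner_eq_ite]
  refine ⟨u, fun x => ?_, fun J i => ?_⟩
  · have key (w' : W) : ⟪w', Aapply n k A u x⟫ =
        ((2 * Real.pi * Complex.I) ^ n * (𝓕⁻ χ : 𝓢(Euc n, ℂ)) x).re * ⟪w', w⟫ := by
      let S : 𝓢(Euc n, ℂ) := ∑ I : Fin k → Fin n, ∑ i,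
        ((⟪w', A I (b i)⟫ : ℝ) : ℂ) • ∂^{fun j => stdVec n (I j)} (G i)
      have hS : 𝓕 S = ((2 * Real.pi * Complex.I) ^ n * ((⟪w', w⟫ : ℝ) : ℂ)) • χ := by
        ext ξ
        have hχ : ⟪w', w⟫ * dyadicBump N ξ =
            ⟪w', symbolMap n k A ξ (Adagger n k A ξ w)⟫ * dyadicBump N ξ := by
          rcases eq_or_ne ξ 0 with rfl | hξ
          · simp [dyadicBump_zero]
          · rw [symbolMap_Adagger_of_mem_range hell hw hξ]
        rw [smul_apply, testSchwartz_apply, smul_eq_mul, mul_assoc, ← Complex.ofReal_mul, hχ,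
          inner_symbolMap_eq_sum A b]
        simp only [S, FourierTransform.fourier_sum, FourierTransform.fourier_smul, sum_apply,
          smul_apply, fourier_iteratedLineDerivOp, hG, Finset.sum_mul, Complex.ofReal_sum,
          Finset.mul_sum]
        refine Finset.sum_congr rfl fun I _ => Finset.sum_congr rfl fun i _ => ?_
        have hpow : (2 * Real.pi * Complex.I : ℂ) ^ k =
            (2 * Real.pi * Complex.I) ^ m * (2 * Real.pi * Complex.I) ^ n := by rw [← hk, pow_add]
        simp only [hpow, c, smul_eq_mul]
        push_cast
        field_simp
      have hSx : S x = (2 * Real.pi * Complex.I) ^ n * ((⟪w', w⟫ : ℝ) : ℂ) *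
          (𝓕⁻ χ : 𝓢(Euc n, ℂ)) x := by
        rw [← FourierTransform.fourierInv_fourier_eq (F := 𝓢(Euc n, ℂ)) S, hS,
          FourierTransform.fourierInv_smul, smul_apply, smul_eq_mul]
      rw [inner_Aapply_eq_sum A b]
      trans (S x).re
      · simp [S, sum_apply, hu, dirDeriv_schwartzMap]
      · rw [hSx, mul_right_comm, Complex.re_mul_ofReal]
    have hA : Aapply n k A u x =
        ((2 * Real.pi * Complex.I) ^ n * (𝓕⁻ χ : 𝓢(Euc n, ℂ)) x).re • w :=
      ext_inner_left ℝ fun w' => by rw [key, real_inner_smul_right]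
    have hre : |((2 * Real.pi * Complex.I) ^ n * (𝓕⁻ χ : 𝓢(Euc n, ℂ)) x).re| ≤
        (2 * Real.pi) ^ n * ‖(𝓕⁻ χ : 𝓢(Euc n, ℂ)) x‖ :=
      (Complex.abs_re_le_norm _).trans_eq (by simp [abs_of_pos Real.pi_pos])
    rw [hA, norm_smul, Real.norm_eq_abs]
    exact (mul_le_mul_of_nonneg_right hre (norm_nonneg w)).trans_eq (mul_right_comm _ _ _)
  · rw [hu, dirDeriv_zero_eq_integral_fourier]
    simp only [hG]
    rw [← integral_const_mul, ← Complex.ofReal_re (∫ ξ : Euc n, _ * dyadicBump N ξ),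
      ← integral_complex_ofReal]
    congr 2
    ext ξ
    simp only [c]
    push_cast
    field_simp

theorem isWeaklyCanceling_of_norm_iteratedFDeriv_zero_le (hn : 1 ≤ n) (hnk : n ≤ k)
    {A : CoeffOp n k V W} (hell : IsElliptic n k A) {C : ℝ} (hC0 : 0 ≤ C)
    (h : ∀ u : Euc n → V, ContDiff ℝ (⊤ : ℕ∞) u → HasCompactSupport u →
      ‖iteratedFDeriv ℝ (k - n) u 0‖ ≤ C * ∫ x, ‖Aapply n k A u x‖) :
    IsWeaklyCanceling n k A := by
  intro w hw J
  have hk := Nat.sub_add_cancel hnk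
  obtain ⟨c, hc, hsphere⟩ := exists_inner_setIntegral_sphere_Adagger hn hk hell
  let b := stdOrthonormalBasis ℝ V
  have hzero (i) : ∫ ξ, ((∏ j, ξ (J j)) * ⟪b i, Adagger n k A ξ w⟫) * annularBump ξ = 0 := by
    set a := ∫ ξ, ((∏ j, ξ (J j)) * ⟪b i, Adagger n k A ξ w⟫) * annularBump ξ
    set K := ∫ x, ‖(𝓕⁻ (testSchwartz contDiff_cutoff hasCompactSupport_cutoff) :
      𝓢(Euc n, ℂ)) x‖
    have hN (N : ℕ) : N * |a| ≤ C * ((2 * Real.pi) ^ n * ‖w‖ * (2 * K)) := by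
      obtain ⟨u, hu1, hu2⟩ := exists_schwartzMap_potential hk hell hw b N
      have h2 := hu2 J i
      rw [integral_mul_dyadicBump (contDiffAt_prod_mul_inner_Adagger hell J (b i) w)
        (fun t ht ξ hξ => prod_mul_inner_Adagger_smul hk hell J (b i) w ht hξ)] at h2
      calc N * |a| = |⟪b i, dirDeriv n (k - n) J u 0⟫| := by rw [h2, abs_mul, Nat.abs_cast]
        _ ≤ ‖dirDeriv n (k - n) J u 0‖ := by
          simpa using abs_real_inner_le_norm (b i) (dirDeriv n (k - n) J u 0)
        _ ≤ ‖iteratedFDeriv ℝ (k - n) u 0‖ := norm_dirDeriv_le J u 0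
        _ ≤ C * ∫ x, ‖Aapply n k A u x‖ := norm_iteratedFDeriv_zero_le_of_schwartzMap A h u
        _ ≤ _ := by
          gcongr
          refine (integral_mono_of_nonneg (Eventually.of_forall fun x => norm_nonneg _)
            ((SchwartzMap.integrable _).norm.const_mul _) (Eventually.of_forall hu1)).trans ?_
          rw [integral_const_mul]
          gcongr
          exact integral_norm_fourierInv_dyadicBump_le N
    by_contra ha
    obtain ⟨N, hN'⟩ := exists_nat_gt (C * ((2 * Real.pi) ^ n * ‖w‖ * (2 * K)) / |a|)
    rw [div_lt_iff₀ (abs_pos.2 ha)] at hN'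
    exact (hN N).not_gt hN'
  rw [← norm_le_zero_iff]
  refine (b.norm_le_sum_abs_inner _).trans_eq (Finset.sum_eq_zero fun i _ => ?_)
  rw [hsphere, hzero, mul_zero, abs_zero]

theorem isWeaklyCanceling_of_essSup_le (hn : 1 ≤ n) (hnk : n ≤ k)
    {A : CoeffOp n k V W} (hell : IsElliptic n k A) {C : ℝ}
    (h : ∀ u : Euc n → V, ContDiff ℝ (⊤ : ℕ∞) u → HasCompactSupport u →
        essSup (fun x => (‖iteratedFDeriv ℝ (k - n) u x‖₊ : ℝ≥0∞)) volume ≤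
          ENNReal.ofReal C * ∫⁻ x, (‖Aapply n k A u x‖₊ : ℝ≥0∞)) :
    IsWeaklyCanceling n k A := by
  refine isWeaklyCanceling_of_norm_iteratedFDeriv_zero_le hn hnk hell (le_max_right C 0)
    fun u hu hc => ?_
  have hint : Integrable (Aapply n k A u) :=
    (continuous_Aapply A hu).integrable_of_hasCompactSupport (hasCompactSupport_Aapply A hc)
  have hle (m : ℕ) : (m : WithTop ℕ∞) ≤ ((⊤ : ℕ∞) : WithTop ℕ∞) := mod_cast le_top
  have hcont : Continuous fun x => ‖iteratedFDeriv ℝ (k - n) u x‖ₑ :=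
    (hu.continuous_iteratedFDeriv (hle _)).enorm
  have h0 : ‖iteratedFDeriv ℝ (k - n) u 0‖ₑ ≤
      essSup (fun x => ‖iteratedFDeriv ℝ (k - n) u x‖ₑ) volume := by
    by_contra! hlt
    have hopen : IsOpen {x | essSup (fun x => ‖iteratedFDeriv ℝ (k - n) u x‖ₑ) volume <
        ‖iteratedFDeriv ℝ (k - n) u x‖ₑ} := isOpen_lt continuous_const hcont
    refine (hopen.measure_pos volume ⟨0, hlt⟩).ne' ?_
    simpa [ae_iff] using ENNReal.ae_le_essSup (μ := volume)
      fun x => ‖iteratedFDeriv ℝ (k - n) u x‖ₑ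
  have h1 : ‖iteratedFDeriv ℝ (k - n) u 0‖ₑ ≤
      ENNReal.ofReal C * ∫⁻ x, ‖Aapply n k A u x‖ₑ := h0.trans (h u hu hc)
  rw [← ofReal_integral_norm_eq_lintegral_enorm hint,
    ← ENNReal.ofReal_mul' (integral_nonneg fun _ => norm_nonneg _), ← ofReal_norm] at h1
  have hnn : 0 ≤ ∫ x, ‖Aapply n k A u x‖ := integral_nonneg fun _ => norm_nonneg _
  rcases ENNReal.ofReal_le_ofReal_iff'.1 h1 with h2 | h2
  · exact h2.trans (mul_le_mul_of_nonneg_right (le_max_left _ _) hnn)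
  · exact h2.trans (mul_nonneg (le_max_right _ _) hnn)

end Necessity

/-- Theorem 1.2: for an elliptic operator `𝒜` of order `k ≥ n ≥ 1`,
the estimate `‖D^{k-n} u‖_{L^∞} ≤ C ‖𝒜 u‖_{L¹}` holds for all `u ∈ C^∞_c(ℝ^n, V)`
if and only if `𝒜` satisfies condition (WC). -/
theorem statement2 (n k : ℕ) (hn : 1 ≤ n) (hnk : n ≤ k) {V W : Type*}
    [NormedAddCommGroup V] [InnerProductSpace ℝ V] [FiniteDimensional ℝ V]
    [NormedAddCommGroup W] [InnerProductSpace ℝ W] [FiniteDimensional ℝ W]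
    (A : CoeffOp n k V W) (hA : IsSymmetricOp n k A) (hell : IsElliptic n k A) :
    (∃ C : ℝ, ∀ u : Euc n → V, ContDiff ℝ (⊤ : ℕ∞) u → HasCompactSupport u →
        essSup (fun x => (‖iteratedFDeriv ℝ (k - n) u x‖₊ : ℝ≥0∞)) volume ≤
          ENNReal.ofReal C * ∫⁻ x, (‖Aapply n k A u x‖₊ : ℝ≥0∞)) ↔
      IsWeaklyCanceling n k A :=
  ⟨fun ⟨_, hC⟩ => isWeaklyCanceling_of_essSup_le hn hnk hell hC,
    fun h => h.exists_essSup_le hn hnk hell⟩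
end
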